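/- Let (T²,g) be a Riemannian torus, c: ℝ → ℝ² a geodesic on the universal covering, and α a minimal axis such that c(a), c(b) ∈ α(ℝ) for some a < b. If there exists a translation element τ with τ(α(ℝ)) ∩ α(ℝ) = ∅ and such that τ(α(ℝ)) intersects c([a,b]) transversally, then the geodesic flow of g has positive topological entropy. -/

import Mathlib

open Filter Topology Set
open scoped ENNReal

noncomputable section

/-- The Euclidean norm of a point of `ℝ × ℝ` (the universal covering of `T²`). -/
def norm2 (p : ℝ × ℝ) : ℝ := Real.sqrt (p.1 ^ 2 + p.2 ^ 2)

/-- The translation vector of the covering transformation `τ_{(m,n)}` of `T² = ℝ²/ℤ²`. -/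
def lat (k : ℤ × ℤ) : ℝ × ℝ := ((k.1 : ℝ), (k.2 : ℝ))

/-- The transl of a curve in `ℝ²` by the covering transformation `τ_k`. -/
def transl (k : ℤ × ℤ) (c : ℝ → ℝ × ℝ) : ℝ → ℝ × ℝ := fun t => c t + lat k

/-- The asymptotic direction `δ(τ_k)` of the axes of the translation element `τ_k`. -/
def latDir (k : ℤ × ℤ) : ℝ × ℝ := (norm2 (lat k))⁻¹ • lat k

/-- A smooth Riemannian metric on the torus `T² = ℝ²/ℤ²`, described through its lift to the
universal covering `ℝ²`: a smooth family of positive definite symmetric bilinear forms on the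
tangent spaces of `ℝ²`, invariant under the deck transformation group `ℤ²`. -/
structure TorusMetric where
  g : (ℝ × ℝ) → (ℝ × ℝ) → (ℝ × ℝ) → ℝ
  smooth : ContDiff ℝ (⊤ : ℕ∞) fun p : (ℝ × ℝ) × (ℝ × ℝ) × (ℝ × ℝ) => g p.1 p.2.1 p.2.2
  symm : ∀ x v w, g x v w = g x w v
  linear : ∀ x w, IsLinearMap ℝ fun v => g x v w
  posdef : ∀ x v, v ≠ 0 → 0 < g x v v
  periodic : ∀ (k : ℤ × ℤ) (x v w : ℝ × ℝ), g (x + lat k) v w = g x v w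

namespace TorusMetric

/-- The Riemannian length of the curve `c` between the parameters `a` and `b`. -/
def length (M : TorusMetric) (c : ℝ → ℝ × ℝ) (a b : ℝ) : ℝ :=
  ∫ t in a..b, Real.sqrt (M.g (c t) (deriv c t) (deriv c t))

/-- The Riemannian distance on the universal covering `ℝ²` (hence also on `T²`). -/
def dist (M : TorusMetric) (x y : ℝ × ℝ) : ℝ :=
  sInf {L | ∃ c : ℝ → ℝ × ℝ, ContDiff ℝ 1 c ∧ c 0 = x ∧ c 1 = y ∧ L = M.length c 0 1}

/-- A (complete, unit speed) geodesic of the lifted metric on the universal covering `ℝ²`: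
a smooth curve with constant unit speed which is locally length minimizing. -/
def IsGeodesic (M : TorusMetric) (c : ℝ → ℝ × ℝ) : Prop :=
  ContDiff ℝ (⊤ : ℕ∞) c ∧ (∀ t, M.g (c t) (deriv c t) (deriv c t) = 1) ∧
    ∀ t : ℝ, ∃ ε > 0, ∀ s₁ s₂, t - ε ≤ s₁ → s₁ ≤ s₂ → s₂ ≤ t + ε →
      M.dist (c s₁) (c s₂) = M.length c s₁ s₂

end TorusMetric

/-- The distance between two points of the unit tangent bundle `ST²` of the torus; points of
`ST²` are represented by points of the tangent bundle `ℝ² × ℝ²` of the universal covering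
(the deck transformations act trivially on the vector component). -/
def phaseDist (p q : (ℝ × ℝ) × (ℝ × ℝ)) : ℝ :=
  sInf {r : ℝ | ∃ k : ℤ × ℤ, r = norm2 (p.1 - (q.1 + lat k)) + norm2 (p.2 - q.2)}

/-- A `(φ,ε)`-separated set with respect to time `T` for the geodesic flow `φ` of `M` on
`ST²`: a finite family of geodesics (each geodesic `c` representing the phase point
`(c 0, ċ 0) ∈ ST²`, of which `t ↦ (c t, ċ t)` is the flow orbit) such that any two distinct
members satisfy `max_{0 ≤ t ≤ T} d(φᵗ v, φᵗ w) > ε`. -/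
def IsSeparated (M : TorusMetric) (ε T : ℝ) (F : Finset (ℝ → ℝ × ℝ)) : Prop :=
  (∀ c ∈ F, M.IsGeodesic c) ∧
    ∀ c₁ ∈ F, ∀ c₂ ∈ F, c₁ ≠ c₂ →
      ∃ t ∈ Set.Icc (0 : ℝ) T, ε < phaseDist (c₁ t, deriv c₁ t) (c₂ t, deriv c₂ t)

/-- `r_T(φ, ε)`: the maximal cardinality of `(φ,ε)`-separated sets with respect to `T`. -/
def sepCount (M : TorusMetric) (ε T : ℝ) : ℝ≥0∞ :=
  ⨆ (F : Finset (ℝ → ℝ × ℝ)) (_ : IsSeparated M ε T F), (F.card : ℝ≥0∞)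

/-- Extended real logarithm of an extended nonnegative real. -/
def elog (x : ℝ≥0∞) : EReal :=
  if x = 0 then ⊥ else if x = ⊤ then ⊤ else ((Real.log x.toReal : ℝ) : EReal)

/-- Bowen's topological entropy `h_top(g)` of the geodesic flow of `g` on `ST²`:
`lim_{ε → 0} limsup_{T → ∞} (1/T) log r_T(φ,ε)`; since `r_T(φ,ε)` is monotone in `ε`,
the limit `ε → 0` is realized as the supremum over `ε > 0`. -/
def topEnt (M : TorusMetric) : EReal :=
  ⨆ (ε : ℝ) (_ : 0 < ε),
    Filter.limsup (fun T : ℝ => ((T⁻¹ : ℝ) : EReal) * elog (sepCount M ε T)) Filter.atTop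

/-- The forward ray `c⁺` of `c` is escaping: `‖c(t)‖ → ∞` as `t → ∞`. -/
def EscapesForward (c : ℝ → ℝ × ℝ) : Prop :=
  Filter.Tendsto (fun t => norm2 (c t)) Filter.atTop Filter.atTop

/-- The backward ray `c⁻` of `c` is escaping: `‖c(-t)‖ → ∞` as `t → ∞`. -/
def EscapesBackward (c : ℝ → ℝ × ℝ) : Prop :=
  Filter.Tendsto (fun t => norm2 (c (-t))) Filter.atTop Filter.atTop

/-- `z ∈ S¹` is the asymptotic direction `δ(c⁺) = lim_{t → ∞} c(t)/‖c(t)‖` of the forward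
ray of `c`. -/
def HasDirection (c : ℝ → ℝ × ℝ) (z : ℝ × ℝ) : Prop :=
  norm2 z = 1 ∧ Filter.Tendsto (fun t => (norm2 (c t))⁻¹ • c t) Filter.atTop (nhds z)

/-- The canonical projection `π : S¹ → P¹(ℝ) ≅ ℝ ∪ {∞}`, sending `(x, y)` to `y/x` if
`x ≠ 0` and to `∞` otherwise; `ℝ ∪ {∞}` is the one-point compactification of `ℝ`. -/
def projPt (z : ℝ × ℝ) : OnePoint ℝ :=
  if z.1 = 0 then OnePoint.infty else ((z.2 / z.1 : ℝ) : OnePoint ℝ)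

/-- `crossDet v w ≠ 0` expresses transversality of two directions in `ℝ²`. -/
def crossDet (v w : ℝ × ℝ) : ℝ := v.1 * w.2 - v.2 * w.1

/-- The set of points at which the curve `c₁` (restricted to parameters in `D₁`) and the
curve `c₂` (restricted to parameters in `D₂`) intersect transversally. -/
def transInter (c₁ c₂ : ℝ → ℝ × ℝ) (D₁ D₂ : Set ℝ) : Set (ℝ × ℝ) :=
  {x | ∃ s ∈ D₁, ∃ t ∈ D₂, c₁ s = x ∧ c₂ t = x ∧ crossDet (deriv c₁ s) (deriv c₂ t) ≠ 0}

/-- The geodesic `c` is an axis of the (nontrivial) translation element `τ_k`: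
`τ_k c(t) = c(t + ℓ)` for some `ℓ` and all `t`. -/
def IsAxisOf (M : TorusMetric) (c : ℝ → ℝ × ℝ) (k : ℤ × ℤ) : Prop :=
  M.IsGeodesic c ∧ k ≠ 0 ∧ ∃ ℓ : ℝ, ∀ t, c (t + ℓ) = c t + lat k

/-- The geodesic `c` is an axis of some nontrivial translation element. -/
def IsAxis (M : TorusMetric) (c : ℝ → ℝ × ℝ) : Prop := ∃ k : ℤ × ℤ, IsAxisOf M c k

/-- The curve `c` is minimal: each of its segments minimizes the Riemannian length between
its endpoints. -/
def IsMinimal (M : TorusMetric) (c : ℝ → ℝ × ℝ) : Prop :=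
  ∀ s t : ℝ, s ≤ t → M.dist (c s) (c t) = M.length c s t

/-- Equivalence of translation elements: `τ₁^a = τ₂^b` for some nonzero integers `a, b`. -/
def TransEquiv (k₁ k₂ : ℤ × ℤ) : Prop := ∃ a b : ℤ, a ≠ 0 ∧ b ≠ 0 ∧ a • k₁ = b • k₂

/-- A translation element is primitive if it is not a nontrivial power of another
translation element. -/
def IsPrimitive (k : ℤ × ℤ) : Prop := k ≠ 0 ∧ ∀ (j : ℤ × ℤ) (n : ℤ), k = n • j → IsUnit n

/-- The metric `g` on `T²` is flat, i.e. its Gaussian curvature vanishes identically;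
equivalently (by the theorems of Myers–Steenrod and Cartan–Hadamard), the universal covering
`ℝ²` with the induced Riemannian distance is isometric to the Euclidean plane. -/
def IsFlat (M : TorusMetric) : Prop :=
  ∃ F : (ℝ × ℝ) ≃ (ℝ × ℝ), ∀ x y, M.dist x y = norm2 (F x - F y)

/-- The plane, universal covering of the torus. -/
abbrev Plane := ℝ × ℝ

@[simp] lemma lat_zero : lat 0 = 0 := by simp [lat]

lemma lat_add (k l : ℤ × ℤ) : lat (k + l) = lat k + lat l := by simp [lat]

lemma lat_neg (k : ℤ × ℤ) : lat (-k) = -lat k := by simp [lat]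

lemma lat_zsmul (n : ℤ) (k : ℤ × ℤ) : lat (n • k) = (n : ℝ) • lat k := by simp [lat]

lemma lat_injective : Function.Injective lat := by
  intro k l h
  simpa [lat, Prod.ext_iff] using h

lemma exists_mem_unitSquare (x : Plane) :
    ∃ k : ℤ × ℤ, x + lat k ∈ Icc (0 : ℝ) 1 ×ˢ Icc (0 : ℝ) 1 := by
  refine ⟨(-⌊x.1⌋, -⌊x.2⌋), ?_⟩
  simp only [lat, mem_prod, Prod.fst_add, Prod.snd_add, mem_Icc]
  push_cast
  refine ⟨⟨?_, ?_⟩, ?_, ?_⟩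
  · linarith [Int.floor_le x.1]
  · linarith [Int.lt_floor_add_one x.1]
  · linarith [Int.floor_le x.2]
  · linarith [Int.lt_floor_add_one x.2]

lemma exists_bound_of_periodic {F : Type*} [NormedAddCommGroup F] {f : Plane → F}
    (hf : Continuous f) (hper : ∀ k x, f (x + lat k) = f x) : ∃ C, 0 < C ∧ ∀ x, ‖f x‖ ≤ C := by
  obtain ⟨C, hC⟩ := (isCompact_Icc.prod isCompact_Icc :
    IsCompact (Icc (0 : ℝ) 1 ×ˢ Icc (0 : ℝ) 1)).exists_bound_of_continuousOn hf.continuousOn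
  refine ⟨max C 1, by positivity, fun x => ?_⟩
  obtain ⟨k, hk⟩ := exists_mem_unitSquare x
  rw [← hper k x]
  exact (hC _ hk).trans (le_max_left _ _)

namespace TorusMetric

variable (M : TorusMetric)

/-- The Riemannian norm of the tangent vector `v` at `x`. -/
def nrm (x v : Plane) : ℝ := Real.sqrt (M.g x v v)

lemma g_add_left (x u v w : Plane) : M.g x (u + v) w = M.g x u w + M.g x v w :=
  (M.linear x w).map_add u v

lemma g_smul_left (x : Plane) (a : ℝ) (v w : Plane) : M.g x (a • v) w = a * M.g x v w :=
  (M.linear x w).map_smul a v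

lemma g_add_right (x u v w : Plane) : M.g x u (v + w) = M.g x u v + M.g x u w := by
  rw [M.symm, g_add_left, M.symm x v, M.symm x w]

lemma g_smul_right (x : Plane) (a : ℝ) (v w : Plane) : M.g x v (a • w) = a * M.g x v w := by
  rw [M.symm, g_smul_left, M.symm x w]

lemma g_neg_left (x v w : Plane) : M.g x (-v) w = -M.g x v w := by
  simpa using M.g_smul_left x (-1) v w

lemma g_neg_right (x v w : Plane) : M.g x v (-w) = -M.g x v w := by
  simpa using M.g_smul_right x (-1) v w

lemma g_sub_left (x u v w : Plane) : M.g x (u - v) w = M.g x u w - M.g x v w := by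
  rw [sub_eq_add_neg, g_add_left, g_neg_left, sub_eq_add_neg]

lemma g_sub_right (x u v w : Plane) : M.g x u (v - w) = M.g x u v - M.g x u w := by
  rw [sub_eq_add_neg, g_add_right, g_neg_right, sub_eq_add_neg]

@[simp] lemma g_zero_left (x w : Plane) : M.g x 0 w = 0 := by
  simpa using M.g_smul_left x 0 0 w

@[simp] lemma g_zero_right (x w : Plane) : M.g x w 0 = 0 := by
  rw [M.symm]; exact M.g_zero_left x w

lemma g_self_nonneg (x v : Plane) : 0 ≤ M.g x v v := by
  rcases eq_or_ne v 0 with rfl | h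
  · simp
  · exact (M.posdef x v h).le

lemma nrm_nonneg (x v : Plane) : 0 ≤ M.nrm x v := Real.sqrt_nonneg _

lemma nrm_sq (x v : Plane) : M.nrm x v ^ 2 = M.g x v v := Real.sq_sqrt (M.g_self_nonneg x v)

@[simp] lemma nrm_zero (x : Plane) : M.nrm x 0 = 0 := by simp [nrm]

lemma nrm_smul (x : Plane) (a : ℝ) (v : Plane) : M.nrm x (a • v) = |a| * M.nrm x v := by
  unfold nrm
  rw [g_smul_left, g_smul_right, ← mul_assoc, ← sq, Real.sqrt_mul (sq_nonneg a),
    Real.sqrt_sq_eq_abs]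

lemma nrm_neg (x v : Plane) : M.nrm x (-v) = M.nrm x v := by
  simpa using M.nrm_smul x (-1) v

lemma nrm_add_lat (x : Plane) (k : ℤ × ℤ) (v : Plane) : M.nrm (x + lat k) v = M.nrm x v := by
  simp [nrm, M.periodic]

/-- Cauchy–Schwarz. -/
lemma g_le_nrm_mul (x v w : Plane) : M.g x v w ≤ M.nrm x v * M.nrm x w := by
  have h : ∀ t : ℝ, 0 ≤ M.g x w w * (t * t) + (2 * M.g x v w) * t + M.g x v v := fun t => by
    have := M.g_self_nonneg x (v + t • w)
    rw [g_add_left, g_add_right, g_add_right, g_smul_left, g_smul_left, g_smul_right,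
      g_smul_right, M.symm x w v] at this
    linarith
  have hd := discrim_le_zero h
  rw [discrim] at hd
  refine le_of_abs_le (abs_le_of_sq_le_sq ?_ (mul_nonneg (M.nrm_nonneg x v) (M.nrm_nonneg x w)))
  rw [mul_pow, nrm_sq, nrm_sq]
  nlinarith

lemma continuous_g : Continuous fun p : Plane × Plane × Plane => M.g p.1 p.2.1 p.2.2 :=
  M.smooth.continuous

lemma continuous_nrm : Continuous fun p : Plane × Plane => M.nrm p.1 p.2 :=
  Real.continuous_sqrt.comp
    (M.continuous_g.comp (continuous_fst.prodMk (continuous_snd.prodMk continuous_snd)))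

@[fun_prop] lemma _root_.Continuous.nrm {X : Type*} [TopologicalSpace X] {M : TorusMetric}
    {f h : X → Plane} (hf : Continuous f) (hh : Continuous h) :
    Continuous fun t => M.nrm (f t) (h t) := M.continuous_nrm.comp (hf.prodMk hh)

lemma exists_nrm_bounds : ∃ m Λ : ℝ, 0 < m ∧ 0 < Λ ∧
    ∀ x v, m * ‖v‖ ≤ M.nrm x v ∧ M.nrm x v ≤ Λ * ‖v‖ := by
  have hK : IsCompact ((Icc (0 : ℝ) 1 ×ˢ Icc (0 : ℝ) 1) ×ˢ Metric.sphere (0 : Plane) 1) :=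
    (isCompact_Icc.prod isCompact_Icc).prod (isCompact_sphere _ _)
  have hne : ((Icc (0 : ℝ) 1 ×ˢ Icc (0 : ℝ) 1) ×ˢ Metric.sphere (0 : Plane) 1).Nonempty :=
    ⟨((0, 0), (1, 0)), by simp⟩
  obtain ⟨p, hp, hpmin⟩ := hK.exists_isMinOn hne M.continuous_nrm.continuousOn
  obtain ⟨q, hq, hqmax⟩ := hK.exists_isMaxOn hne M.continuous_nrm.continuousOn
  have hpos : 0 < M.nrm p.1 p.2 := Real.sqrt_pos.2 (M.posdef _ _ (by
    rintro h
    have : ‖p.2‖ = 1 := by simpa using hp.2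
    simp [h] at this))
  refine ⟨M.nrm p.1 p.2, M.nrm q.1 q.2, hpos, hpos.trans_le (hpmin hq), fun x v => ?_⟩
  rcases eq_or_ne v 0 with rfl | hv
  · simp
  obtain ⟨k, hk⟩ := exists_mem_unitSquare x
  have hv' : 0 < ‖v‖ := norm_pos_iff.2 hv
  have hu : (x + lat k, ‖v‖⁻¹ • v) ∈
      (Icc (0 : ℝ) 1 ×ˢ Icc (0 : ℝ) 1) ×ˢ Metric.sphere (0 : Plane) 1 :=
    ⟨hk, by simp [norm_smul, hv'.ne']⟩
  have h1 := hpmin hu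
  have h2 := hqmax hu
  simp only [mem_ofPred_eq, nrm_add_lat, nrm_smul, abs_inv, abs_norm] at h1 h2
  rw [inv_mul_eq_div, le_div_iff₀ hv'] at h1
  rw [inv_mul_eq_div, div_le_iff₀ hv'] at h2
  exact ⟨h1, h2⟩

/-- Lower bound of the Riemannian norm in terms of the sup norm. -/
def lo : ℝ := M.exists_nrm_bounds.choose

/-- Upper bound of the Riemannian norm in terms of the sup norm. -/
def up : ℝ := M.exists_nrm_bounds.choose_spec.choose

lemma lo_pos : 0 < M.lo := M.exists_nrm_bounds.choose_spec.choose_spec.1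

lemma up_pos : 0 < M.up := M.exists_nrm_bounds.choose_spec.choose_spec.2.1

lemma lo_le_nrm (x v : Plane) : M.lo * ‖v‖ ≤ M.nrm x v :=
  (M.exists_nrm_bounds.choose_spec.choose_spec.2.2 x v).1

lemma nrm_le_up (x v : Plane) : M.nrm x v ≤ M.up * ‖v‖ :=
  (M.exists_nrm_bounds.choose_spec.choose_spec.2.2 x v).2

lemma g_eq_sum (x v w : Plane) : M.g x v w =
    v.1 * w.1 * M.g x (1, 0) (1, 0) + v.1 * w.2 * M.g x (1, 0) (0, 1) +
      v.2 * w.1 * M.g x (0, 1) (1, 0) + v.2 * w.2 * M.g x (0, 1) (0, 1) := by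
  have h : ∀ u : Plane, u = u.1 • ((1, 0) : Plane) + u.2 • ((0, 1) : Plane) := fun u => by
    ext <;> simp
  conv_lhs => rw [h v, h w]
  simp only [g_add_left, g_add_right, g_smul_left, g_smul_right]
  ring

lemma contDiff_g_const (v w : Plane) : ContDiff ℝ (⊤ : ℕ∞) fun x => M.g x v w :=
  M.smooth.comp (contDiff_id.prodMk (contDiff_const (c := (v, w))))

lemma exists_lipschitz_g_const (v w : Plane) :
    ∃ C, 0 < C ∧ ∀ x y, |M.g x v w - M.g y v w| ≤ C * ‖x - y‖ := by
  have hd := M.contDiff_g_const v w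
  obtain ⟨C, hC, hb⟩ := exists_bound_of_periodic (f := fderiv ℝ fun x => M.g x v w)
    (hd.continuous_fderiv (by simp)) (fun k x => by
      have : (fun y => M.g y v w) = fun y => M.g (y + lat k) v w := by
        ext y; rw [M.periodic]
      conv_rhs => rw [this]
      rw [fderiv_comp_add_right (f := fun y => M.g y v w)])
  refine ⟨C, hC, fun x y => ?_⟩
  exact Convex.norm_image_sub_le_of_norm_fderiv_le (𝕜 := ℝ) (s := univ)
    (fun z _ => (hd.differentiable (by simp)).differentiableAt) (fun z _ => hb z) convex_univ
    (mem_univ y) (mem_univ x)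

lemma exists_lipschitz_g : ∃ C, 0 < C ∧ ∀ x y v,
    |M.g x v v - M.g y v v| ≤ C * ‖x - y‖ * ‖v‖ ^ 2 := by
  obtain ⟨C₁, h₁, H₁⟩ := M.exists_lipschitz_g_const (1, 0) (1, 0)
  obtain ⟨C₂, h₂, H₂⟩ := M.exists_lipschitz_g_const (1, 0) (0, 1)
  obtain ⟨C₃, h₃, H₃⟩ := M.exists_lipschitz_g_const (0, 1) (1, 0)
  obtain ⟨C₄, h₄, H₄⟩ := M.exists_lipschitz_g_const (0, 1) (0, 1)
  refine ⟨C₁ + C₂ + C₃ + C₄, by positivity, fun x y v => ?_⟩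
  have hv1 : |v.1| ≤ ‖v‖ := norm_fst_le v
  have hv2 : |v.2| ≤ ‖v‖ := norm_snd_le v
  have key : ∀ {a b z C : ℝ}, |a| ≤ ‖v‖ → |b| ≤ ‖v‖ → |z| ≤ C * ‖x - y‖ →
      |a * b * z| ≤ ‖v‖ ^ 2 * (C * ‖x - y‖) := fun ha hb hz => by
    rw [abs_mul, abs_mul, sq]
    gcongr
  rw [M.g_eq_sum x, M.g_eq_sum y]
  have e : ∀ a b c d p q r s p' q' r' s' : ℝ, a * p + b * q + c * r + d * s -
      (a * p' + b * q' + c * r' + d * s') =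
      a * (p - p') + b * (q - q') + c * (r - r') + d * (s - s') := by intros; ring
  rw [e]
  refine (abs_add_le _ _).trans ((add_le_add ((abs_add_le _ _).trans
    (add_le_add (abs_add_le _ _) le_rfl)) le_rfl).trans ?_)
  have := key hv1 hv1 (H₁ x y)
  have := key hv1 hv2 (H₂ x y)
  have := key hv2 hv1 (H₃ x y)
  have := key hv2 hv2 (H₄ x y)
  nlinarith

lemma exists_nrm_le_mul : ∃ K, 0 < K ∧ ∀ x y v,
    M.nrm x v ≤ (1 + K * ‖x - y‖) * M.nrm y v := by
  obtain ⟨C, hC, H⟩ := M.exists_lipschitz_g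
  refine ⟨C / M.lo ^ 2, div_pos hC (pow_pos M.lo_pos 2), fun x y v => ?_⟩
  have h0 : 0 ≤ C / M.lo ^ 2 * ‖x - y‖ :=
    mul_nonneg (div_pos hC (pow_pos M.lo_pos 2)).le (norm_nonneg _)
  refine Real.sqrt_le_iff.2 ⟨mul_nonneg (by linarith) (M.nrm_nonneg _ _), ?_⟩
  rw [mul_pow, nrm_sq]
  have h1 := (abs_le.1 (H x y v)).2
  have h2 : M.lo ^ 2 * ‖v‖ ^ 2 ≤ M.g y v v := by
    rw [← nrm_sq, ← mul_pow]
    have := M.lo_le_nrm y v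
    have := M.lo_pos
    gcongr
  have h3 : C * ‖x - y‖ * ‖v‖ ^ 2 ≤ C / M.lo ^ 2 * ‖x - y‖ * M.g y v v := by
    have : C * ‖x - y‖ * ‖v‖ ^ 2 = C / M.lo ^ 2 * ‖x - y‖ * (M.lo ^ 2 * ‖v‖ ^ 2) := by
      have := M.lo_pos.ne'
      field_simp
    rw [this]
    gcongr
  have h4 := M.g_self_nonneg y v
  linarith [mul_nonneg h0 h4, mul_nonneg (mul_nonneg h0 h0) h4]

/-- Distortion constant of the metric. -/
def dst : ℝ := M.exists_nrm_le_mul.choose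

lemma dst_pos : 0 < M.dst := M.exists_nrm_le_mul.choose_spec.1

lemma nrm_le_mul (x y v : Plane) : M.nrm x v ≤ (1 + M.dst * ‖x - y‖) * M.nrm y v :=
  M.exists_nrm_le_mul.choose_spec.2 x y v

end TorusMetric

namespace TorusMetric

variable (M : TorusMetric)

lemma length_eq (c : ℝ → Plane) (a b : ℝ) :
    M.length c a b = ∫ t in a..b, M.nrm (c t) (deriv c t) := rfl

variable {M}

lemma continuous_speed {c : ℝ → Plane} (hc : ContDiff ℝ 1 c) :
    Continuous fun t => M.nrm (c t) (deriv c t) :=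
  hc.continuous.nrm (hc.continuous_deriv le_rfl)

lemma length_nonneg (c : ℝ → Plane) {a b : ℝ} (h : a ≤ b) : 0 ≤ M.length c a b :=
  intervalIntegral.integral_nonneg h fun _ _ => M.nrm_nonneg _ _

lemma length_add {c : ℝ → Plane} (hc : ContDiff ℝ 1 c) (a b d : ℝ) :
    M.length c a b + M.length c b d = M.length c a d :=
  intervalIntegral.integral_add_adjacent_intervals
    ((continuous_speed hc).intervalIntegrable _ _) ((continuous_speed hc).intervalIntegrable _ _)

lemma length_comp {c : ℝ → Plane} (hc : ContDiff ℝ 1 c) {φ : ℝ → ℝ} (hφ : ContDiff ℝ 1 φ)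
    {a b : ℝ} (hmono : ∀ t ∈ uIcc a b, 0 ≤ deriv φ t) :
    M.length (c ∘ φ) a b = M.length c (φ a) (φ b) := by
  rw [length_eq, length_eq, ← intervalIntegral.integral_comp_mul_deriv (f' := deriv φ)
    (g := fun t => M.nrm (c t) (deriv c t))
    (fun t _ => (hφ.differentiable one_ne_zero t).hasDerivAt)
    (hφ.continuous_deriv le_rfl).continuousOn (continuous_speed hc)]
  refine intervalIntegral.integral_congr fun t ht => ?_
  have h : deriv (c ∘ φ) t = deriv φ t • deriv c (φ t) :=
    deriv.scomp t (hc.differentiable one_ne_zero _) (hφ.differentiable one_ne_zero _)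
  simp only [Function.comp_apply] at h ⊢
  rw [h, nrm_smul, abs_of_nonneg (hmono t ht), mul_comm]

lemma bddBelow_lengths (x y : Plane) :
    BddBelow {L | ∃ c : ℝ → ℝ × ℝ, ContDiff ℝ 1 c ∧ c 0 = x ∧ c 1 = y ∧ L = M.length c 0 1} :=
  ⟨0, by rintro _ ⟨c, _, _, _, rfl⟩; exact length_nonneg c zero_le_one⟩

lemma contDiff_segment (x v : Plane) : ContDiff ℝ 1 fun t : ℝ => x + t • v :=
  contDiff_const.add (contDiff_id.smul contDiff_const)

lemma deriv_segment (x v : Plane) (t : ℝ) : deriv (fun t : ℝ => x + t • v) t = v := by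
  have := ((hasDerivAt_id t).smul_const v).const_add x
  simpa using this.deriv

lemma lengths_nonempty (x y : Plane) :
    {L | ∃ c : ℝ → ℝ × ℝ, ContDiff ℝ 1 c ∧ c 0 = x ∧ c 1 = y ∧ L = M.length c 0 1}.Nonempty :=
  ⟨_, fun t => x + t • (y - x), contDiff_segment _ _, by simp, by simp, rfl⟩

lemma dist_le_length₀₁ {c : ℝ → Plane} (hc : ContDiff ℝ 1 c) :
    M.dist (c 0) (c 1) ≤ M.length c 0 1 :=
  csInf_le (bddBelow_lengths _ _) ⟨c, hc, rfl, rfl, rfl⟩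

lemma dist_le_length {c : ℝ → Plane} (hc : ContDiff ℝ 1 c) {a b : ℝ} (h : a ≤ b) :
    M.dist (c a) (c b) ≤ M.length c a b := by
  have hφ : ContDiff ℝ 1 fun t : ℝ => a + t * (b - a) := by fun_prop
  have hd : ∀ t, deriv (fun t : ℝ => a + t * (b - a)) t = b - a := fun t => by
    simp
  have := dist_le_length₀₁ (M := M) (hc.comp hφ)
  rw [length_comp hc hφ (fun t _ => by rw [hd]; linarith)] at this
  simpa using this

lemma dist_nonneg (x y : Plane) : 0 ≤ M.dist x y :=
  Real.sInf_nonneg (by rintro _ ⟨c, _, _, _, rfl⟩; exact length_nonneg c zero_le_one)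

lemma exists_lt_of_dist_lt {x y : Plane} {L : ℝ} (h : M.dist x y < L) :
    ∃ c : ℝ → Plane, ContDiff ℝ 1 c ∧ c 0 = x ∧ c 1 = y ∧ M.length c 0 1 < L := by
  obtain ⟨_, ⟨c, hc, h0, h1, rfl⟩, hL⟩ := exists_lt_of_csInf_lt (lengths_nonempty x y) h
  exact ⟨c, hc, h0, h1, hL⟩

lemma le_dist {x y : Plane} {L : ℝ}
    (h : ∀ c : ℝ → Plane, ContDiff ℝ 1 c → c 0 = x → c 1 = y → L ≤ M.length c 0 1) :
    L ≤ M.dist x y :=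
  le_csInf (lengths_nonempty x y) (by rintro _ ⟨c, hc, h0, h1, rfl⟩; exact h c hc h0 h1)

lemma dist_comm_le (x y : Plane) : M.dist y x ≤ M.dist x y := by
  refine le_dist fun c hc h0 h1 => ?_
  have hr : ContDiff ℝ 1 fun t : ℝ => 1 - t := by fun_prop
  have hd : ∀ t, deriv (c ∘ fun t : ℝ => 1 - t) t = -deriv c (1 - t) := fun t =>
    deriv_comp_const_sub c 1 t
  have h := dist_le_length₀₁ (M := M) (hc.comp hr)
  have hl : M.length (c ∘ fun t : ℝ => 1 - t) 0 1 = M.length c 0 1 := by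
    have := intervalIntegral.integral_comp_sub_left (a := 0) (b := 1)
      (fun t => M.nrm (c t) (deriv c t)) 1
    simp only [sub_self, sub_zero] at this
    simp only [length_eq, hd, nrm_neg, ← this, Function.comp_apply]
  rw [hl] at h
  simpa [h0, h1] using h

lemma dist_comm (x y : Plane) : M.dist x y = M.dist y x :=
  le_antisymm (dist_comm_le _ _) (dist_comm_le _ _)

@[simp] lemma dist_self (x : Plane) : M.dist x x = 0 := by
  refine le_antisymm ?_ (dist_nonneg _ _)
  have := dist_le_length₀₁ (M := M) (contDiff_const (c := x) : ContDiff ℝ 1 fun _ : ℝ => x)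
  simpa [length_eq] using this

lemma smoothTransition_deriv_nonneg (k m : ℝ) (hk : 0 ≤ k) (t : ℝ) :
    0 ≤ deriv (fun t : ℝ => Real.smoothTransition (k * t - m)) t := by
  refine Monotone.deriv_nonneg fun s t h => ?_
  exact Real.smoothTransition.monotone (by gcongr)

lemma dist_triangle (x y z : Plane) : M.dist x z ≤ M.dist x y + M.dist y z := by
  refine le_of_forall_pos_lt_add fun ε hε => ?_
  obtain ⟨c, hc, hc0, hc1, hcl⟩ := exists_lt_of_dist_lt (M := M) (x := x) (y := y)
    (L := M.dist x y + ε / 2) (by linarith)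
  obtain ⟨e, he, he0, he1, hel⟩ := exists_lt_of_dist_lt (M := M) (x := y) (y := z)
    (L := M.dist y z + ε / 2) (by linarith)
  set φ : ℝ → ℝ := fun t => Real.smoothTransition (2 * t - 0) with hφdef
  set ψ : ℝ → ℝ := fun t => Real.smoothTransition (2 * t - 1) with hψdef
  have hφ : ContDiff ℝ 1 φ := Real.smoothTransition.contDiff.comp (by fun_prop)
  have hψ : ContDiff ℝ 1 ψ := Real.smoothTransition.contDiff.comp (by fun_prop)
  have hφ1 : ∀ t, 1 / 2 ≤ t → φ t = 1 := fun t ht =>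
    Real.smoothTransition.one_of_one_le (by linarith)
  have hψ0 : ∀ t, t ≤ 1 / 2 → ψ t = 0 := fun t ht =>
    Real.smoothTransition.zero_of_nonpos (by linarith)
  have hφ0 : φ 0 = 0 := Real.smoothTransition.zero_of_nonpos (by simp)
  have hψ1 : ψ 1 = 1 := Real.smoothTransition.one_of_one_le (by norm_num)
  set γ : ℝ → Plane := fun t => c (φ t) + e (ψ t) - y with hγdef
  have hγ : ContDiff ℝ 1 γ := ((hc.comp hφ).add (he.comp hψ)).sub contDiff_const
  have hleft : EqOn γ (c ∘ φ) (Iio (1 / 2)) := fun t ht => by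
    simp [hγdef, hψ0 t (le_of_lt ht), he0]
  have hright : EqOn γ (e ∘ ψ) (Ioi (1 / 2)) := fun t ht => by
    simp [hγdef, hφ1 t (le_of_lt ht), hc1]
  have hL : M.length γ 0 (1 / 2) = M.length c 0 1 := by
    have h1 : M.length γ 0 (1 / 2) = M.length (c ∘ φ) 0 (1 / 2) := by
      refine intervalIntegral.integral_congr_Ioo_of_le (by norm_num) fun t ht => ?_
      have : γ =ᶠ[𝓝 t] c ∘ φ := hleft.eventuallyEq_of_mem (Iio_mem_nhds ht.2)
      simp only [this.eq_of_nhds, this.deriv_eq]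
    rw [h1, length_comp hc hφ fun t _ => smoothTransition_deriv_nonneg 2 0 (by norm_num) t, hφ0,
      hφ1 _ le_rfl]
  have hR : M.length γ (1 / 2) 1 = M.length e 0 1 := by
    have h1 : M.length γ (1 / 2) 1 = M.length (e ∘ ψ) (1 / 2) 1 := by
      refine intervalIntegral.integral_congr_Ioo_of_le (by norm_num) fun t ht => ?_
      have : γ =ᶠ[𝓝 t] e ∘ ψ := hright.eventuallyEq_of_mem (Ioi_mem_nhds ht.1)
      simp only [this.eq_of_nhds, this.deriv_eq]
    rw [h1, length_comp he hψ fun t _ => smoothTransition_deriv_nonneg 2 1 (by norm_num) t, hψ1,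
      hψ0 _ le_rfl]
  have h := dist_le_length₀₁ (M := M) hγ
  rw [← length_add hγ 0 (1 / 2) 1, hL, hR] at h
  have e0 : γ 0 = x := by simp [hγdef, hφ0, hψ0 0 (by norm_num), hc0, he0]
  have e1 : γ 1 = z := by simp [hγdef, hφ1 1 (by norm_num), hψ1, hc1, he1]
  rw [e0, e1] at h
  linarith

lemma dist_add_lat_le (x y : Plane) (k : ℤ × ℤ) :
    M.dist (x + lat k) (y + lat k) ≤ M.dist x y := by
  refine le_dist fun c hc h0 h1 => ?_
  have h := dist_le_length₀₁ (M := M) (hc.add (contDiff_const (c := lat k)))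
  have : M.length (fun t => c t + lat k) 0 1 = M.length c 0 1 := by
    simp [length_eq, nrm_add_lat]
  change M.dist (c 0 + lat k) (c 1 + lat k) ≤ M.length (fun t => c t + lat k) 0 1 at h
  rwa [this, h0, h1] at h

@[simp] lemma dist_add_lat (x y : Plane) (k : ℤ × ℤ) :
    M.dist (x + lat k) (y + lat k) = M.dist x y := by
  refine le_antisymm (dist_add_lat_le _ _ _) ?_
  simpa [lat_neg] using dist_add_lat_le (M := M) (x + lat k) (y + lat k) (-k)

lemma dist_sub_lat (x y : Plane) (k : ℤ × ℤ) :
    M.dist (x - lat k) (y - lat k) = M.dist x y := by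
  simpa [lat_neg, sub_eq_add_neg] using dist_add_lat (M := M) x y (-k)

lemma lo_le_dist (x y : Plane) : M.lo * ‖x - y‖ ≤ M.dist x y := by
  refine le_dist fun c hc h0 h1 => ?_
  have hInt := (hc.continuous_deriv le_rfl).intervalIntegrable (μ := MeasureTheory.volume) 0 1
  have h := intervalIntegral.integral_deriv_eq_sub
    (fun t _ => hc.differentiable one_ne_zero t) hInt
  rw [h0, h1] at h
  rw [norm_sub_rev, ← h]
  have h2 := intervalIntegral.norm_integral_le_integral_norm (f := deriv c)
    (μ := MeasureTheory.volume) (zero_le_one (α := ℝ))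
  calc _ ≤ M.lo * ∫ t in (0:ℝ)..1, ‖deriv c t‖ := by have := M.lo_pos; gcongr
    _ = ∫ t in (0:ℝ)..1, M.lo * ‖deriv c t‖ := by rw [intervalIntegral.integral_const_mul]
    _ ≤ _ := intervalIntegral.integral_mono_on zero_le_one
      (((hc.continuous_deriv le_rfl).norm.const_mul _).intervalIntegrable _ _)
      ((continuous_speed hc).intervalIntegrable _ _) fun t _ => M.lo_le_nrm _ _

lemma dist_le_segment (x y : Plane) :
    M.dist x y ≤ ∫ t in (0:ℝ)..1, M.nrm (x + t • (y - x)) (y - x) := by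
  have h := dist_le_length₀₁ (M := M) (contDiff_segment x (y - x))
  simpa only [length_eq, deriv_segment, zero_smul, add_zero, one_smul, add_sub_cancel] using h

lemma dist_le_of_segment {x y : Plane} {B : ℝ}
    (h : ∀ t ∈ Icc (0 : ℝ) 1, M.nrm (x + t • (y - x)) (y - x) ≤ B) : M.dist x y ≤ B := by
  refine (dist_le_segment x y).trans ?_
  have := intervalIntegral.integral_mono_on (μ := MeasureTheory.volume) (zero_le_one (α := ℝ))
    (f := fun t => M.nrm (x + t • (y - x)) (y - x)) (g := fun _ => B)
    (Continuous.intervalIntegrable (by fun_prop) _ _) (by simp) h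
  simpa using this

lemma dist_le_up (x y : Plane) : M.dist x y ≤ M.up * ‖x - y‖ :=
  dist_le_of_segment fun t _ => by rw [norm_sub_rev]; exact M.nrm_le_up _ _

lemma eq_of_dist_le_zero {x y : Plane} (h : M.dist x y ≤ 0) : x = y := by
  have h1 := (lo_le_dist x y).trans h
  have : ‖x - y‖ ≤ 0 := by
    by_contra! h2
    exact absurd h1 (not_le.2 (mul_pos M.lo_pos h2))
  exact sub_eq_zero.1 (norm_le_zero_iff.1 this)

lemma norm_sub_le_dist (x y : Plane) : ‖x - y‖ ≤ M.dist x y / M.lo := by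
  rw [le_div_iff₀ M.lo_pos, mul_comm]
  exact lo_le_dist x y

lemma abs_dist_sub_dist_le (x y x' y' : Plane) :
    |M.dist x y - M.dist x' y'| ≤ M.dist x x' + M.dist y y' := by
  rw [abs_le]
  have h1 := dist_triangle (M := M) x x' y
  have h2 := dist_triangle (M := M) x' y' y
  have h3 := dist_triangle (M := M) x' x y'
  have h4 := dist_triangle (M := M) x y y'
  rw [dist_comm (M := M) y' y] at h2
  rw [dist_comm (M := M) x' x] at h3
  constructor <;> linarith

lemma continuous_dist : Continuous fun p : Plane × Plane => M.dist p.1 p.2 := by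
  refine continuous_iff_continuousAt.2 fun p => ?_
  refine tendsto_iff_norm_sub_tendsto_zero.2 ?_
  have h : Tendsto (fun q : Plane × Plane => M.up * ‖q.1 - p.1‖ + M.up * ‖q.2 - p.2‖) (𝓝 p)
      (𝓝 (M.up * ‖p.1 - p.1‖ + M.up * ‖p.2 - p.2‖)) :=
    Continuous.tendsto (by fun_prop) p
  simp only [sub_self, norm_zero, mul_zero, add_zero] at h
  refine squeeze_zero (fun _ => norm_nonneg _) (fun q => ?_) h
  exact (abs_dist_sub_dist_le _ _ _ _).trans (add_le_add (dist_le_up _ _) (dist_le_up _ _))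

@[fun_prop] lemma _root_.Continuous.mdist {X : Type*} [TopologicalSpace X] {f h : X → Plane}
    (hf : Continuous f) (hh : Continuous h) : Continuous fun t => M.dist (f t) (h t) :=
  continuous_dist.comp (hf.prodMk hh)

lemma tendsto_dist {ι : Type*} {l : Filter ι} {f h : ι → Plane} {x y : Plane}
    (hf : Tendsto f l (𝓝 x)) (hh : Tendsto h l (𝓝 y)) :
    Tendsto (fun i => M.dist (f i) (h i)) l (𝓝 (M.dist x y)) := by
  have h1 := (continuous_dist (M := M)).tendsto (x, y)
  rw [nhds_prod_eq] at h1
  have h2 : Tendsto (fun i => (f i, h i)) l (𝓝 x ×ˢ 𝓝 y) := hf.prodMk hh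
  have h3 := Tendsto.comp (g := fun p : Plane × Plane => M.dist p.1 p.2) h1 h2
  exact h3

/-- Comparison of the distance with the frozen norm at a nearby point, upper bound. -/
lemma dist_le_frozen {m x y : Plane} {r : ℝ} (hx : ‖x - m‖ ≤ r) (hy : ‖y - m‖ ≤ r) :
    M.dist x y ≤ (1 + M.dst * r) * M.nrm m (y - x) := by
  refine dist_le_of_segment fun t ht => (M.nrm_le_mul _ m _).trans ?_
  have h : ‖x + t • (y - x) - m‖ ≤ r := by
    have e : x + t • (y - x) - m = (1 - t) • (x - m) + t • (y - m) := by
      module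
    rw [e]
    refine (norm_add_le _ _).trans ?_
    rw [norm_smul, norm_smul, Real.norm_of_nonneg ht.1, Real.norm_of_nonneg (by linarith [ht.2])]
    nlinarith [ht.1, ht.2]
  have := M.dst_pos
  have := M.nrm_nonneg m (y - x)
  gcongr

lemma nrm_integral_le (m : Plane) {v : ℝ → Plane} (hv : Continuous v) {a b : ℝ} (hab : a ≤ b) :
    M.nrm m (∫ t in a..b, v t) ≤ ∫ t in a..b, M.nrm m (v t) := by
  set w := ∫ t in a..b, v t with hw
  have hN : 0 ≤ ∫ t in a..b, M.nrm m (v t) :=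
    intervalIntegral.integral_nonneg hab fun _ _ => M.nrm_nonneg _ _
  have hlin : M.g m w w = ∫ t in a..b, M.g m w (v t) := by
    let L : Plane →L[ℝ] ℝ := LinearMap.toContinuousLinearMap
      { toFun := fun u => M.g m w u, map_add' := M.g_add_right m w,
        map_smul' := fun a u => M.g_smul_right m a w u }
    have := L.intervalIntegral_comp_comm (hv.intervalIntegrable (μ := MeasureTheory.volume) a b)
    rw [← hw] at this
    exact this.symm
  have hle : M.g m w w ≤ M.nrm m w * ∫ t in a..b, M.nrm m (v t) := by
    rw [hlin, ← intervalIntegral.integral_const_mul]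
    refine intervalIntegral.integral_mono_on hab ?_ ?_ fun t _ => M.g_le_nrm_mul _ _ _
    · exact (M.continuous_g.comp (continuous_const.prodMk
        (continuous_const.prodMk hv))).intervalIntegrable _ _
    · exact ((continuous_const.nrm hv).const_mul _).intervalIntegrable _ _
  rw [← nrm_sq, sq] at hle
  rcases (M.nrm_nonneg m w).eq_or_lt with h | h
  · rw [← h]; exact hN
  · exact le_of_mul_le_mul_left hle h

/-- Comparison of the distance with the frozen norm at a nearby point, lower bound. -/
lemma frozen_le_dist {m x y : Plane} {r : ℝ} (hx : ‖x - m‖ + M.dist x y / M.lo ≤ r) :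
    M.nrm m (y - x) ≤ (1 + M.dst * r) * M.dist x y := by
  have hr0 : 0 ≤ r := le_trans (add_nonneg (norm_nonneg _)
    (div_nonneg (dist_nonneg _ _) M.lo_pos.le)) hx
  have key : ∀ ε > 0, M.nrm m (y - x) ≤ (1 + M.dst * (r + ε / M.lo)) * (M.dist x y + ε) := by
    intro ε hε
    obtain ⟨c, hc, h0, h1, hl⟩ := exists_lt_of_dist_lt (M := M) (x := x) (y := y)
      (L := M.dist x y + ε) (by linarith)
    have hd := hc.continuous_deriv le_rfl
    have hxy : y - x = ∫ t in (0:ℝ)..1, deriv c t := by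
      rw [intervalIntegral.integral_deriv_eq_sub (fun t _ => hc.differentiable one_ne_zero t)
        (hd.intervalIntegrable _ _), h0, h1]
    have hlen := length_nonneg (M := M) c (zero_le_one (α := ℝ))
    have hb : ∀ t ∈ Icc (0:ℝ) 1, M.nrm m (deriv c t) ≤
        (1 + M.dst * (r + ε / M.lo)) * M.nrm (c t) (deriv c t) := fun t ht => by
      refine (M.nrm_le_mul m (c t) _).trans ?_
      have h2 : ‖m - c t‖ ≤ r + ε / M.lo := by
        have h3 := norm_sub_le_dist (M := M) (c t) x
        have h4 : M.dist x (c t) ≤ M.dist x y + ε := by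
          rw [← h0]
          have := dist_le_length (M := M) hc ht.1
          have := length_nonneg (M := M) c ht.2
          have := length_add (M := M) hc 0 t 1
          rw [h0] at *
          linarith
        rw [dist_comm] at h3
        have h5 : M.dist x (c t) / M.lo ≤ (M.dist x y + ε) / M.lo := by
          have := M.lo_pos; gcongr
        rw [add_div] at h5
        have h6 : m - c t = -(x - m) - (c t - x) := by abel
        rw [h6]
        have := norm_sub_le (-(x - m)) (c t - x)
        rw [norm_neg] at this
        linarith
      have := M.dst_pos
      have := M.nrm_nonneg (c t) (deriv c t)
      gcongr
    calc M.nrm m (y - x) ≤ ∫ t in (0:ℝ)..1, M.nrm m (deriv c t) := by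
          rw [hxy]; exact nrm_integral_le m hd zero_le_one
      _ ≤ ∫ t in (0:ℝ)..1, (1 + M.dst * (r + ε / M.lo)) * M.nrm (c t) (deriv c t) :=
          intervalIntegral.integral_mono_on zero_le_one
            ((continuous_const.nrm hd).intervalIntegrable _ _)
            (((continuous_speed hc).const_mul _).intervalIntegrable _ _) hb
      _ = (1 + M.dst * (r + ε / M.lo)) * M.length c 0 1 := by
          rw [intervalIntegral.integral_const_mul, length_eq]
      _ ≤ _ := by
          have := M.dst_pos
          have := M.lo_pos
          gcongr
  have hlim : Tendsto (fun ε : ℝ => (1 + M.dst * (r + ε / M.lo)) * (M.dist x y + ε)) (𝓝[>] 0)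
      (𝓝 ((1 + M.dst * (r + 0 / M.lo)) * (M.dist x y + 0))) :=
    (Continuous.tendsto (by fun_prop) 0).mono_left nhdsWithin_le_nhds
  simp only [zero_div, add_zero] at hlim
  exact ge_of_tendsto hlim (eventually_nhdsWithin_of_forall key)

end TorusMetric

namespace TorusMetric

variable (M : TorusMetric)

/-- Curves which do not increase distances. -/
def Lip1 (γ : ℝ → Plane) : Prop := ∀ s t, M.dist (γ s) (γ t) ≤ |s - t|

variable {M}

lemma Lip1.norm_le {γ : ℝ → Plane} (h : M.Lip1 γ) (s t : ℝ) : ‖γ s - γ t‖ ≤ |s - t| / M.lo :=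
  (norm_sub_le_dist _ _).trans (by have := M.lo_pos; have := h s t; gcongr)

lemma Lip1.continuous {γ : ℝ → Plane} (h : M.Lip1 γ) : Continuous γ := by
  refine (LipschitzWith.of_dist_le_mul (K := Real.toNNReal M.lo⁻¹)
    fun s t => ?_).continuous
  rw [dist_eq_norm, Real.dist_eq, Real.coe_toNNReal _ (inv_pos.2 M.lo_pos).le, inv_mul_eq_div]
  exact h.norm_le s t

lemma Lip1.add_lat {γ : ℝ → Plane} (h : M.Lip1 γ) (k : ℤ × ℤ) :
    M.Lip1 fun t => γ t + lat k := fun s t => by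
  rw [dist_add_lat]; exact h s t

lemma Lip1.comp_add {γ : ℝ → Plane} (h : M.Lip1 γ) (a : ℝ) :
    M.Lip1 fun t => γ (t + a) := fun s t => by
  simpa using h (s + a) (t + a)

lemma Lip1.ite {β γ : ℝ → Plane} (hβ : M.Lip1 β) (hγ : M.Lip1 γ) {θ : ℝ} (hθ : β θ = γ θ) :
    M.Lip1 fun t => if t ≤ θ then β t else γ t := by
  have key : ∀ s t, s ≤ θ → θ < t → M.dist (β s) (γ t) ≤ t - s := fun s t hs ht => by
    have h1 := dist_triangle (M := M) (β s) (β θ) (γ t)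
    have h2 := hβ s θ
    have h3 := hγ θ t
    rw [← hθ] at h3
    rw [abs_sub_comm, abs_of_nonneg (by linarith)] at h2 h3
    linarith
  intro s t
  by_cases hs : s ≤ θ <;> by_cases ht : t ≤ θ
  · simpa [hs, ht] using hβ s t
  · simp only [hs, ht, if_true, if_false]
    refine (key s t hs (not_le.1 ht)).trans ?_
    rw [abs_sub_comm]; exact le_abs_self _
  · simp only [hs, ht, if_true, if_false]
    rw [dist_comm]
    exact (key t s ht (not_le.1 hs)).trans (le_abs_self _)
  · simpa [hs, ht] using hγ s t

lemma exists_tendsto_hyperfilter {x : ℕ → Plane} {B : ℝ} (h : ∀ n, ‖x n‖ ≤ B) :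
    ∃ y, ‖y‖ ≤ B ∧ Tendsto x (hyperfilter ℕ) (𝓝 y) := by
  have hc : IsCompact (Metric.closedBall (0 : Plane) B) := isCompact_closedBall _ _
  obtain ⟨y, hy, hle⟩ := hc.ultrafilter_le_nhds' ((hyperfilter ℕ).map x)
    (by
      rw [Ultrafilter.mem_map]
      exact Filter.univ_mem' fun n => by simpa using h n)
  exact ⟨y, by simpa using hy, hle⟩

lemma exists_hyperlimit {γ : ℕ → ℝ → Plane} (hγ : ∀ n, M.Lip1 (γ n)) {B : ℝ}
    (hB : ∀ n, ‖γ n 0‖ ≤ B) :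
    ∃ L : ℝ → Plane, M.Lip1 L ∧ ∀ t, Tendsto (fun n => γ n t) (hyperfilter ℕ) (𝓝 (L t)) := by
  have h : ∀ t, ∃ y, Tendsto (fun n => γ n t) (hyperfilter ℕ) (𝓝 y) := fun t => by
    obtain ⟨y, -, hy⟩ := exists_tendsto_hyperfilter (x := fun n => γ n t)
      (B := |t| / M.lo + B) fun n => by
        have h1 := (hγ n).norm_le t 0
        have h2 := norm_sub_norm_le (γ n t) (γ n 0)
        rw [sub_zero] at h1
        linarith [hB n]
    exact ⟨y, hy⟩
  choose L hL using h
  exact ⟨L, fun s t => le_of_tendsto (tendsto_dist (hL s) (hL t))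
    (Eventually.of_forall fun n => hγ n s t), hL⟩

lemma exists_almost_minimizer (x y : Plane) {ε : ℝ} (hε : 0 < ε) :
    ∃ γ : ℝ → Plane, ∃ ℓ, M.Lip1 γ ∧ γ 0 = x ∧ γ ℓ = y ∧ M.dist x y ≤ ℓ ∧ ℓ < M.dist x y + ε := by
  obtain ⟨c, hc, h0, h1, hl⟩ := exists_lt_of_dist_lt (M := M) (x := x) (y := y)
    (L := M.dist x y + ε) (by linarith)
  set ℓ := M.length c 0 1 with hℓ
  have hxy : M.dist x y ≤ ℓ := by rw [← h0, ← h1]; exact dist_le_length₀₁ hc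
  have hℓ0 : 0 ≤ ℓ := (dist_nonneg _ _).trans hxy
  have hcont : Continuous fun t => M.length c 0 t :=
    intervalIntegral.continuous_primitive
      (fun a b => (continuous_speed hc).intervalIntegrable a b) 0
  have hsurj : ∀ u : ℝ, ∃ t ∈ Icc (0 : ℝ) 1, M.length c 0 t = max 0 (min u ℓ) := fun u => by
    have := intermediate_value_Icc (zero_le_one (α := ℝ)) hcont.continuousOn
    have hz : M.length c 0 0 = 0 := by simp [length_eq]
    exact this ⟨by rw [hz]; exact le_max_left _ _, max_le hℓ0 (min_le_right _ _)⟩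
  choose φ hφ hφl using hsurj
  have hd : ∀ s t, s ≤ t → M.dist (c s) (c t) ≤ |M.length c 0 s - M.length c 0 t| :=
    fun s t hst => by
      have h2 := length_add (M := M) hc 0 s t
      have h3 := dist_le_length (M := M) hc hst
      rw [abs_sub_comm]
      exact h3.trans (by rw [← h2, add_sub_cancel_left]; exact le_abs_self _)
  have hd' : ∀ s t, M.dist (c s) (c t) ≤ |M.length c 0 s - M.length c 0 t| := fun s t => by
    rcases le_total s t with h | h
    · exact hd s t h
    · rw [dist_comm, abs_sub_comm]; exact hd t s h
  refine ⟨fun u => c (φ u), ℓ, fun s t => ?_, ?_, ?_, hxy, hl⟩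
  · refine (hd' _ _).trans ?_
    rw [hφl, hφl]
    have h1 := abs_max_sub_max_le_max 0 (min s ℓ) 0 (min t ℓ)
    have h2 := abs_min_sub_min_le_max s ℓ t ℓ
    simp only [sub_self, abs_zero, abs_nonneg, max_eq_left,
      max_eq_right] at h1 h2
    exact h1.trans h2
  · have h := hd' (φ 0) 0
    rw [hφl] at h
    have hz : M.length c 0 0 = 0 := by simp [length_eq]
    simp only [hz, min_eq_left hℓ0, max_self, sub_zero, abs_zero] at h
    rw [← h0]; exact eq_of_dist_le_zero h
  · have h := hd' (φ ℓ) 1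
    rw [hφl] at h
    simp only [min_self, max_eq_right hℓ0, ← hℓ, sub_self, abs_zero] at h
    rw [← h1]; exact eq_of_dist_le_zero h

/-- Existence of minimal segments. -/
lemma exists_minimizer (x y : Plane) :
    ∃ γ : ℝ → Plane, M.Lip1 γ ∧ γ 0 = x ∧ γ (M.dist x y) = y := by
  have h : ∀ n : ℕ, ∃ γ : ℝ → Plane, ∃ ℓ, M.Lip1 γ ∧ γ 0 = x ∧ γ ℓ = y ∧ M.dist x y ≤ ℓ ∧
      ℓ < M.dist x y + 1 / (n + 1) := fun n => exists_almost_minimizer x y (by positivity)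
  choose γ ℓ hγ h0 hℓ hle hlt using h
  obtain ⟨L, hL, hlim⟩ := exists_hyperlimit hγ (B := ‖x‖) (fun n => by rw [h0 n])
  refine ⟨L, hL, ?_, ?_⟩
  · have := hlim 0
    simp only [h0] at this
    exact tendsto_nhds_unique this tendsto_const_nhds
  · refine eq_of_dist_le_zero (M := M) ?_
    have h1 := tendsto_dist (M := M) (hlim (M.dist x y)) (tendsto_const_nhds (x := y))
    have h2 : Tendsto (fun n : ℕ => 1 / ((n : ℝ) + 1)) (hyperfilter ℕ) (𝓝 0) :=
      tendsto_one_div_add_atTop_nhds_zero_nat.mono_left Nat.hyperfilter_le_atTop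
    refine le_of_tendsto_of_tendsto h1 h2 (Eventually.of_forall fun n => ?_)
    have h3 := hγ n (M.dist x y) (ℓ n)
    rw [hℓ, abs_sub_comm, abs_of_nonneg (by linarith [hle n])] at h3
    exact h3.trans (by linarith [hlt n])

end TorusMetric

namespace TorusMetric

variable (M : TorusMetric)

/-- The curve `γ` is isometric on the parameter set `S`. -/
def IsoOn (γ : ℝ → Plane) (S : Set ℝ) : Prop := ∀ s ∈ S, ∀ t ∈ S, M.dist (γ s) (γ t) = |s - t|

/-- The curve `γ` is locally isometric. -/
def LocIso (γ : ℝ → Plane) : Prop := ∀ t, ∃ ε > 0, M.IsoOn γ (Icc (t - ε) (t + ε))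

variable {M}

lemma IsoOn.mono {γ : ℝ → Plane} {S T : Set ℝ} (h : M.IsoOn γ T) (hST : S ⊆ T) : M.IsoOn γ S :=
  fun s hs t ht => h s (hST hs) t (hST ht)

lemma IsoOn.norm_le {γ : ℝ → Plane} {S : Set ℝ} (h : M.IsoOn γ S) {s t : ℝ} (hs : s ∈ S)
    (ht : t ∈ S) : ‖γ s - γ t‖ ≤ |s - t| / M.lo := by
  rw [← h s hs t ht]; exact norm_sub_le_dist _ _

lemma LocIso.continuous {γ : ℝ → Plane} (h : M.LocIso γ) : Continuous γ := by
  refine continuous_iff_continuousAt.2 fun t => ?_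
  obtain ⟨ε, hε, hi⟩ := h t
  refine tendsto_iff_norm_sub_tendsto_zero.2 ?_
  have h1 : Tendsto (fun s => |s - t| / M.lo) (𝓝 t) (𝓝 (|t - t| / M.lo)) :=
    Continuous.tendsto (by fun_prop) t
  simp only [sub_self, abs_zero, zero_div] at h1
  refine squeeze_zero' (Eventually.of_forall fun _ => norm_nonneg _) ?_ h1
  filter_upwards [Icc_mem_nhds (show t - ε < t by linarith) (show t < t + ε by linarith)]
    with s hs
  exact hi.norm_le hs ⟨by linarith, by linarith⟩

lemma parallelogram (m a b : Plane) :
    M.nrm m (a + b) ^ 2 + M.nrm m (a - b) ^ 2 = 2 * M.nrm m a ^ 2 + 2 * M.nrm m b ^ 2 := by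
  simp only [nrm_sq, g_add_left, g_add_right, g_sub_left, g_sub_right]
  ring

/-- A point is nearly the affine midpoint of the endpoints of a short minimal segment of which it
is the midpoint. -/
lemma exists_midpoint_bound (M : TorusMetric) : ∃ K h₀ : ℝ, 0 < K ∧ 0 < h₀ ∧
    ∀ (γ : ℝ → Plane) (t h : ℝ), 0 < h → h ≤ h₀ → M.IsoOn γ (Icc (t - h) (t + h)) →
      ‖γ (t + h) + γ (t - h) - (2 : ℝ) • γ t‖ ≤ K * (h * √h) := by
  have hlo := M.lo_pos
  have hdst := M.dst_pos
  refine ⟨4 * √(M.dst / M.lo) / M.lo, M.lo / M.dst, by positivity, by positivity,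
    fun γ t h h0 hh₀ hi => ?_⟩
  set κ := M.dst * (h / M.lo) with hκ
  have hκ1 : κ ≤ 1 := by
    rw [hκ]
    calc M.dst * (h / M.lo) ≤ M.dst * (M.lo / M.dst / M.lo) := by gcongr
      _ = 1 := by field_simp
  have hκ0 : 0 < κ := by positivity
  set x := γ t
  have mt : t ∈ Icc (t - h) (t + h) := ⟨by linarith, by linarith⟩
  have mp : t - h ∈ Icc (t - h) (t + h) := ⟨by linarith, by linarith⟩
  have mq : t + h ∈ Icc (t - h) (t + h) := ⟨by linarith, by linarith⟩
  have dq : M.dist x (γ (t + h)) = h := by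
    rw [hi t mt _ mq, sub_add_cancel_left, abs_neg, abs_of_pos h0]
  have dp : M.dist x (γ (t - h)) = h := by
    rw [hi t mt _ mp, sub_sub_cancel, abs_of_pos h0]
  have dpq : M.dist (γ (t - h)) (γ (t + h)) = 2 * h := by
    rw [hi _ mp _ mq, show t - h - (t + h) = -(2 * h) by ring, abs_neg, abs_of_pos (by linarith)]
  have nq : M.nrm x (γ (t + h) - x) ≤ (1 + κ) * h := by
    have := frozen_le_dist (M := M) (m := x) (x := x) (y := γ (t + h)) (r := h / M.lo)
      (by rw [dq]; simp)
    rwa [dq] at this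
  have np : M.nrm x (γ (t - h) - x) ≤ (1 + κ) * h := by
    have := frozen_le_dist (M := M) (m := x) (x := x) (y := γ (t - h)) (r := h / M.lo)
      (by rw [dp]; simp)
    rwa [dp] at this
  have npq : 2 * h ≤ (1 + κ) * M.nrm x (γ (t + h) - γ (t - h)) := by
    rw [← dpq]
    refine dist_le_frozen ?_ ?_
    · have := norm_sub_le_dist (M := M) x (γ (t - h))
      rwa [dp, norm_sub_rev] at this
    · have := norm_sub_le_dist (M := M) x (γ (t + h))
      rwa [dq, norm_sub_rev] at this
  have hpar := parallelogram (M := M) x (γ (t + h) - x) (γ (t - h) - x)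
  rw [show γ (t + h) - x - (γ (t - h) - x) = γ (t + h) - γ (t - h) by abel,
    show γ (t + h) - x + (γ (t - h) - x) = γ (t + h) + γ (t - h) - (2 : ℝ) • x by
      rw [two_smul]; abel] at hpar
  set w := γ (t + h) + γ (t - h) - (2 : ℝ) • x
  set u := M.nrm x (γ (t + h) - γ (t - h))
  have hu : 2 * h * (1 - κ) ≤ u := by
    have hu0 : 0 ≤ u := M.nrm_nonneg _ _
    nlinarith [mul_le_mul_of_nonneg_left npq (sub_nonneg.2 hκ1), mul_nonneg hu0 (sq_nonneg κ)]
  have hu2 : (2 * h * (1 - κ)) ^ 2 ≤ u ^ 2 :=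
    pow_le_pow_left₀ (mul_nonneg (by linarith) (by linarith)) hu 2
  have hq2 := pow_le_pow_left₀ (M.nrm_nonneg _ _) nq 2
  have hp2 := pow_le_pow_left₀ (M.nrm_nonneg _ _) np 2
  have hw : M.nrm x w ^ 2 ≤ 16 * h ^ 2 * κ := by nlinarith
  have hlow := M.lo_le_nrm x w
  have h1 : (M.lo * ‖w‖) ^ 2 ≤ (4 * √(M.dst / M.lo) * (h * √h)) ^ 2 := by
    refine (pow_le_pow_left₀ (by positivity) hlow 2).trans (hw.trans_eq ?_)
    rw [mul_pow, mul_pow, mul_pow, Real.sq_sqrt h0.le, Real.sq_sqrt (by positivity), hκ]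
    ring
  have h2 := le_of_abs_le (abs_le_of_sq_le_sq h1 (by positivity))
  rw [show 4 * √(M.dst / M.lo) / M.lo * (h * √h) = 4 * √(M.dst / M.lo) * (h * √h) / M.lo by ring,
    le_div_iff₀ hlo, mul_comm]
  exact h2

lemma LocIso.exists_hasDerivAt {γ : ℝ → Plane} (hγ : M.LocIso γ) (t₀ : ℝ) :
    ∃ v : ℝ → Plane, ∃ U ∈ 𝓝 t₀, ContinuousOn v U ∧ ∀ t ∈ U, HasDerivAt γ (v t) t := by
  obtain ⟨K, h₀, hK, hh₀, hmid⟩ := exists_midpoint_bound M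
  obtain ⟨ε, hε, hi⟩ := hγ t₀
  have hcont := hγ.continuous
  set δ := min (ε / 2) h₀ with hδ
  have hδ0 : 0 < δ := lt_min (by linarith) hh₀
  have hδε : δ ≤ ε / 2 := min_le_left _ _
  set U := Ioo (t₀ - ε) (t₀ + ε / 2) with hU
  set h : ℕ → ℝ := fun n => δ * (1 / 2) ^ n with hh
  have hpos : ∀ n, 0 < h n := fun n => by simp only [hh]; positivity
  have hle : ∀ n, h n ≤ δ := fun n => by
    have : ((1 : ℝ) / 2) ^ n ≤ 1 := pow_le_one₀ (by norm_num) (by norm_num)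
    simp only [hh]
    nlinarith
  have hsucc : ∀ n, h n = 2 * h (n + 1) := fun n => by simp only [hh, pow_succ]; ring
  have htend : Tendsto h atTop (𝓝 0) := by
    simpa [hh] using (tendsto_pow_atTop_nhds_zero_of_lt_one (r := (1 : ℝ) / 2) (by norm_num)
      (by norm_num)).const_mul δ
  set D : ℕ → ℝ → Plane := fun n t => (h n)⁻¹ • (γ (t + h n) - γ t) with hD
  set ρ : ℝ := √(1 / 2) with hρ
  have hρ1 : ρ < 1 := by rw [hρ, Real.sqrt_lt' one_pos]; norm_num
  have hρ0 : 0 ≤ ρ := Real.sqrt_nonneg _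
  have hsq : ∀ n, √(h n) = √δ * ρ ^ n := fun n => by
    simp only [hh, hρ]
    rw [Real.sqrt_mul hδ0.le]
    congr 1
    rw [Real.sqrt_eq_iff_mul_self_eq (by positivity) (by positivity), ← mul_pow,
      Real.mul_self_sqrt (by norm_num)]
  have hstep : ∀ t ∈ U, ∀ n, ‖D n t - D (n + 1) t‖ ≤ K * √δ * ρ ^ n := fun t ht n => by
    have hp := hpos (n + 1)
    have hl := hle n
    have hs := hsucc n
    have hm := hmid γ (t + h (n + 1)) (h (n + 1)) hp
      ((hle _).trans (min_le_right _ _)) (hi.mono (Icc_subset_Icc (by linarith [ht.1])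
        (by linarith [ht.2])))
    rw [add_sub_cancel_right, add_assoc, ← two_mul, ← hs] at hm
    have e : D n t - D (n + 1) t = (h n)⁻¹ • (γ (t + h n) + γ t - (2 : ℝ) • γ (t + h (n + 1))) := by
      simp only [hD]
      have : (h (n + 1))⁻¹ = (h n)⁻¹ * 2 := by rw [hs]; field_simp
      rw [this]
      module
    rw [e, norm_smul, norm_inv, Real.norm_of_nonneg (hpos n).le, inv_mul_le_iff₀ (hpos n)]
    refine hm.trans ?_
    have h1 : √(h (n + 1)) ≤ √δ * ρ ^ n := by
      rw [← hsq]; exact Real.sqrt_le_sqrt (by linarith)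
    have h2 : h (n + 1) ≤ h n := by linarith
    calc K * (h (n + 1) * √(h (n + 1))) ≤ K * (h n * (√δ * ρ ^ n)) := by
          have := hpos n
          gcongr
      _ = _ := by ring
  have hlim : ∀ t, ∃ y, t ∈ U → Tendsto (fun n => D n t) atTop (𝓝 y) := fun t => by
    by_cases ht : t ∈ U
    · have hcau : CauchySeq fun n => D n t :=
        cauchySeq_of_le_geometric ρ (K * √δ) hρ1 fun n => by
          rw [dist_eq_norm]; exact hstep t ht n
      obtain ⟨y, hy⟩ := cauchySeq_tendsto_of_complete hcau
      exact ⟨y, fun _ => hy⟩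
    · exact ⟨0, fun h => absurd h ht⟩
  choose v hv using hlim
  have hunif : TendstoUniformlyOn D v atTop U := by
    have h1 : Tendsto (fun n => K * √δ * ρ ^ n / (1 - ρ)) atTop (𝓝 0) := by
      simpa using ((tendsto_pow_atTop_nhds_zero_of_lt_one hρ0 hρ1).const_mul
        (K * √δ)).div_const (1 - ρ)
    rw [Metric.tendstoUniformlyOn_iff]
    intro η hη
    filter_upwards [h1.eventually_lt_const hη] with n hn t ht
    rw [_root_.dist_comm]
    exact (dist_le_of_le_geometric_of_tendsto ρ (K * √δ) hρ1
      (fun n => by rw [dist_eq_norm]; exact hstep t ht n) (hv t ht) n).trans_lt hn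
  have hDcont : ∀ n, Continuous (D n) := fun n => by
    simp only [hD]; fun_prop
  have hInt : ∀ a b, IntervalIntegrable γ MeasureTheory.volume a b := fun a b =>
    hcont.intervalIntegrable a b
  set f : ℕ → ℝ → Plane := fun n t => (h n)⁻¹ • ∫ s in t..(t + h n), γ s with hf
  have hfd : ∀ n t, HasDerivAt (f n) (D n t) t := fun n t => by
    have hprim : ∀ u, HasDerivAt (fun u => ∫ s in (0:ℝ)..u, γ s) (γ u) u := fun u =>
      intervalIntegral.integral_hasDerivAt_right (hInt _ _)
        (hcont.stronglyMeasurableAtFilter _ _) hcont.continuousAt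
    have e : f n = fun t => (h n)⁻¹ • ((∫ s in (0:ℝ)..(t + h n), γ s) - ∫ s in (0:ℝ)..t, γ s) := by
      funext t
      simp only [hf]
      rw [intervalIntegral.integral_interval_sub_left (hInt _ _) (hInt _ _)]
    rw [e]
    exact (((hprim (t + h n)).comp_add_const t (h n)).sub (hprim t)).const_smul (h n)⁻¹
  have hflim : ∀ t, Tendsto (fun n => f n t) atTop (𝓝 (γ t)) := fun t => by
    have hprim : HasDerivAt (fun u => ∫ s in t..u, γ s) (γ t) t :=
      intervalIntegral.integral_hasDerivAt_right (hInt _ _)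
        (hcont.stronglyMeasurableAtFilter _ _) hcont.continuousAt
    have h1 := hprim.tendsto_slope_zero
    have h2 : Tendsto h atTop (𝓝[≠] 0) :=
      tendsto_nhdsWithin_iff.2 ⟨htend, Eventually.of_forall fun n => (hpos n).ne'⟩
    have h3 := h1.comp h2
    refine h3.congr fun n => ?_
    simp [hf]
  refine ⟨v, U, Ioo_mem_nhds (by linarith) (by linarith),
    hunif.continuousOn (Frequently.of_forall fun n => (hDcont n).continuousOn), fun t ht => ?_⟩
  exact hasDerivAt_of_tendstoUniformlyOn isOpen_Ioo hunif
    (Eventually.of_forall fun n t _ => hfd n t) (fun t _ => hflim t) ht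

lemma LocIso.contDiff_one {γ : ℝ → Plane} (hγ : M.LocIso γ) : ContDiff ℝ 1 γ := by
  rw [contDiff_one_iff_deriv]
  refine ⟨fun t => ?_, continuous_iff_continuousAt.2 fun t => ?_⟩
  · obtain ⟨v, U, hU, -, hd⟩ := hγ.exists_hasDerivAt t
    exact (hd t (mem_of_mem_nhds hU)).differentiableAt
  · obtain ⟨v, U, hU, hv, hd⟩ := hγ.exists_hasDerivAt t
    exact (hv.continuousAt hU).congr (mem_of_superset hU fun s hs => (hd s hs).deriv.symm)

lemma LocIso.nrm_deriv {γ : ℝ → Plane} (hγ : M.LocIso γ) (t : ℝ) :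
    M.nrm (γ t) (deriv γ t) = 1 := by
  obtain ⟨ε, hε, hi⟩ := hγ t
  have hlo := M.lo_pos
  have hdst := M.dst_pos
  have hd := ((hγ.contDiff_one.differentiable one_ne_zero t).hasDerivAt).tendsto_slope_zero_right
  have h1 : Tendsto (fun h => M.nrm (γ t) (h⁻¹ • (γ (t + h) - γ t))) (𝓝[>] 0)
      (𝓝 (M.nrm (γ t) (deriv γ t))) :=
    ((continuous_const.nrm continuous_id : Continuous fun v => M.nrm (γ t) v).tendsto _).comp hd
  have hup : Tendsto (fun h : ℝ => 1 + M.dst * (h / M.lo)) (𝓝[>] 0) (𝓝 1) := by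
    have : Tendsto (fun h : ℝ => 1 + M.dst * (h / M.lo)) (𝓝 0) (𝓝 (1 + M.dst * (0 / M.lo))) :=
      Continuous.tendsto (by fun_prop) 0
    simpa using this.mono_left nhdsWithin_le_nhds
  have hev : ∀ᶠ h in 𝓝[>] (0 : ℝ), 0 < h ∧ h < ε := Ioo_mem_nhdsGT hε
  have hfacts : ∀ h : ℝ, 0 < h ∧ h < ε → M.dist (γ t) (γ (t + h)) = h := fun h hh => by
    rw [hi t ⟨by linarith, by linarith⟩ (t + h) ⟨by linarith, by linarith⟩,
      sub_add_cancel_left, abs_neg, abs_of_pos hh.1]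
  refine le_antisymm (le_of_tendsto_of_tendsto h1 hup ?_) ?_
  · filter_upwards [hev] with h hh
    have := frozen_le_dist (M := M) (m := γ t) (x := γ t) (y := γ (t + h)) (r := h / M.lo)
      (by rw [hfacts h hh]; simp)
    rw [hfacts h hh] at this
    rw [nrm_smul, abs_inv, abs_of_pos hh.1, inv_mul_le_iff₀ hh.1]
    linarith
  · have h2 := hup.mul h1
    rw [one_mul] at h2
    refine ge_of_tendsto h2 ?_
    filter_upwards [hev] with h hh
    have := dist_le_frozen (M := M) (m := γ t) (x := γ t) (y := γ (t + h)) (r := h / M.lo)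
      (by simpa using (div_pos hh.1 hlo).le)
      (by have := norm_sub_le_dist (M := M) (γ t) (γ (t + h))
          rwa [hfacts h hh, norm_sub_rev] at this)
    rw [hfacts h hh] at this
    rw [nrm_smul, abs_inv, abs_of_pos hh.1, mul_left_comm, le_inv_mul_iff₀ hh.1, mul_one]
    exact this

end TorusMetric

/-- The lemma of du Bois-Reymond. -/
lemma hasDerivAt_of_variation {f P : ℝ → ℝ} (hf : Continuous f) (hP : Continuous P) {a b : ℝ}
    (hab : a < b)
    (h : ∀ φ : ℝ → ℝ, ContDiff ℝ 1 φ → φ a = 0 → φ b = 0 →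
      ∫ t in a..b, (φ t * f t + deriv φ t * P t) = 0) {t : ℝ} (ht : t ∈ Ioo a b) :
    HasDerivAt P (f t) t := by
  have hprim : ∀ {g : ℝ → ℝ}, Continuous g → ∀ u, HasDerivAt (fun u => ∫ s in a..u, g s) (g u) u :=
    fun hg u => intervalIntegral.integral_hasDerivAt_right (hg.intervalIntegrable _ _)
      (hg.stronglyMeasurableAtFilter _ _) hg.continuousAt
  set F : ℝ → ℝ := fun u => ∫ s in a..u, f s with hF
  have hFd : ∀ u, HasDerivAt F (f u) u := hprim hf
  have hFc : Continuous F := continuous_iff_continuousAt.2 fun u => (hFd u).continuousAt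
  set κ : ℝ := (∫ s in a..b, (P s - F s)) / (b - a) with hκ
  set ψ : ℝ → ℝ := fun u => P u - F u - κ with hψ
  have hψc : Continuous ψ := by fun_prop
  set φ : ℝ → ℝ := fun u => ∫ s in a..u, ψ s with hφ
  have hφd : ∀ u, HasDerivAt φ (ψ u) u := hprim hψc
  have hφ' : deriv φ = ψ := funext fun u => (hφd u).deriv
  have hφc : Continuous φ := continuous_iff_continuousAt.2 fun u => (hφd u).continuousAt
  have hφ1 : ContDiff ℝ 1 φ := contDiff_one_iff_deriv.2
    ⟨fun u => (hφd u).differentiableAt, by rw [hφ']; exact hψc⟩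
  have hφa : φ a = 0 := by simp [hφ]
  have hφb : φ b = 0 := by
    have h1 : b - a ≠ 0 := by linarith
    have h2 : ∫ u in a..b, (P u - F u - κ) = (∫ u in a..b, (P u - F u)) - ∫ _ in a..b, κ :=
      intervalIntegral.integral_sub
        (Continuous.intervalIntegrable (by fun_prop) _ _) intervalIntegrable_const
    simp only [hφ, hψ]
    rw [h2]
    simp only [intervalIntegral.integral_const, smul_eq_mul, hκ]
    field_simp
    ring
  have h0 := h φ hφ1 hφa hφb
  rw [hφ'] at h0
  have hparts := intervalIntegral.integral_deriv_mul_eq_sub (a := a) (b := b)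
    (fun u _ => hφd u) (fun u _ => hFd u)
    (hψc.intervalIntegrable _ _) (hf.intervalIntegrable _ _)
  rw [hφa, hφb, zero_mul, zero_mul, sub_zero] at hparts
  have hsq : ∫ u in a..b, ψ u ^ 2 = 0 := by
    have e : (fun u => ψ u ^ 2) = fun u => (φ u * f u + ψ u * P u) -
        (ψ u * F u + φ u * f u) - κ * ψ u := by
      funext u; simp only [hψ]; ring
    rw [e, intervalIntegral.integral_sub, intervalIntegral.integral_sub, h0, hparts,
      intervalIntegral.integral_const_mul]
    · change 0 - 0 - κ * φ b = 0
      rw [hφb]; ring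
    all_goals exact Continuous.intervalIntegrable (by fun_prop) _ _
  have hzero : ∀ u ∈ Icc a b, ψ u = 0 := fun u hu => by
    by_contra hne
    have := intervalIntegral.integral_pos hab (hψc.pow 2).continuousOn
      (fun x _ => sq_nonneg _) ⟨u, hu, sq_pos_iff.2 hne⟩
    exact absurd hsq this.ne'
  have hev : P =ᶠ[𝓝 t] fun u => F u + κ := by
    filter_upwards [Icc_mem_nhds ht.1 ht.2] with u hu
    have := hzero u hu
    simp only [hψ] at this
    linarith
  exact ((hFd t).add_const κ).congr_of_eventuallyEq hev

namespace TorusMetric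

variable (M : TorusMetric)

/-- The kinetic energy. -/
def en : Plane × Plane → ℝ := fun p => M.g p.1 p.2 p.2

lemma contDiff_en : ContDiff ℝ (⊤ : ℕ∞) M.en :=
  M.smooth.comp (contDiff_fst.prodMk (contDiff_snd.prodMk contDiff_snd))

lemma hasFDerivAt_en (p : Plane × Plane) : HasFDerivAt M.en (fderiv ℝ M.en p) p :=
  (M.contDiff_en.differentiable (by simp) p).hasFDerivAt

lemma continuous_fderiv_en : Continuous (fderiv ℝ M.en) :=
  M.contDiff_en.continuous_fderiv (by simp)

lemma nrm_sq_eq_en (x v : Plane) : M.nrm x v ^ 2 = M.en (x, v) := M.nrm_sq x v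

variable {M}

lemma IsoOn.first_variation {γ : ℝ → Plane} (hγ : ContDiff ℝ 1 γ)
    (hspeed : ∀ t, M.nrm (γ t) (deriv γ t) = 1) {a b : ℝ} (hab : a < b)
    (hi : M.IsoOn γ (Icc a b)) (e : Plane) {φ : ℝ → ℝ} (hφ : ContDiff ℝ 1 φ) (ha : φ a = 0)
    (hb : φ b = 0) :
    ∫ t in a..b, (φ t * fderiv ℝ M.en (γ t, deriv γ t) (e, 0) +
      deriv φ t * fderiv ℝ M.en (γ t, deriv γ t) (0, e)) = 0 := by
  have hγc := hγ.continuous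
  have hγ'c := hγ.continuous_deriv le_rfl
  have hφc := hφ.continuous
  have hφ'c := hφ.continuous_deriv le_rfl
  have henc := M.contDiff_en.continuous
  have hdenc := M.continuous_fderiv_en
  set base : ℝ → Plane × Plane := fun t => (γ t, deriv γ t) with hbase
  set dir : ℝ → Plane × Plane := fun t => (φ t • e, deriv φ t • e) with hdir
  have hbc : Continuous base := hγc.prodMk hγ'c
  have hdc : Continuous dir := (hφc.smul continuous_const).prodMk (hφ'c.smul continuous_const)
  set F : ℝ → ℝ → ℝ := fun s t => M.en (base t + s • dir t) with hF
  set F' : ℝ → ℝ → ℝ := fun s t => fderiv ℝ M.en (base t + s • dir t) (dir t) with hF'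
  have hFc : ∀ s, Continuous (F s) := fun s => by simp only [hF]; fun_prop
  have hF'c : Continuous fun p : ℝ × ℝ => F' p.1 p.2 := by
    simp only [hF']
    exact (hdenc.comp (by fun_prop)).clm_apply (by fun_prop)
  have hFd : ∀ s t, HasDerivAt (fun s => F s t) (F' s t) s := fun s t => by
    have h1 : HasDerivAt (fun s : ℝ => base t + s • dir t) (dir t) s := by
      simpa using ((hasDerivAt_id s).smul_const (dir t)).const_add (base t)
    exact (M.hasFDerivAt_en _).comp_hasDerivAt s h1
  obtain ⟨B, hB⟩ := (isCompact_Icc.prod isCompact_Icc : IsCompact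
    (Icc (-1 : ℝ) 1 ×ˢ Icc a b)).exists_bound_of_continuousOn hF'c.continuousOn
  have hJ := (intervalIntegral.hasDerivAt_integral_of_dominated_loc_of_deriv_le
    (μ := MeasureTheory.volume) (a := a) (b := b) (F := F) (F' := F') (x₀ := 0)
    (s := Icc (-1) 1) (bound := fun _ => B) (Icc_mem_nhds (by norm_num) (by norm_num))
    (Eventually.of_forall fun s => (hFc s).aestronglyMeasurable)
    ((hFc 0).intervalIntegrable _ _)
    (hF'c.comp (continuous_const.prodMk continuous_id)).aestronglyMeasurable
    (Eventually.of_forall fun t ht s hs => hB (s, t) ⟨hs, by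
      rw [uIoc_of_le hab.le] at ht; exact ⟨ht.1.le, ht.2⟩⟩)
    (by simp) (Eventually.of_forall fun t _ s _ => hFd s t)).2
  have hlow : ∀ s, b - a ≤ ∫ t in a..b, F s t := fun s => by
    set β : ℝ → Plane := fun t => γ t + (s * φ t) • e with hβ
    have hβ1 : ContDiff ℝ 1 β := hγ.add ((contDiff_const.mul hφ).smul contDiff_const)
    have hβ' : ∀ t, deriv β t = deriv γ t + (s * deriv φ t) • e := fun t =>
      ((hγ.differentiable one_ne_zero t).hasDerivAt.add
        (((hφ.differentiable one_ne_zero t).hasDerivAt.const_mul s).smul_const e)).deriv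
    have hFe : ∀ t, F s t = M.nrm (β t) (deriv β t) ^ 2 := fun t => by
      rw [nrm_sq_eq_en, hβ']
      simp only [hF, hbase, hdir, hβ, Prod.smul_mk, Prod.mk_add_mk, smul_smul]
    have hlen := dist_le_length (M := M) hβ1 hab.le
    have eβ : β a = γ a ∧ β b = γ b := by simp [hβ, ha, hb]
    rw [eβ.1, eβ.2, hi a (left_mem_Icc.2 hab.le) b (right_mem_Icc.2 hab.le), abs_sub_comm,
      abs_of_pos (by linarith), length_eq] at hlen
    have hsc := continuous_speed (M := M) hβ1
    have hmono : ∫ t in a..b, (2 * M.nrm (β t) (deriv β t) - 1) ≤ ∫ t in a..b, F s t := by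
      refine intervalIntegral.integral_mono_on hab.le
        (Continuous.intervalIntegrable (by fun_prop) _ _)
        ((hFc s).intervalIntegrable _ _) fun t _ => ?_
      rw [hFe]
      nlinarith [sq_nonneg (M.nrm (β t) (deriv β t) - 1)]
    rw [intervalIntegral.integral_sub (Continuous.intervalIntegrable (by fun_prop) _ _) (by simp),
      intervalIntegral.integral_const_mul] at hmono
    simp only [intervalIntegral.integral_const, smul_eq_mul, mul_one] at hmono
    linarith
  have hzero : ∫ t in a..b, F 0 t = b - a := by
    have : ∀ t, F 0 t = 1 := fun t => by
      have h1 := hspeed t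
      simp only [hF, hbase, zero_smul, add_zero, ← nrm_sq_eq_en, h1, one_pow]
    simp [this]
  have hmin : IsLocalMin (fun s => ∫ t in a..b, F s t) 0 :=
    Eventually.of_forall fun s => by simpa only [hzero] using hlow s
  have hz := hmin.hasDerivAt_eq_zero hJ
  rw [← hz]
  refine intervalIntegral.integral_congr fun t _ => ?_
  have : dir t = φ t • ((e, 0) : Plane × Plane) + deriv φ t • ((0, e) : Plane × Plane) := by
    simp [hdir]
  simp only [hF', zero_smul, add_zero]
  rw [this, map_add, map_smul, map_smul, smul_eq_mul, smul_eq_mul]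

/-- The Euler–Lagrange equation. -/
lemma LocIso.euler_lagrange {γ : ℝ → Plane} (hγ : M.LocIso γ) (e : Plane) (t : ℝ) :
    HasDerivAt (fun t => fderiv ℝ M.en (γ t, deriv γ t) (0, e))
      (fderiv ℝ M.en (γ t, deriv γ t) (e, 0)) t := by
  obtain ⟨ε, hε, hi⟩ := hγ t
  have h1 := hγ.contDiff_one
  have hb : Continuous fun t => fderiv ℝ M.en (γ t, deriv γ t) :=
    M.continuous_fderiv_en.comp (h1.continuous.prodMk (h1.continuous_deriv le_rfl))
  exact hasDerivAt_of_variation (f := fun t => fderiv ℝ M.en (γ t, deriv γ t) (e, 0))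
    (hb.clm_apply continuous_const) (hb.clm_apply continuous_const)
    (show t - ε < t + ε by linarith)
    (fun φ hφ ha hb => hi.first_variation h1 hγ.nrm_deriv (by linarith) e hφ ha hb)
    ⟨by linarith, by linarith⟩

lemma fderiv_en_vertical (x v e : Plane) : fderiv ℝ M.en (x, v) (0, e) = 2 * M.g x v e := by
  have h1 : HasDerivAt (fun s : ℝ => (x, v) + s • ((0, e) : Plane × Plane)) (0, e) 0 := by
    simpa using ((hasDerivAt_id (0 : ℝ)).smul_const ((0, e) : Plane × Plane)).const_add (x, v)
  have h2 : HasDerivAt (fun s : ℝ => M.en ((x, v) + s • ((0, e) : Plane × Plane)))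
      (fderiv ℝ M.en (x, v) (0, e)) 0 := by
    have := M.hasFDerivAt_en ((x, v) + (0 : ℝ) • ((0, e) : Plane × Plane))
    have h3 := this.comp_hasDerivAt 0 h1
    simpa [Function.comp_def] using h3
  have h3 : (fun s : ℝ => M.en ((x, v) + s • ((0, e) : Plane × Plane))) =
      fun s => M.g x v v + s * (2 * M.g x v e) + s ^ 2 * M.g x e e := by
    funext s
    simp only [en, Prod.smul_mk, Prod.mk_add_mk, smul_zero, add_zero, g_add_left, g_add_right,
      g_smul_left, g_smul_right, M.symm x e v]
    ring
  have h4 : HasDerivAt (fun s : ℝ => M.g x v v + s * (2 * M.g x v e) + s ^ 2 * M.g x e e)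
      (2 * M.g x v e) 0 := by
    have := (((hasDerivAt_id (0 : ℝ)).mul_const (2 * M.g x v e)).const_add (M.g x v v)).add
      ((hasDerivAt_pow 2 (0 : ℝ)).mul_const (M.g x e e))
    refine HasDerivAt.congr_deriv (this : HasDerivAt (fun s : ℝ =>
      M.g x v v + s * (2 * M.g x v e) + s ^ 2 * M.g x e e) _ 0) (by simp)
  rw [h3] at h2
  exact h2.unique h4

variable (M)

/-- Determinant of the Gram matrix. -/
def gram (x : Plane) : ℝ :=
  M.g x (1, 0) (1, 0) * M.g x (0, 1) (0, 1) - M.g x (1, 0) (0, 1) * M.g x (1, 0) (0, 1)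

lemma gram_pos (x : Plane) : 0 < M.gram x := by
  have hC : 0 < M.g x (0, 1) (0, 1) := M.posdef x _ (by simp)
  have hw := M.posdef x (M.g x (0, 1) (0, 1) • (1, 0) - M.g x (1, 0) (0, 1) • (0, 1)) (by
    intro h
    have := congrArg Prod.fst h
    simp at this
    exact hC.ne' this)
  simp only [g_sub_left, g_sub_right, g_smul_left, g_smul_right, M.symm x (0, 1) (1, 0)] at hw
  unfold gram
  by_contra! hle
  nlinarith

/-- The velocity as a function of position and momentum. -/
def vel (y : Plane × Plane) : Plane :=
  ((M.g y.1 (0, 1) (0, 1) * y.2.1 - M.g y.1 (1, 0) (0, 1) * y.2.2) / (2 * M.gram y.1),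
    (M.g y.1 (1, 0) (1, 0) * y.2.2 - M.g y.1 (1, 0) (0, 1) * y.2.1) / (2 * M.gram y.1))

lemma contDiff_gram : ContDiff ℝ (⊤ : ℕ∞) M.gram :=
  ((M.contDiff_g_const _ _).mul (M.contDiff_g_const _ _)).sub
    ((M.contDiff_g_const _ _).mul (M.contDiff_g_const _ _))

lemma contDiff_vel : ContDiff ℝ (⊤ : ℕ∞) M.vel := by
  have hg : ∀ v w, ContDiff ℝ (⊤ : ℕ∞) fun y : Plane × Plane => M.g y.1 v w :=
    fun v w => (M.contDiff_g_const v w).comp contDiff_fst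
  have hd : ContDiff ℝ (⊤ : ℕ∞) fun y : Plane × Plane => 2 * M.gram y.1 :=
    contDiff_const.mul (M.contDiff_gram.comp contDiff_fst)
  have h1 : ContDiff ℝ (⊤ : ℕ∞) fun y : Plane × Plane => y.2.1 := contDiff_fst.comp contDiff_snd
  have h2 : ContDiff ℝ (⊤ : ℕ∞) fun y : Plane × Plane => y.2.2 := contDiff_snd.comp contDiff_snd
  have hne : ∀ y : Plane × Plane, 2 * M.gram y.1 ≠ 0 := fun y => by
    have := M.gram_pos y.1; positivity
  exact ((((hg _ _).mul h1).sub ((hg _ _).mul h2)).div hd hne).prodMk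
    ((((hg _ _).mul h2).sub ((hg _ _).mul h1)).div hd hne)

/-- The momentum of a tangent vector. -/
def mom (x v : Plane) : Plane := (2 * M.g x v (1, 0), 2 * M.g x v (0, 1))

lemma vel_mom (x v : Plane) : M.vel (x, M.mom x v) = v := by
  have h := M.gram_pos x
  have e1 := M.g_eq_sum x v (1, 0)
  have e2 := M.g_eq_sum x v (0, 1)
  simp only [mul_one, mul_zero, zero_mul, add_zero, zero_add] at e1 e2
  rw [M.symm x (0, 1) (1, 0)] at e1
  simp only [vel, mom, e1, e2]
  unfold gram at h ⊢
  ext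
  · simp only
    rw [div_eq_iff (by positivity)]
    ring
  · simp only
    rw [div_eq_iff (by positivity)]
    ring

/-- The Hamiltonian vector field in coordinates. -/
def field (y : Plane × Plane) : Plane × Plane :=
  (M.vel y, (fderiv ℝ M.en (y.1, M.vel y) ((1, 0), 0), fderiv ℝ M.en (y.1, M.vel y) ((0, 1), 0)))

lemma contDiff_field : ContDiff ℝ (⊤ : ℕ∞) M.field := by
  have hD : ContDiff ℝ (⊤ : ℕ∞) fun y : Plane × Plane => fderiv ℝ M.en (y.1, M.vel y) :=
    (M.contDiff_en.fderiv_right (m := (⊤ : ℕ∞)) (by simp)).comp (contDiff_fst.prodMk M.contDiff_vel)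
  exact M.contDiff_vel.prodMk
    ((hD.clm_apply contDiff_const).prodMk (hD.clm_apply contDiff_const))

variable {M}

lemma LocIso.hasDerivAt_field {γ : ℝ → Plane} (hγ : M.LocIso γ) (t : ℝ) :
    HasDerivAt (fun t => (γ t, M.mom (γ t) (deriv γ t)))
      (M.field (γ t, M.mom (γ t) (deriv γ t))) t := by
  have h1 := hγ.euler_lagrange (1, 0) t
  have h2 := hγ.euler_lagrange (0, 1) t
  simp only [fderiv_en_vertical] at h1 h2
  have h0 := (hγ.contDiff_one.differentiable one_ne_zero t).hasDerivAt
  have h := h0.prodMk (h1.prodMk h2)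
  have e : M.field (γ t, M.mom (γ t) (deriv γ t)) = (deriv γ t,
      (fderiv ℝ M.en (γ t, deriv γ t) ((1, 0), 0), fderiv ℝ M.en (γ t, deriv γ t) ((0, 1), 0))) := by
    simp only [field, vel_mom]
  rw [e]
  exact h

lemma LocIso.contDiff {γ : ℝ → Plane} (hγ : M.LocIso γ) : ContDiff ℝ (⊤ : ℕ∞) γ := by
  set y : ℝ → Plane × Plane := fun t => (γ t, M.mom (γ t) (deriv γ t)) with hy
  have hd : deriv y = M.field ∘ y := funext fun t => (hγ.hasDerivAt_field t).deriv
  have hn : ∀ n : ℕ, ContDiff ℝ n y := fun n => by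
    induction n with
    | zero => exact contDiff_zero.2 (continuous_iff_continuousAt.2 fun t =>
        (hγ.hasDerivAt_field t).continuousAt)
    | succ n ih =>
      push_cast
      refine contDiff_succ_iff_deriv.2 ⟨fun t => (hγ.hasDerivAt_field t).differentiableAt,
        by simp, ?_⟩
      rw [hd]
      exact (M.contDiff_field.of_le (by exact_mod_cast le_top)).comp ih
  exact contDiff_fst.comp (contDiff_infty.2 hn)

lemma LocIso.isGeodesic {γ : ℝ → Plane} (hγ : M.LocIso γ) : M.IsGeodesic γ := by
  refine ⟨hγ.contDiff, fun t => ?_, fun t => ?_⟩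
  · rw [← nrm_sq, hγ.nrm_deriv, one_pow]
  · obtain ⟨ε, hε, hi⟩ := hγ t
    refine ⟨ε, hε, fun s₁ s₂ h1 h12 h2 => ?_⟩
    rw [hi s₁ ⟨h1, by linarith⟩ s₂ ⟨by linarith, h2⟩, abs_sub_comm, abs_of_nonneg (by linarith),
      length_eq]
    simp [hγ.nrm_deriv]

lemma IsGeodesic.nrm_deriv {γ : ℝ → Plane} (hγ : M.IsGeodesic γ) (t : ℝ) :
    M.nrm (γ t) (deriv γ t) = 1 := by
  unfold nrm; rw [hγ.2.1 t, Real.sqrt_one]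

lemma IsGeodesic.length_eq {γ : ℝ → Plane} (hγ : M.IsGeodesic γ) (s t : ℝ) :
    M.length γ s t = t - s := by
  rw [TorusMetric.length_eq]
  simp [hγ.nrm_deriv]

lemma IsGeodesic.contDiff_one {γ : ℝ → Plane} (hγ : M.IsGeodesic γ) : ContDiff ℝ 1 γ :=
  hγ.1.of_le (by exact_mod_cast le_top)

lemma IsGeodesic.lip1 {γ : ℝ → Plane} (hγ : M.IsGeodesic γ) : M.Lip1 γ := by
  intro s t
  rcases le_total s t with h | h
  · have := dist_le_length (M := M) hγ.contDiff_one h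
    rw [hγ.length_eq] at this
    rw [abs_sub_comm]; exact this.trans (le_abs_self _)
  · have := dist_le_length (M := M) hγ.contDiff_one h
    rw [hγ.length_eq] at this
    rw [dist_comm]; exact this.trans (le_abs_self _)

lemma IsGeodesic.locIso {γ : ℝ → Plane} (hγ : M.IsGeodesic γ) : M.LocIso γ := by
  intro t
  obtain ⟨ε, hε, h⟩ := hγ.2.2 t
  refine ⟨ε, hε, fun s hs u hu => ?_⟩
  rcases le_total s u with hsu | hsu
  · rw [h s u hs.1 hsu hu.2, hγ.length_eq, abs_sub_comm, abs_of_nonneg (by linarith)]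
  · rw [dist_comm, h u s hu.1 hsu hs.2, hγ.length_eq, abs_of_nonneg (by linarith)]

/-- Geodesics are determined by their initial position and velocity. -/
lemma LocIso.eq_of_eq_of_deriv_eq {β γ : ℝ → Plane} (hβ : M.LocIso β) (hγ : M.LocIso γ) {t₀ : ℝ}
    (h0 : β t₀ = γ t₀) (h1 : deriv β t₀ = deriv γ t₀) : β = γ := by
  funext t
  set y : ℝ → Plane × Plane := fun t => (β t, M.mom (β t) (deriv β t)) with hy
  set z : ℝ → Plane × Plane := fun t => (γ t, M.mom (γ t) (deriv γ t)) with hz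
  have hyc : Continuous y := continuous_iff_continuousAt.2 fun t =>
    (hβ.hasDerivAt_field t).continuousAt
  have hzc : Continuous z := continuous_iff_continuousAt.2 fun t =>
    (hγ.hasDerivAt_field t).continuousAt
  set a := min t₀ t - 1
  set b := max t₀ t + 1
  obtain ⟨R₁, hR₁⟩ := isCompact_Icc.exists_bound_of_continuousOn (s := Icc a b) hyc.continuousOn
  obtain ⟨R₂, hR₂⟩ := isCompact_Icc.exists_bound_of_continuousOn (s := Icc a b) hzc.continuousOn
  set S := Metric.closedBall (0 : Plane × Plane) (max R₁ R₂)
  obtain ⟨K, hK⟩ := (isCompact_closedBall (0 : Plane × Plane)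
    (max R₁ R₂)).exists_bound_of_continuousOn
    (M.contDiff_field.continuous_fderiv (by simp)).continuousOn
  have hL : LipschitzOnWith K.toNNReal M.field S := by
    refine Convex.lipschitzOnWith_of_nnnorm_fderiv_le (𝕜 := ℝ)
      (fun x _ => M.contDiff_field.differentiable (by simp) x) (fun x hx => ?_)
      (convex_closedBall _ _)
    rw [← NNReal.coe_le_coe, coe_nnnorm]
    exact (hK x hx).trans (Real.le_coe_toNNReal K)
  have hmem : t₀ ∈ Ioo a b := ⟨by linarith [min_le_left t₀ t], by linarith [le_max_left t₀ t]⟩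
  have hmem' : t ∈ Icc a b := ⟨by linarith [min_le_right t₀ t], by linarith [le_max_right t₀ t]⟩
  have key := ODE_solution_unique_of_mem_Icc (v := fun _ => M.field) (s := fun _ => S)
    (fun _ _ => hL) hmem hyc.continuousOn (fun s _ => hβ.hasDerivAt_field s)
    (fun s hs => by simpa [S] using Or.inl (hR₁ s (Ioo_subset_Icc_self hs)))
    hzc.continuousOn (fun s _ => hγ.hasDerivAt_field s)
    (fun s hs => by simpa [S] using Or.inr (hR₂ s (Ioo_subset_Icc_self hs)))
    (by simp only [hy, hz, h0, h1]) hmem'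
  exact congrArg Prod.fst key

end TorusMetric

/-- A function on an interval that avoids two values stays between them. -/
lemma mem_Ioo_of_avoids {θ : ℝ → ℝ} (hθ : Continuous θ) {a b x y l u : ℝ} (hx : x ∈ Icc a b)
    (hy : y ∈ Icc a b) (h : ∀ t ∈ Icc a b, θ t ≠ l ∧ θ t ≠ u) (hxm : θ x ∈ Ioo l u) :
    θ y ∈ Ioo l u := by
  by_contra hc
  have hsub : uIcc x y ⊆ Icc a b := ordConnected_Icc.uIcc_subset hx hy
  have hivt := intermediate_value_uIcc (f := θ) (a := x) (b := y) hθ.continuousOn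
  simp only [mem_Ioo, not_and_or, not_lt] at hc
  rcases hc with hc | hc
  · obtain ⟨t, ht, e⟩ := hivt (mem_uIcc.2 (Or.inr ⟨hc, hxm.1.le⟩))
    exact (h t (hsub ht)).1 e
  · obtain ⟨t, ht, e⟩ := hivt (mem_uIcc.2 (Or.inl ⟨hxm.2.le, hc⟩))
    exact (h t (hsub ht)).2 e

/-- A nonvanishing function on a rectangle cannot map the four sides into the four half planes
in cyclic order. -/
lemma no_winding {F : ℝ × ℝ → ℂ} (hF : Continuous F) (h0 : ∀ z, F z ≠ 0) {R : ℝ} (hR : 0 < R)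
    (h1 : ∀ s, 0 < (F (0, s)).im) (h2 : ∀ s, (F (1, s)).im < 0)
    (h3 : ∀ t ∈ Icc (0 : ℝ) 1, 0 < (F (t, R)).re)
    (h4 : ∀ t ∈ Icc (0 : ℝ) 1, (F (t, -R)).re < 0) : False := by
  obtain ⟨e₀, he₀⟩ : ∃ e, Complex.exp e = F (0, 0) :=
    ⟨Complex.log (F (0, 0)), Complex.exp_log (h0 _)⟩
  obtain ⟨g, ⟨-, hg⟩, -⟩ := Complex.isCoveringMap_exp.existsUnique_continuousMap_lifts
    (⟨fun z => (⟨F z, h0 z⟩ : {z : ℂ // z ≠ 0}), by fun_prop⟩ : C(ℝ × ℝ, {z : ℂ // z ≠ 0}))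
    (0, 0) e₀ (Subtype.ext he₀)
  have hg' : ∀ z, Complex.exp (g z) = F z := fun z => congrArg Subtype.val (congrFun hg z)
  set θ : ℝ × ℝ → ℝ := fun z => (g z).im with hθ
  have hθc : Continuous θ := Complex.continuous_im.comp g.continuous
  have hre : ∀ z, (F z).re = Real.exp (g z).re * Real.cos (θ z) := fun z => by
    rw [← hg' z, Complex.exp_re]
  have him : ∀ z, (F z).im = Real.exp (g z).re * Real.sin (θ z) := fun z => by
    rw [← hg' z, Complex.exp_im]
  have s1 : ∀ s, 0 < Real.sin (θ (0, s)) := fun s => by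
    have := h1 s
    rw [him] at this
    exact (pos_iff_pos_of_mul_pos this).1 (Real.exp_pos _)
  have s2 : ∀ s, Real.sin (θ (1, s)) < 0 := fun s => by
    have := h2 s
    rw [him] at this
    by_contra! hc
    exact absurd this (not_lt.2 (mul_nonneg (Real.exp_pos _).le hc))
  have s3 : ∀ t ∈ Icc (0 : ℝ) 1, 0 < Real.cos (θ (t, R)) := fun t ht => by
    have := h3 t ht
    rw [hre] at this
    exact (pos_iff_pos_of_mul_pos this).1 (Real.exp_pos _)
  have s4 : ∀ t ∈ Icc (0 : ℝ) 1, Real.cos (θ (t, -R)) < 0 := fun t ht => by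
    have := h4 t ht
    rw [hre] at this
    by_contra! hc
    exact absurd this (not_lt.2 (mul_nonneg (Real.exp_pos _).le hc))
  have hpi := Real.pi_pos
  have m0 : (0 : ℝ) ∈ Icc (0 : ℝ) 1 := by simp
  have m1 : (1 : ℝ) ∈ Icc (0 : ℝ) 1 := by simp
  -- normalize the angle at the corner `(0, R)`
  obtain ⟨k, hk⟩ : ∃ k : ℤ, θ (0, R) - k * (2 * Real.pi) ∈ Ico (-(Real.pi)) (-Real.pi + 2 * Real.pi) := by
    obtain ⟨k, hk, -⟩ := existsUnique_sub_zsmul_mem_Ico Real.two_pi_pos (θ (0, R)) (-Real.pi)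
    exact ⟨k, by simpa using hk⟩
  set φ : ℝ × ℝ → ℝ := fun z => θ z - k * (2 * Real.pi) with hφ
  have hφc : Continuous φ := by fun_prop
  have hsin : ∀ z, Real.sin (φ z) = Real.sin (θ z) := fun z => Real.sin_sub_int_mul_two_pi _ _
  have hcos : ∀ z, Real.cos (φ z) = Real.cos (θ z) := fun z => Real.cos_sub_int_mul_two_pi _ _
  simp only [← hsin, ← hcos] at s1 s2 s3 s4
  have sinz : ∀ {x : ℝ}, Real.sin x ≠ 0 → x ≠ 0 ∧ x ≠ Real.pi :=
    fun h => ⟨by rintro rfl; simp at h, by rintro rfl; simp at h⟩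
  have c0 : φ (0, R) ∈ Ioo 0 Real.pi := by
    have hs := s1 R
    refine ⟨?_, ?_⟩
    · by_contra! hle
      exact absurd (Real.sin_nonpos_of_nonpos_of_neg_pi_le hle hk.1) (not_le.2 hs)
    · have := hk.2
      simp only [hφ]
      linarith
  have c1 : φ (0, -R) ∈ Ioo 0 Real.pi :=
    mem_Ioo_of_avoids (θ := fun s => φ (0, s)) (by fun_prop) (a := -R) (b := R) (x := R)
      ⟨by linarith, le_rfl⟩ ⟨le_rfl, by linarith⟩ (fun s _ => sinz (s1 s).ne') c0
  have d0 : φ (0, R) ∈ Ioo (-(Real.pi / 2)) (Real.pi / 2) := by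
    refine ⟨by linarith [c0.1], ?_⟩
    by_contra! hle
    exact absurd (Real.cos_nonpos_of_pi_div_two_le_of_le hle (by linarith [c0.2]))
      (not_le.2 (s3 0 m0))
  have d1 : φ (1, R) ∈ Ioo (-(Real.pi / 2)) (Real.pi / 2) :=
    mem_Ioo_of_avoids (θ := fun t => φ (t, R)) (by fun_prop) m0 m1
      (fun t ht => ⟨fun h => by have := s3 t ht; simp [h] at this,
        fun h => by have := s3 t ht; simp [h] at this⟩) d0
  have hc3 : Real.cos (Real.pi / 2 + Real.pi) = 0 := by rw [Real.cos_add_pi]; simp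
  have e0 : φ (0, -R) ∈ Ioo (Real.pi / 2) (Real.pi / 2 + Real.pi) := by
    refine ⟨?_, by linarith [c1.2]⟩
    by_contra! hle
    exact absurd (Real.cos_nonneg_of_neg_pi_div_two_le_of_le (by linarith [c1.1]) hle)
      (not_le.2 (s4 0 m0))
  have e1 : φ (1, -R) ∈ Ioo (Real.pi / 2) (Real.pi / 2 + Real.pi) :=
    mem_Ioo_of_avoids (θ := fun t => φ (t, -R)) (by fun_prop) m0 m1
      (fun t ht => ⟨fun h => by have := s4 t ht; simp [h] at this,
        fun h => by have := s4 t ht; simp only [h, hc3, lt_irrefl] at this⟩) e0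
  have f1 : φ (1, R) < 0 := by
    by_contra! hle
    exact absurd (Real.sin_nonneg_of_nonneg_of_le_pi hle (by linarith [d1.2])) (not_le.2 (s2 R))
  obtain ⟨s, -, hs⟩ := intermediate_value_uIcc (f := fun s => φ (1, s)) (a := R) (b := -R)
    (by fun_prop) (mem_uIcc.2 (Or.inl ⟨f1.le, by linarith [e1.1]⟩) : (0 : ℝ) ∈ _)
  have := s2 s
  simp only at hs
  simp [hs] at this

/-- The height above the direction of `k`. -/
def ht (k : ℤ × ℤ) (v : Plane) : ℝ := k.1 * v.2 - k.2 * v.1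

/-- The coordinate along the direction of `k`. -/
def wd (k : ℤ × ℤ) (v : Plane) : ℝ := k.1 * v.1 + k.2 * v.2

@[fun_prop]
lemma continuous_ht (k : ℤ × ℤ) : Continuous (ht k) := by unfold ht; fun_prop

@[fun_prop]
lemma continuous_wd (k : ℤ × ℤ) : Continuous (wd k) := by unfold wd; fun_prop

lemma ht_add (k : ℤ × ℤ) (v w : Plane) : ht k (v + w) = ht k v + ht k w := by
  simp only [ht, Prod.fst_add, Prod.snd_add]; ring

lemma ht_smul (k : ℤ × ℤ) (a : ℝ) (v : Plane) : ht k (a • v) = a * ht k v := by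
  simp only [ht, Prod.smul_fst, Prod.smul_snd, smul_eq_mul]; ring

lemma wd_add (k : ℤ × ℤ) (v w : Plane) : wd k (v + w) = wd k v + wd k w := by
  simp only [wd, Prod.fst_add, Prod.snd_add]; ring

lemma wd_smul (k : ℤ × ℤ) (a : ℝ) (v : Plane) : wd k (a • v) = a * wd k v := by
  simp only [wd, Prod.smul_fst, Prod.smul_snd, smul_eq_mul]; ring

lemma ht_lat_self (k : ℤ × ℤ) : ht k (lat k) = 0 := by simp [ht, lat]; ring

lemma wd_lat_self_pos {k : ℤ × ℤ} (hk : k ≠ 0) : 0 < wd k (lat k) := by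
  have : (k.1 : ℝ) ≠ 0 ∨ (k.2 : ℝ) ≠ 0 := by
    by_contra! h
    exact hk (Prod.ext (by exact_mod_cast h.1) (by exact_mod_cast h.2))
  simp only [wd, lat]
  rcases this with h | h
  · nlinarith [mul_self_pos.2 h, mul_self_nonneg (k.2 : ℝ)]
  · nlinarith [mul_self_pos.2 h, mul_self_nonneg (k.1 : ℝ)]

namespace TorusMetric

variable {M : TorusMetric}

/-- A globally minimizing unit speed curve that the translation by `k` shifts by `A > 0`. -/
structure Axis (M : TorusMetric) (α : ℝ → Plane) (k : ℤ × ℤ) (A : ℝ) : Prop where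
  iso : ∀ s t, M.dist (α s) (α t) = |s - t|
  pos : 0 < A
  per : ∀ s, α (s + A) = α s + lat k

namespace Axis

variable {α : ℝ → Plane} {k : ℤ × ℤ} {A : ℝ}

lemma lip1 (h : M.Axis α k A) : M.Lip1 α := fun s t => (h.iso s t).le

lemma continuous (h : M.Axis α k A) : Continuous α := h.lip1.continuous

lemma locIso (h : M.Axis α k A) : M.LocIso α := fun _ => ⟨1, one_pos, fun s _ u _ => h.iso s u⟩

lemma ne_zero (h : M.Axis α k A) : k ≠ 0 := by
  rintro rfl
  have h1 := h.iso (0 + A) 0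
  rw [h.per 0] at h1
  simp only [lat_zero, add_zero, M.dist_self, zero_add, sub_zero] at h1
  exact absurd (abs_eq_zero.1 h1.symm) h.pos.ne'

lemma injective (h : M.Axis α k A) : Function.Injective α := fun s t e => by
  have := h.iso s t
  rw [e, M.dist_self] at this
  exact sub_eq_zero.1 (abs_eq_zero.1 this.symm)

lemma per_int (h : M.Axis α k A) (n : ℤ) (s : ℝ) : α (s + n * A) = α s + (n : ℝ) • lat k := by
  induction n using Int.induction_on with
  | zero => simp
  | succ n ih =>
    have := h.per (s + n * A)
    push_cast at ih ⊢
    rw [show s + (n + 1) * A = s + n * A + A by ring, this, ih]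
    module
  | pred n ih =>
    have := h.per (s + (-n - 1) * A)
    push_cast at ih ⊢
    rw [show s + (-(n : ℝ) - 1) * A + A = s + -(n : ℝ) * A by ring, ih] at this
    rw [eq_sub_of_add_eq this.symm]
    module

lemma add_lat (h : M.Axis α k A) (l : ℤ × ℤ) : M.Axis (fun s => α s + lat l) k A :=
  ⟨fun s t => by rw [M.dist_add_lat, h.iso], h.pos, fun s => by simp only [h.per s]; abel⟩

/-- Every parameter can be shifted into a fundamental domain. -/
lemma exists_shift (h : M.Axis α k A) (s : ℝ) : ∃ n : ℤ, s + n * A ∈ Ico 0 A := by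
  obtain ⟨n, hn, -⟩ := existsUnique_add_zsmul_mem_Ico h.pos s 0
  exact ⟨n, by simpa using hn⟩

lemma ht_per (h : M.Axis α k A) (n : ℤ) (s : ℝ) : ht k (α (s + n * A)) = ht k (α s) := by
  rw [h.per_int, ht_add, ht_smul, ht_lat_self, mul_zero, add_zero]

lemma exists_highest (h : M.Axis α k A) : ∃ s₀, ∀ s, ht k (α s) ≤ ht k (α s₀) := by
  obtain ⟨s₀, -, hs₀⟩ := isCompact_Icc.exists_isMaxOn (nonempty_Icc.2 h.pos.le)
    (((continuous_ht k).comp h.continuous).continuousOn)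
  refine ⟨s₀, fun s => ?_⟩
  obtain ⟨n, hn⟩ := h.exists_shift s
  rw [← h.ht_per n s]
  exact hs₀ (Ico_subset_Icc_self hn)

lemma exists_lowest (h : M.Axis α k A) : ∃ s₀, ∀ s, ht k (α s₀) ≤ ht k (α s) := by
  obtain ⟨s₀, -, hs₀⟩ := isCompact_Icc.exists_isMinOn (nonempty_Icc.2 h.pos.le)
    (((continuous_ht k).comp h.continuous).continuousOn)
  refine ⟨s₀, fun s => ?_⟩
  obtain ⟨n, hn⟩ := h.exists_shift s
  rw [← h.ht_per n s]
  exact hs₀ (Ico_subset_Icc_self hn)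

/-- A path from below to above meets the axis. -/
theorem crossing (h : M.Axis α k A) {p : ℝ → Plane} (hp : ContinuousOn p (Icc 0 1))
    (h0 : ∀ s, ht k (p 0) < ht k (α s)) (h1 : ∀ s, ht k (α s) < ht k (p 1)) :
    ∃ t ∈ Icc (0 : ℝ) 1, p t ∈ range α := by
  by_contra! hcon
  set q : ℝ → Plane := fun t => p (projIcc 0 1 zero_le_one t) with hq
  have hqc : Continuous q := (continuousOn_iff_continuous_domRestrict.1 hp).comp continuous_projIcc
  have hqp : ∀ t ∈ Icc (0 : ℝ) 1, q t = p t := fun t ht => by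
    simp only [hq, projIcc_of_mem zero_le_one ht]
  have hqr : ∀ t, q t ∉ range α := fun t => hcon _ (projIcc 0 1 zero_le_one t).2
  obtain ⟨C, hC⟩ : ∃ C, ∀ t ∈ Icc (0 : ℝ) 1, |wd k (p t)| ≤ C := by
    obtain ⟨C, hC⟩ := isCompact_Icc.exists_bound_of_continuousOn
      ((continuous_wd k).comp_continuousOn hp)
    exact ⟨C, hC⟩
  have hw := wd_lat_self_pos h.ne_zero
  obtain ⟨n, hn⟩ := exists_nat_gt ((C + |wd k (α 0)|) / wd k (lat k))
  rw [div_lt_iff₀ hw] at hn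
  have hC0 : 0 ≤ C := (abs_nonneg _).trans (hC 0 (by simp))
  have hn0 : (0 : ℝ) < n := by
    by_contra! hle
    nlinarith [abs_nonneg (wd k (α 0))]
  have hwd : ∀ m : ℤ, wd k (α (m * A)) = wd k (α 0) + m * wd k (lat k) := fun m => by
    have := h.per_int m 0
    rw [zero_add] at this
    rw [this, wd_add, wd_smul]
  have hk0 : ∀ w : Plane, ht k w = 0 → wd k w = 0 → w = 0 := fun w e1 e2 => by
    simp only [ht, wd, lat] at e1 e2 hw
    have x1 : w.1 * (k.1 * k.1 + k.2 * k.2) = 0 := by linear_combination (k.1 : ℝ) * e2 - (k.2 : ℝ) * e1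
    have x2 : w.2 * (k.1 * k.1 + k.2 * k.2) = 0 := by linear_combination (k.2 : ℝ) * e2 + (k.1 : ℝ) * e1
    exact Prod.ext ((mul_eq_zero.1 x1).resolve_right hw.ne') ((mul_eq_zero.1 x2).resolve_right hw.ne')
  have hα := h.continuous
  refine no_winding (F := fun z => (⟨wd k (α z.2) - wd k (q z.1), ht k (α z.2) - ht k (q z.1)⟩ : ℂ))
    ?_ ?_ (R := n * A) (mul_pos hn0 h.pos) ?_ ?_ ?_ ?_
  · have e : (fun z : ℝ × ℝ => (⟨wd k (α z.2) - wd k (q z.1), ht k (α z.2) - ht k (q z.1)⟩ : ℂ)) =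
        fun z => ((wd k (α z.2) - wd k (q z.1) : ℝ) : ℂ) +
          ((ht k (α z.2) - ht k (q z.1) : ℝ) : ℂ) * Complex.I := by
      funext z
      rw [Complex.mk_eq_add_mul_I]
    rw [e]
    fun_prop
  · intro z hz
    have e1 := congrArg Complex.re hz
    have e2 := congrArg Complex.im hz
    simp only [Complex.zero_re, Complex.zero_im] at e1 e2
    have hsub : α z.2 - q z.1 = 0 := by
      refine hk0 _ ?_ ?_
      · rw [← e2]; simp only [ht, Prod.fst_sub, Prod.snd_sub]; ring
      · rw [← e1]; simp only [wd, Prod.fst_sub, Prod.snd_sub]; ring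
    exact hqr z.1 ⟨z.2, sub_eq_zero.1 hsub⟩
  · intro s
    simp only [hqp 0 (by simp)]
    linarith [h0 s]
  · intro s
    simp only [hqp 1 (by simp)]
    linarith [h1 s]
  · intro t ht
    have := hwd n
    push_cast at this
    simp only [hqp t ht, this]
    have h1 := abs_le.1 (hC t ht)
    have h2 := neg_abs_le (wd k (α 0))
    linarith [h1.2]
  · intro t ht
    have := hwd (-n)
    push_cast at this
    rw [neg_mul] at this
    simp only [hqp t ht, this]
    have h1 := abs_le.1 (hC t ht)
    have h2 := le_abs_self (wd k (α 0))
    linarith [h1.1]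

end Axis

end TorusMetric

namespace TorusMetric

variable {M : TorusMetric}

/-- The region above `α`. -/
def above (k : ℤ × ℤ) (α : ℝ → Plane) : Set Plane :=
  {x | ∃ y, (∀ s, ht k (α s) < ht k y) ∧ JoinedIn (range α)ᶜ x y}

/-- The region below `α`. -/
def below (k : ℤ × ℤ) (α : ℝ → Plane) : Set Plane :=
  {x | ∃ y, (∀ s, ht k y < ht k (α s)) ∧ JoinedIn (range α)ᶜ x y}

section basic

variable {k : ℤ × ℤ} {α : ℝ → Plane}

lemma not_mem_of_mem_above {x : Plane} (hx : x ∈ above k α) : x ∉ range α := by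
  obtain ⟨y, -, hy⟩ := hx
  exact hy.source_mem

lemma not_mem_of_mem_below {x : Plane} (hx : x ∈ below k α) : x ∉ range α := by
  obtain ⟨y, -, hy⟩ := hx
  exact hy.source_mem

lemma mem_above_of_lt {x : Plane} (hx : ∀ s, ht k (α s) < ht k x) : x ∈ above k α :=
  ⟨x, hx, JoinedIn.refl (by rintro ⟨s, rfl⟩; exact lt_irrefl _ (hx s))⟩

lemma mem_below_of_lt {x : Plane} (hx : ∀ s, ht k x < ht k (α s)) : x ∈ below k α :=
  ⟨x, hx, JoinedIn.refl (by rintro ⟨s, rfl⟩; exact lt_irrefl _ (hx s))⟩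

lemma mem_above_of_joinedIn {x y : Plane} (h : JoinedIn (range α)ᶜ x y) (hx : x ∈ above k α) :
    y ∈ above k α := by
  obtain ⟨z, hz, hj⟩ := hx
  exact ⟨z, hz, h.symm.trans hj⟩

lemma mem_below_of_joinedIn {x y : Plane} (h : JoinedIn (range α)ᶜ x y) (hx : x ∈ below k α) :
    y ∈ below k α := by
  obtain ⟨z, hz, hj⟩ := hx
  exact ⟨z, hz, h.symm.trans hj⟩

/-- A curve avoiding `α` on an interval has its points joined in the complement. -/
lemma joinedIn_of_avoids {γ : ℝ → Plane} {I : Set ℝ} (hI : I.OrdConnected)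
    (hγ : ContinuousOn γ I) (h : ∀ t ∈ I, γ t ∉ range α) {s t : ℝ} (hs : s ∈ I) (ht : t ∈ I) :
    JoinedIn (range α)ᶜ (γ s) (γ t) := by
  have h1 : JoinedIn I s t := JoinedIn.of_segment_subset (by
    rw [segment_eq_uIcc]; exact hI.uIcc_subset hs ht)
  have h2 := h1.map_continuousOn hγ
  exact h2.mono (by rintro _ ⟨u, hu, rfl⟩; exact h u hu)

lemma mem_above_of_avoids {γ : ℝ → Plane} {I : Set ℝ} (hI : I.OrdConnected)
    (hγ : ContinuousOn γ I) (h : ∀ t ∈ I, γ t ∉ range α) {s t : ℝ} (hs : s ∈ I) (ht : t ∈ I)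
    (hsa : γ s ∈ above k α) : γ t ∈ above k α :=
  mem_above_of_joinedIn (joinedIn_of_avoids hI hγ h hs ht) hsa

lemma mem_below_of_avoids {γ : ℝ → Plane} {I : Set ℝ} (hI : I.OrdConnected)
    (hγ : ContinuousOn γ I) (h : ∀ t ∈ I, γ t ∉ range α) {s t : ℝ} (hs : s ∈ I) (ht : t ∈ I)
    (hsa : γ s ∈ below k α) : γ t ∈ below k α :=
  mem_below_of_joinedIn (joinedIn_of_avoids hI hγ h hs ht) hsa

end basic

namespace Axis

variable {α : ℝ → Plane} {k : ℤ × ℤ} {A : ℝ}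

/-- The axis is a proper curve. -/
lemma isClosed_range (h : M.Axis α k A) : IsClosed (range α) := by
  refine IsClosedEmbedding.isClosed_range (f := α) ?_
  refine IsClosedEmbedding.of_continuous_injective_isClosedMap h.continuous h.injective ?_
  refine (IsProperMap.isClosedMap ?_)
  refine isProperMap_iff_tendsto_cocompact.2 ⟨h.continuous, ?_⟩
  rw [← Metric.cobounded_eq_cocompact (α := Plane), ← Metric.cobounded_eq_cocompact (α := ℝ)]
  rw [tendsto_iff_comap, ← tendsto_iff_comap, ← tendsto_norm_atTop_iff_cobounded]
  have hb : ∀ s, (|s| / M.up) - ‖α 0‖ ≤ ‖α s‖ := fun s => by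
    have h1 := M.dist_le_up (α s) (α 0)
    rw [h.iso, sub_zero] at h1
    have h2 := norm_sub_le (α s) (α 0)
    have h3 : |s| / M.up ≤ ‖α s - α 0‖ := by
      rw [div_le_iff₀ M.up_pos]; linarith
    linarith
  refine tendsto_atTop_mono hb ?_
  refine tendsto_atTop_add_const_right _ _ (Tendsto.atTop_div_const M.up_pos ?_)
  exact tendsto_norm_cobounded_atTop

lemma isOpen_above (h : M.Axis α k A) : IsOpen (above k α) := by
  refine isOpen_iff_mem_nhds.2 fun x hx => ?_
  obtain ⟨r, hr, hb⟩ := Metric.isOpen_iff.1 h.isClosed_range.isOpen_compl x (not_mem_of_mem_above hx)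
  refine Filter.mem_of_superset (Metric.ball_mem_nhds x hr) fun y hy => ?_
  exact mem_above_of_joinedIn (JoinedIn.of_segment_subset
    (((convex_ball x r).segment_subset (Metric.mem_ball_self hr) hy).trans hb)) hx

lemma isOpen_below (h : M.Axis α k A) : IsOpen (below k α) := by
  refine isOpen_iff_mem_nhds.2 fun x hx => ?_
  obtain ⟨r, hr, hb⟩ := Metric.isOpen_iff.1 h.isClosed_range.isOpen_compl x (not_mem_of_mem_below hx)
  refine Filter.mem_of_superset (Metric.ball_mem_nhds x hr) fun y hy => ?_
  exact mem_below_of_joinedIn (JoinedIn.of_segment_subset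
    (((convex_ball x r).segment_subset (Metric.mem_ball_self hr) hy).trans hb)) hx

lemma disjoint_above_below (h : M.Axis α k A) {x : Plane} (hu : x ∈ above k α)
    (hd : x ∈ below k α) : False := by
  obtain ⟨y, hy, hxy⟩ := hu
  obtain ⟨z, hz, hxz⟩ := hd
  obtain ⟨p, hp⟩ := hxz.symm.trans hxy
  obtain ⟨t, ht, hm⟩ := h.crossing (p := p.extend) p.continuous_extend.continuousOn
    (by simpa using hz) (by simpa using hy)
  rw [Path.extend_apply _ ht] at hm
  exact hp _ hm

/-- A curve from below to above meets the axis. -/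
lemma exists_mem_of_below_above (h : M.Axis α k A) {γ : ℝ → Plane} (hγ : Continuous γ) {s t : ℝ}
    (hs : γ s ∈ below k α) (ht : γ t ∈ above k α) : ∃ u ∈ uIcc s t, γ u ∈ range α := by
  by_contra! hcon
  exact h.disjoint_above_below ht
    (mem_below_of_avoids ordConnected_uIcc hγ.continuousOn hcon left_mem_uIcc right_mem_uIcc hs)

lemma range_add_lat (h : M.Axis α k A) {x : Plane} (n : ℤ) :
    x + (n : ℝ) • lat k ∈ range α ↔ x ∈ range α := by
  constructor
  · rintro ⟨s, hs⟩
    refine ⟨s + (-n : ℤ) * A, ?_⟩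
    rw [h.per_int, hs]; push_cast; module
  · rintro ⟨s, rfl⟩
    exact ⟨s + n * A, h.per_int n s⟩

lemma add_mem_above (h : M.Axis α k A) {x : Plane} (hx : x ∈ above k α) (n : ℤ) :
    x + (n : ℝ) • lat k ∈ above k α := by
  obtain ⟨y, hy, hxy⟩ := hx
  refine ⟨y + (n : ℝ) • lat k, fun s => ?_, ?_⟩
  · rw [ht_add, ht_smul, ht_lat_self, mul_zero, add_zero]; exact hy s
  · refine (hxy.map (f := fun z => z + (n : ℝ) • lat k) (by fun_prop)).mono ?_
    rintro _ ⟨z, hz, rfl⟩ hm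
    exact hz ((h.range_add_lat n).1 hm)

end Axis

end TorusMetric

/-- Rotation by a quarter turn. -/
def rot (v : Plane) : Plane := (-v.2, v.1)

@[fun_prop]
lemma contDiff_rot {n : WithTop ℕ∞} : ContDiff ℝ n rot := by unfold rot; fun_prop

/-- The normal coordinates along a curve. -/
def nb (β : ℝ → Plane) (z : ℝ × ℝ) : Plane := β z.1 + z.2 • rot (deriv β z.1)

lemma nb_zero (β : ℝ → Plane) (s : ℝ) : nb β (s, 0) = β s := by simp [nb]

lemma contDiff_nb {β : ℝ → Plane} (hβ : ContDiff ℝ (⊤ : ℕ∞) β) : ContDiff ℝ 1 (nb β) := by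
  have h1 : ContDiff ℝ 1 β := hβ.of_le (by exact_mod_cast le_top)
  have h2 : ContDiff ℝ 1 (deriv β) :=
    (contDiff_infty_iff_deriv.1 hβ).2.of_le (by exact_mod_cast le_top)
  have h3 : ContDiff ℝ 1 fun z : ℝ × ℝ => rot (deriv β z.1) :=
    contDiff_rot.comp (h2.comp contDiff_fst)
  exact (h1.comp contDiff_fst).add (contDiff_snd.smul h3)

lemma crossDet_rot_pos {v : Plane} (hv : v ≠ 0) : 0 < v.1 * v.1 + v.2 * v.2 := by
  have : v.1 ≠ 0 ∨ v.2 ≠ 0 := by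
    by_contra! h
    exact hv (Prod.ext h.1 h.2)
  rcases this with h | h
  · nlinarith [mul_self_pos.2 h, mul_self_nonneg v.2]
  · nlinarith [mul_self_pos.2 h, mul_self_nonneg v.1]

/-- Normal coordinates straighten a regular curve; a transversal curve moves across. -/
lemma exists_chart {β : ℝ → Plane} (hβ : ContDiff ℝ (⊤ : ℕ∞) β) {s₀ : ℝ} (h0 : deriv β s₀ ≠ 0) :
    ∃ e : OpenPartialHomeomorph (ℝ × ℝ) Plane, (s₀, (0 : ℝ)) ∈ e.source ∧ (∀ z, e z = nb β z) ∧
      ∀ (γ : ℝ → Plane) (t₀ : ℝ) (v : Plane), HasDerivAt γ v t₀ → γ t₀ = β s₀ →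
        crossDet (deriv β s₀) v ≠ 0 →
          ∃ y ≠ 0, HasDerivAt (fun t => (e.symm (γ t)).2) y t₀ := by
  set w := deriv β s₀ with hw
  have hpos := crossDet_rot_pos h0
  set L : (ℝ × ℝ) →L[ℝ] Plane := (ContinuousLinearMap.fst ℝ ℝ ℝ).smulRight w +
    (ContinuousLinearMap.snd ℝ ℝ ℝ).smulRight (rot w) with hL
  have hLv : ∀ z, L z = z.1 • w + z.2 • rot w := fun z => by simp [hL]
  have hinj : Function.Injective (L : (ℝ × ℝ) →ₗ[ℝ] Plane) := by
    refine (injective_iff_map_eq_zero _).2 fun z hz => ?_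
    change L z = 0 at hz
    rw [hLv] at hz
    have e1 := congrArg Prod.fst hz
    have e2 := congrArg Prod.snd hz
    simp only [rot, Prod.fst_add, Prod.smul_fst, Prod.snd_add, Prod.smul_snd, smul_eq_mul,
      Prod.fst_zero, Prod.snd_zero] at e1 e2
    have x1 : z.1 * (w.1 * w.1 + w.2 * w.2) = 0 := by linear_combination w.1 * e1 + w.2 * e2
    have x2 : z.2 * (w.1 * w.1 + w.2 * w.2) = 0 := by linear_combination w.1 * e2 - w.2 * e1
    exact Prod.ext ((mul_eq_zero.1 x1).resolve_right hpos.ne')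
      ((mul_eq_zero.1 x2).resolve_right hpos.ne')
  set E : (ℝ × ℝ) ≃L[ℝ] Plane :=
    (LinearEquiv.ofInjectiveEndo (L : (ℝ × ℝ) →ₗ[ℝ] (ℝ × ℝ)) hinj).toContinuousLinearEquiv with hE
  have hEL : (E : (ℝ × ℝ) →L[ℝ] Plane) = L := by ext <;> rfl
  have hd : HasFDerivAt (nb β) (E : (ℝ × ℝ) →L[ℝ] Plane) (s₀, 0) := by
    rw [hEL]
    have d1 : HasFDerivAt (fun z : ℝ × ℝ => β z.1)
        ((ContinuousLinearMap.fst ℝ ℝ ℝ).smulRight w) (s₀, 0) := by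
      have := ((hβ.differentiable (by simp)) s₀).hasDerivAt.hasFDerivAt
      have h2 := HasFDerivAt.comp ((s₀, (0 : ℝ)) : ℝ × ℝ) (f := Prod.fst) this hasFDerivAt_fst
      refine HasFDerivAt.congr_fderiv (f := fun z : ℝ × ℝ => β z.1) h2 ?_
      ext <;> simp [hw]
    have hg : DifferentiableAt ℝ (fun z : ℝ × ℝ => rot (deriv β z.1)) (s₀, 0) := by
      have h2 : ContDiff ℝ (⊤ : ℕ∞) (deriv β) := (contDiff_infty_iff_deriv.1 hβ).2
      have h3 : ContDiff ℝ (⊤ : ℕ∞) fun z : ℝ × ℝ => rot (deriv β z.1) :=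
        contDiff_rot.comp (h2.comp contDiff_fst)
      exact (h3.differentiable (by simp)) _
    have d2 := (hasFDerivAt_snd (𝕜 := ℝ) (p := ((s₀, (0 : ℝ)) : ℝ × ℝ))).smul hg.hasFDerivAt
    have d3 := d1.add d2
    refine d3.congr_fderiv ?_
    simp [hL, hw]
  have hs := (contDiff_nb hβ).contDiffAt.hasStrictFDerivAt' hd one_ne_zero
  refine ⟨hs.toOpenPartialHomeomorph (nb β), hs.mem_toOpenPartialHomeomorph_source,
    fun z => rfl, fun γ t₀ v hγ hγ0 hv => ?_⟩
  have hinv := hs.to_localInverse.hasFDerivAt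
  rw [hs.localInverse_def, nb_zero, ← hγ0] at hinv
  have hcomp := hinv.comp_hasDerivAt t₀ hγ
  have hsnd := (ContinuousLinearMap.snd ℝ ℝ ℝ).hasFDerivAt.comp_hasDerivAt t₀ hcomp
  refine ⟨(E.symm v).2, fun hy => hv ?_, hsnd⟩
  have hz : L (E.symm v) = v := by rw [← hEL]; exact E.apply_symm_apply v
  rw [hLv, hy, zero_smul, add_zero] at hz
  rw [← hz]
  simp only [crossDet, Prod.smul_fst, Prod.smul_snd, smul_eq_mul]
  ring

/-- A function with nonzero derivative changes its sign at a zero. -/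
lemma sign_change {f : ℝ → ℝ} {y t₀ : ℝ} (hf : HasDerivAt f y t₀) (h0 : f t₀ = 0)
    {σ : ℝ} (hσ : 0 < σ * y) :
    (∀ᶠ t in 𝓝[>] t₀, 0 < σ * f t) ∧ ∀ᶠ t in 𝓝[<] t₀, 0 < -σ * f t := by
  have hd : HasDerivAt (fun t => σ * f t) (σ * y) t₀ := hf.const_mul σ
  have := eventually_nhdsWithin_sign_eq_of_deriv_pos (f := fun t => σ * f t) (x₀ := t₀)
    (by rw [hd.deriv]; exact hσ) (by simp [h0])
  constructor
  · filter_upwards [nhdsWithin_le_nhds this, self_mem_nhdsWithin] with t ht hlt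
    have h1 : SignType.sign (t - t₀) = 1 := sign_pos (sub_pos.2 hlt)
    rw [h1] at ht
    exact sign_eq_one_iff.1 ht
  · filter_upwards [nhdsWithin_le_nhds this, self_mem_nhdsWithin] with t ht hlt
    have h1 : SignType.sign (t - t₀) = -1 := sign_neg (sub_neg.2 hlt)
    rw [h1] at ht
    have := sign_eq_neg_one_iff.1 ht
    linarith

namespace TorusMetric

variable {M : TorusMetric}

lemma LocIso.deriv_ne_zero {γ : ℝ → Plane} (hγ : M.LocIso γ) (t : ℝ) : deriv γ t ≠ 0 := fun h => by
  have := hγ.nrm_deriv t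
  rw [h, M.nrm_zero] at this
  exact zero_ne_one this

namespace Axis

variable {α : ℝ → Plane} {k : ℤ × ℤ} {A : ℝ}

/-- Near an axis the normal coordinates see only the base curve. -/
lemma exists_collar (h : M.Axis α k A) (s₀ : ℝ) {e : OpenPartialHomeomorph (ℝ × ℝ) Plane}
    (he0 : (s₀, (0 : ℝ)) ∈ e.source) (he : ∀ z, e z = nb α z) :
    ∃ δ > 0, Metric.ball (s₀, (0 : ℝ)) δ ⊆ e.source ∧
      ∀ z ∈ Metric.ball (s₀, (0 : ℝ)) δ, nb α z ∈ range α → z.2 = 0 := by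
  obtain ⟨ε, hε, hball⟩ := Metric.isOpen_iff.1 e.open_source _ he0
  have hc : Continuous fun z => M.dist (nb α z) (α s₀) := by
    have h1 := (contDiff_nb h.locIso.contDiff).continuous
    fun_prop
  have hev : ∀ᶠ z in 𝓝 (s₀, (0 : ℝ)), M.dist (nb α z) (α s₀) < ε := by
    refine hc.continuousAt.eventually_lt continuousAt_const ?_
    rw [nb_zero, M.dist_self]; exact hε
  obtain ⟨δ, hδ, hb⟩ := Metric.eventually_nhds_iff_ball.1 hev
  refine ⟨min δ ε, lt_min hδ hε, (Metric.ball_subset_ball (min_le_right _ _)).trans hball, ?_⟩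
  rintro z hz ⟨s, hs⟩
  have hd := hb z (Metric.ball_subset_ball (min_le_left _ _) hz)
  rw [← hs, h.iso] at hd
  have hmem : (s, (0 : ℝ)) ∈ e.source := hball (by
    rw [Metric.mem_ball, Prod.dist_eq]
    simpa [Real.dist_eq, hε] using hd)
  have := e.injOn hmem (hball (Metric.ball_subset_ball (min_le_right _ _) hz))
    (by rw [he, he, nb_zero, hs])
  rw [← this]

/-- The set of parameters at which the side `σ` of the axis lies in `W`. -/
def _root_.TorusMetric.sideSet (α : ℝ → Plane) (W : Set Plane) (σ : ℝ) : Set ℝ :=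
  {s | ∃ δ > 0, ∀ z ∈ Metric.ball (s, (0 : ℝ)) δ, 0 < σ * z.2 → nb α z ∈ W}

variable {W : Set Plane}

/-- If a point on one side of the axis near `α s₀` is in `W` then the side lies in `W`. -/
lemma exists_side (h : M.Axis α k A)
    (hW : ∀ x y, JoinedIn (range α)ᶜ x y → x ∈ W → y ∈ W) (s₀ : ℝ) :
    ∃ e : OpenPartialHomeomorph (ℝ × ℝ) Plane, (s₀, (0 : ℝ)) ∈ e.source ∧ (∀ z, e z = nb α z) ∧
      (∀ (γ : ℝ → Plane) (t₀ : ℝ) (v : Plane), HasDerivAt γ v t₀ → γ t₀ = α s₀ →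
        crossDet (deriv α s₀) v ≠ 0 →
          ∃ y ≠ 0, HasDerivAt (fun t => (e.symm (γ t)).2) y t₀) ∧
      ∃ δ > 0, Metric.ball (s₀, (0 : ℝ)) δ ⊆ e.source ∧
      (∀ z ∈ Metric.ball (s₀, (0 : ℝ)) δ, nb α z ∈ range α → z.2 = 0) ∧
      ∀ σ : ℝ, ∀ z ∈ Metric.ball (s₀, (0 : ℝ)) δ, 0 < σ * z.2 → nb α z ∈ W → s₀ ∈ sideSet α W σ := by
  obtain ⟨e, he0, he, hcr⟩ := exists_chart h.locIso.contDiff (h.locIso.deriv_ne_zero s₀)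
  obtain ⟨δ, hδ, hsrc, hcol⟩ := h.exists_collar s₀ he0 he
  refine ⟨e, he0, he, hcr, δ, hδ, hsrc, hcol, fun σ z hz hσz hzW => ⟨δ, hδ, fun w hw hσw => ?_⟩⟩
  refine hW _ _ ?_ hzW
  have hseg : segment ℝ z w ⊆ Metric.ball (s₀, (0 : ℝ)) δ ∩ {z | 0 < σ * z.2} := by
    refine ((convex_ball _ _).inter ?_).segment_subset ⟨hz, hσz⟩ ⟨hw, hσw⟩
    exact convex_halfSpace_gt (f := fun z : ℝ × ℝ => σ * z.2)
      ⟨fun x y => by simp [mul_add], fun c x => by simp; ring⟩ 0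
  have hj := (JoinedIn.of_segment_subset hseg).map (contDiff_nb h.locIso.contDiff).continuous
  refine hj.mono ?_
  rintro _ ⟨u, ⟨hu1, hu2⟩, rfl⟩ hm
  rw [Set.mem_ofPred_eq, hcol u hu1 hm, mul_zero] at hu2
  exact lt_irrefl _ hu2

lemma isClopen_sideSet (h : M.Axis α k A)
    (hW : ∀ x y, JoinedIn (range α)ᶜ x y → x ∈ W → y ∈ W) {σ : ℝ} (hσ : σ = 1 ∨ σ = -1) :
    IsClopen (sideSet α W σ) := by
  have hdist : ∀ s s' : ℝ, Dist.dist (s, (0 : ℝ)) (s', (0 : ℝ)) = |s - s'| := fun s s' => by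
    rw [Prod.dist_eq]; simp [Real.dist_eq]
  constructor
  · refine isClosed_of_closure_subset fun s₀ hs₀ => ?_
    obtain ⟨e, -, -, -, δ, hδ, -, -, hside⟩ := h.exists_side hW s₀
    obtain ⟨s, ⟨δ', hδ', hs⟩, hss⟩ := Metric.mem_closure_iff.1 hs₀ δ hδ
    obtain ⟨r, hr0, hr1⟩ := exists_between (lt_min hδ hδ')
    have hr2 := lt_min_iff.1 hr1
    have hσ2 : 0 < σ * (σ * r) := by rcases hσ with rfl | rfl <;> simpa using hr0
    have habs : |σ * r| = r := by
      rcases hσ with rfl | rfl <;> simp [abs_of_pos hr0]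
    refine hside σ (s, σ * r) ?_ hσ2 (hs (s, σ * r) ?_ hσ2)
    · rw [Metric.mem_ball, Prod.dist_eq]
      simp only [max_lt_iff, Real.dist_eq, sub_zero, habs, hr2.1, and_true]
      rw [abs_sub_comm]
      rwa [Real.dist_eq] at hss
    · rw [Metric.mem_ball, Prod.dist_eq]
      simpa only [Real.dist_eq, sub_self, sub_zero, abs_zero, habs] using max_lt hδ' hr2.2
  · refine Metric.isOpen_iff.2 ?_
    rintro s ⟨δ, hδ, hs⟩
    refine ⟨δ, hδ, fun s' hs' => ⟨δ - Dist.dist s' s, sub_pos.2 hs', fun z hz hσz => hs z ?_ hσz⟩⟩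
    rw [Metric.mem_ball] at hz ⊢
    have h1 := _root_.dist_triangle z (s', (0 : ℝ)) (s, (0 : ℝ))
    rw [hdist, ← Real.dist_eq] at h1
    linarith

/-- A vertical ray at an extreme point decides the type of one side. -/
lemma exists_sideSet_eq_univ (h : M.Axis α k A)
    (hW : ∀ x y, JoinedIn (range α)ᶜ x y → x ∈ W → y ∈ W) (hWα : ∀ x ∈ W, x ∉ range α)
    {s₀ : ℝ} {u : Plane} (hu : ∀ t > 0, α s₀ + (t : ℝ) • u ∈ W) :
    ∃ σ : ℝ, (σ = 1 ∨ σ = -1) ∧ sideSet α W σ = univ := by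
  obtain ⟨e, he0, he, -, δ, hδ, hsrc, hcol, hside⟩ := h.exists_side hW s₀
  have he1 : e (s₀, 0) = α s₀ := by rw [he, nb_zero]
  have htgt : α s₀ ∈ e.target := he1 ▸ e.map_source he0
  have hcont : Tendsto (fun t : ℝ => α s₀ + t • u) (𝓝[>] 0) (𝓝 (α s₀)) := by
    have : Continuous fun t : ℝ => α s₀ + t • u := by fun_prop
    have := (this.tendsto 0).mono_left (nhdsWithin_le_nhds (s := Ioi 0))
    simpa using this
  have hsymm : Tendsto e.symm (𝓝 (α s₀)) (𝓝 (s₀, 0)) := by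
    have := (e.continuousAt_symm htgt).tendsto
    rwa [← he1, e.left_inv he0, he1] at this
  have ev1 := hcont.eventually (hsymm.eventually (Metric.ball_mem_nhds (s₀, (0 : ℝ)) hδ))
  have ev2 := hcont.eventually (e.open_target.mem_nhds htgt)
  obtain ⟨t, ht1, ht2, ht0⟩ := (ev1.and (ev2.and self_mem_nhdsWithin)).exists
  set z := e.symm (α s₀ + t • u) with hz
  have hez : nb α z = α s₀ + t • u := by rw [← he, hz, e.right_inv ht2]
  have hzW : nb α z ∈ W := hez ▸ hu t ht0
  have hz2 : z.2 ≠ 0 := fun h0 => by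
    refine hWα _ hzW ⟨z.1, ?_⟩
    rw [← nb_zero α z.1, ← h0]
  have huniv : ∀ σ : ℝ, (σ = 1 ∨ σ = -1) → 0 < σ * z.2 → sideSet α W σ = univ := fun σ hσ hp =>
    (isClopen_iff.1 (h.isClopen_sideSet hW hσ)).resolve_left fun hemp => by
      have := hside σ z ht1 hp hzW
      rw [hemp] at this
      exact this
  rcases hz2.lt_or_gt with h1 | h1
  · exact ⟨-1, Or.inr rfl, huniv _ (Or.inr rfl) (by linarith)⟩
  · exact ⟨1, Or.inl rfl, huniv _ (Or.inl rfl) (by linarith)⟩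

/-- One side of the axis is above, the other one below. -/
theorem exists_sides (h : M.Axis α k A) : ∃ σ : ℝ, (σ = 1 ∨ σ = -1) ∧
    sideSet α (above k α) σ = univ ∧ sideSet α (below k α) (-σ) = univ := by
  have hu : 0 < ht k (rot (lat k)) := by
    have := wd_lat_self_pos h.ne_zero
    simp only [ht, rot, lat, wd] at this ⊢
    linarith
  obtain ⟨s₁, hs₁⟩ := h.exists_highest
  obtain ⟨s₂, hs₂⟩ := h.exists_lowest
  obtain ⟨σ, hσ, hσu⟩ := h.exists_sideSet_eq_univ (W := above k α)
    (fun x y hxy hx => mem_above_of_joinedIn hxy hx) (fun x hx => not_mem_of_mem_above hx)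
    (s₀ := s₁) (u := rot (lat k)) fun t ht => mem_above_of_lt fun s => by
      rw [ht_add, ht_smul]
      have := hs₁ s
      have := mul_pos ht hu
      linarith
  obtain ⟨σ', hσ', hσu'⟩ := h.exists_sideSet_eq_univ (W := below k α)
    (fun x y hxy hx => mem_below_of_joinedIn hxy hx) (fun x hx => not_mem_of_mem_below hx)
    (s₀ := s₂) (u := (-1 : ℝ) • rot (lat k)) fun t ht => mem_below_of_lt fun s => by
      rw [ht_add, ht_smul, ht_smul]
      have := hs₂ s
      have := mul_pos ht hu
      linarith
  have hne : σ ≠ σ' := by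
    rintro rfl
    obtain ⟨δ, hδ, h1⟩ := (hσu ▸ mem_univ 0 : (0 : ℝ) ∈ sideSet α (above k α) σ)
    obtain ⟨δ', hδ', h2⟩ := (hσu' ▸ mem_univ 0 : (0 : ℝ) ∈ sideSet α (below k α) σ)
    obtain ⟨r, hr0, hr1⟩ := exists_between (lt_min hδ hδ')
    have hr2 := lt_min_iff.1 hr1
    have hσ2 : 0 < σ * (σ * r) := by rcases hσ with rfl | rfl <;> simpa using hr0
    have habs : |σ * r| = r := by
      rcases hσ with rfl | rfl <;> simp [abs_of_pos hr0]
    have hb : ∀ ε, r < ε → ((0 : ℝ), σ * r) ∈ Metric.ball ((0 : ℝ), (0 : ℝ)) ε := fun ε hε => by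
      rw [Metric.mem_ball, Prod.dist_eq]
      simpa only [Real.dist_eq, sub_self, sub_zero, abs_zero, habs] using max_lt (hr0.trans hε) hε
    exact h.disjoint_above_below (h1 _ (hb _ hr2.1) hσ2) (h2 _ (hb _ hr2.2) hσ2)
  refine ⟨σ, hσ, hσu, ?_⟩
  rcases hσ with rfl | rfl <;> rcases hσ' with rfl | rfl
  · exact absurd rfl hne
  · exact hσu'
  · rwa [neg_neg]
  · exact absurd rfl hne

/-- A curve crossing the axis transversally changes sides. -/
theorem changes_side (h : M.Axis α k A) {γ : ℝ → Plane} {t₀ s₀ : ℝ} {v : Plane}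
    (hγ : HasDerivAt γ v t₀) (h0 : γ t₀ = α s₀) (hv : crossDet (deriv α s₀) v ≠ 0) :
    ((∀ᶠ t in 𝓝[>] t₀, γ t ∈ above k α) ∧ ∀ᶠ t in 𝓝[<] t₀, γ t ∈ below k α) ∨
      (∀ᶠ t in 𝓝[>] t₀, γ t ∈ below k α) ∧ ∀ᶠ t in 𝓝[<] t₀, γ t ∈ above k α := by
  obtain ⟨σ, hσ, hup, hdown⟩ := h.exists_sides
  obtain ⟨e, he0, he, hcr⟩ := exists_chart h.locIso.contDiff (h.locIso.deriv_ne_zero s₀)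
  obtain ⟨y, hy, hf⟩ := hcr γ t₀ v hγ h0 hv
  obtain ⟨δ, hδ, h1⟩ := (hup ▸ mem_univ s₀ : s₀ ∈ sideSet α (above k α) σ)
  obtain ⟨δ', hδ', h2⟩ := (hdown ▸ mem_univ s₀ : s₀ ∈ sideSet α (below k α) (-σ))
  have he1 : e (s₀, 0) = γ t₀ := by rw [he, nb_zero, h0]
  have htgt : γ t₀ ∈ e.target := he1 ▸ e.map_source he0
  have hsymm : Tendsto e.symm (𝓝 (γ t₀)) (𝓝 (s₀, 0)) := by
    have := (e.continuousAt_symm htgt).tendsto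
    rwa [← he1, e.left_inv he0, he1] at this
  have hf0 : (e.symm (γ t₀)).2 = 0 := by rw [← he1, e.left_inv he0]
  have hγc := hγ.continuousAt.tendsto
  have ev1 := hγc.eventually (hsymm.eventually (Metric.ball_mem_nhds (s₀, (0 : ℝ)) hδ))
  have ev2 := hγc.eventually (hsymm.eventually (Metric.ball_mem_nhds (s₀, (0 : ℝ)) hδ'))
  have ev3 := hγc.eventually (e.open_target.mem_nhds htgt)
  have hab : ∀ᶠ t in 𝓝 t₀, 0 < σ * (e.symm (γ t)).2 → γ t ∈ above k α := by
    filter_upwards [ev1, ev3] with t ht1 ht3 hp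
    have := h1 _ ht1 hp
    rwa [← he, e.right_inv ht3] at this
  have hbe : ∀ᶠ t in 𝓝 t₀, 0 < -σ * (e.symm (γ t)).2 → γ t ∈ below k α := by
    filter_upwards [ev2, ev3] with t ht1 ht3 hp
    have := h2 _ ht1 hp
    rwa [← he, e.right_inv ht3] at this
  have hσ0 : σ ≠ 0 := by rcases hσ with rfl | rfl <;> norm_num
  rcases (mul_ne_zero hσ0 hy).lt_or_gt with hs | hs
  · obtain ⟨c1, c2⟩ := sign_change hf hf0 (σ := -σ) (by linarith)
    right
    refine ⟨?_, ?_⟩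
    · filter_upwards [c1, nhdsWithin_le_nhds hbe] with t a b using b a
    · filter_upwards [c2, nhdsWithin_le_nhds hab] with t a b using b (by simpa using a)
  · obtain ⟨c1, c2⟩ := sign_change hf hf0 hs
    left
    refine ⟨?_, ?_⟩
    · filter_upwards [c1, nhdsWithin_le_nhds hab] with t a b using b a
    · filter_upwards [c2, nhdsWithin_le_nhds hbe] with t a b using b a

end Axis

end TorusMetric

namespace TorusMetric

attribute [local irreducible] TorusMetric.dist

variable (M : TorusMetric)

/-- The Busemann-type barrier of the backward end of the axis `α`. -/
def bar (α : ℝ → Plane) (x : Plane) : ℝ := ⨅ s, (M.dist (α s) x + s)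

/-- The curve with reversed time. -/
def rev (α : ℝ → Plane) : ℝ → Plane := fun s => α (-s)

/-- The minimal excess of the transition from `α` to `α₁`. -/
def gap (α α₁ : ℝ → Plane) : ℝ := M.bar (rev α₁) (α 0)

variable {M}

lemma Lip1.dist_le_sub {γ : ℝ → Plane} (h : M.Lip1 γ) {s t : ℝ} (hst : s ≤ t) :
    M.dist (γ s) (γ t) ≤ t - s := by
  have := h s t
  rwa [abs_sub_comm, abs_of_nonneg (sub_nonneg.2 hst)] at this

/-- A monotone function with a period is constant. -/
lemma eq_of_antitone_of_periodic {f : ℝ → ℝ} (hf : Antitone f) {A : ℝ} (hA : 0 < A)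
    (hp : ∀ s, f (s + A) = f s) (s t : ℝ) : f s = f t := by
  have hn : ∀ (n : ℕ) (s : ℝ), f (s + n * A) = f s := fun n => by
    induction n with
    | zero => intro s; simp
    | succ n ih =>
      intro s
      rw [show s + ((n + 1 : ℕ) : ℝ) * A = s + n * A + A by push_cast; ring, hp, ih]
  have key : ∀ s t, f s ≤ f t := fun s t => by
    obtain ⟨n, hn'⟩ := exists_nat_gt ((t - s) / A)
    rw [div_lt_iff₀ hA] at hn'
    rw [← hn n s]
    exact hf (by linarith)
  exact le_antisymm (key s t) (key t s)

namespace Axis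

variable {α α₁ : ℝ → Plane} {k : ℤ × ℤ} {A : ℝ}

lemma rev (h : M.Axis α k A) : M.Axis (rev α) (-k) A where
  iso s t := by
    have := h.iso (-s) (-t)
    rwa [neg_sub_neg, abs_sub_comm] at this
  pos := h.pos
  per s := by
    have := h.per (-(s + A))
    rw [show -(s + A) + A = -s by ring] at this
    simp only [TorusMetric.rev]
    rw [this, lat_neg, add_neg_cancel_right]

lemma bddBelow_bar (h : M.Axis α k A) (x : Plane) :
    BddBelow (range fun s => M.dist (α s) x + s) := by
  refine ⟨-M.dist (α 0) x, ?_⟩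
  rintro _ ⟨s, rfl⟩
  have h1 := dist_triangle (M := M) (α s) x (α 0)
  rw [h.iso, dist_comm x, sub_zero] at h1
  have := neg_abs_le s
  dsimp only
  linarith

lemma bar_le (h : M.Axis α k A) (s : ℝ) (x : Plane) : M.bar α x ≤ M.dist (α s) x + s :=
  ciInf_le (h.bddBelow_bar x) s

lemma _root_.TorusMetric.le_bar {x : Plane} {b : ℝ} (hb : ∀ s, b ≤ M.dist (α s) x + s) :
    b ≤ M.bar α x := le_ciInf hb

lemma bar_le_add (h : M.Axis α k A) (x y : Plane) : M.bar α y ≤ M.bar α x + M.dist x y := by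
  rw [← sub_le_iff_le_add]
  refine le_bar fun s => ?_
  have h1 := h.bar_le s y
  have h2 := dist_triangle (M := M) (α s) x y
  linarith

@[simp] lemma bar_self (h : M.Axis α k A) (s : ℝ) : M.bar α (α s) = s := by
  refine le_antisymm ?_ (le_bar fun r => ?_)
  · have := h.bar_le s (α s)
    rwa [dist_self, zero_add] at this
  · rw [h.iso]
    have := neg_abs_le (r - s)
    linarith

lemma bar_add_lat (h : M.Axis α k A) (n : ℤ) (x : Plane) :
    M.bar α (x + (n : ℝ) • lat k) = M.bar α x + n * A := by
  have key : ∀ (n : ℤ) (x : Plane), M.bar α x + n * A ≤ M.bar α (x + (n : ℝ) • lat k) :=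
    fun n x => le_bar fun s => by
      have h1 := h.bar_le (s - n * A) x
      have h2 := h.per_int n (s - n * A)
      rw [sub_add_cancel] at h2
      rw [h2, ← lat_zsmul, dist_add_lat]
      linarith
  refine le_antisymm ?_ (key n x)
  have := key (-n) (x + (n : ℝ) • lat k)
  push_cast at this
  rw [neg_smul, add_neg_cancel_right] at this
  linarith

lemma continuous_bar (h : M.Axis α k A) : Continuous (M.bar α) := by
  refine continuous_iff_continuousAt.2 fun x => ?_
  refine tendsto_iff_norm_sub_tendsto_zero.2 ?_
  have h1 : Tendsto (fun y => M.dist x y) (𝓝 x) (𝓝 0) := by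
    have := tendsto_dist (M := M) (tendsto_const_nhds (x := x)) (tendsto_id (x := 𝓝 x))
    rwa [dist_self] at this
  refine squeeze_zero (fun _ => norm_nonneg _) (fun y => ?_) h1
  rw [Real.norm_eq_abs, abs_le]
  have := h.bar_le_add x y
  have h3 := h.bar_le_add y x
  rw [dist_comm] at h3
  constructor <;> linarith

/-- The barrier is approximated uniformly on compact sets. -/
lemma bar_approx (h : M.Axis α k A) {K : Set Plane} (hK : IsCompact K) {ε : ℝ} (hε : 0 < ε) :
    ∃ N, ∀ s ≤ N, ∀ x ∈ K, M.dist (α s) x + s ≤ M.bar α x + ε := by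
  have hmono : ∀ x, Monotone fun s => M.dist (α s) x + s := fun x s t hst => by
    have h1 := dist_triangle (M := M) (α s) (α t) x
    rw [h.iso, abs_sub_comm, abs_of_nonneg (by linarith)] at h1
    dsimp only
    linarith
  refine hK.induction_on (p := fun K => ∃ N, ∀ s ≤ N, ∀ x ∈ K, M.dist (α s) x + s ≤ M.bar α x + ε)
    ⟨0, fun s _ x hx => hx.elim⟩ ?_ ?_ ?_
  · rintro K K' hKK ⟨N, hN⟩
    exact ⟨N, fun s hs x hx => hN s hs x (hKK hx)⟩
  · rintro K K' ⟨N, hN⟩ ⟨N', hN'⟩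
    refine ⟨min N N', fun s hs x hx => ?_⟩
    rcases hx with hx | hx
    · exact hN s (hs.trans (min_le_left _ _)) x hx
    · exact hN' s (hs.trans (min_le_right _ _)) x hx
  · intro x _
    obtain ⟨N, hN⟩ := exists_lt_of_ciInf_lt (show M.bar α x < M.bar α x + ε / 2 by linarith)
    have hev : ∀ᶠ y in 𝓝 x, M.dist (α N) y + N < M.bar α y + ε := by
      have := h.continuous_bar
      refine ContinuousAt.eventually_lt (by fun_prop) (by fun_prop) ?_
      linarith
    refine ⟨{y | M.dist (α N) y + N < M.bar α y + ε}, nhdsWithin_le_nhds hev, N,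
      fun s hs y hy => (hmono y hs).trans (le_of_lt hy)⟩


end Axis

section Pair

variable {α α₁ : ℝ → Plane} {k : ℤ × ℤ} {A : ℝ}

lemma Axis.bar_rev_left (h : M.Axis α k A) (h₁ : M.Axis α₁ k A) (s : ℝ) :
    M.bar (TorusMetric.rev α₁) (α s) = M.gap α α₁ - s := by
  have hanti : Antitone fun s => -(M.bar (TorusMetric.rev α₁) (α s) + s) := fun s t hst => by
    have h1 := h₁.rev.bar_le_add (α t) (α s)
    rw [h.iso, abs_of_nonneg (by linarith)] at h1
    dsimp only
    linarith
  have hper : ∀ s, -(M.bar (TorusMetric.rev α₁) (α (s + A)) + (s + A)) =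
      -(M.bar (TorusMetric.rev α₁) (α s) + s) := fun s => by
    have h1 := h₁.rev.bar_add_lat (-1) (α s)
    rw [h.per, show lat k = ((-1 : ℤ) : ℝ) • lat (-k) by simp [lat_neg], h1]
    push_cast
    ring
  have := eq_of_antitone_of_periodic hanti h.pos hper s 0
  unfold gap
  linarith

lemma Axis.gap_le (h : M.Axis α k A) (h₁ : M.Axis α₁ k A) (x y : Plane) :
    M.gap α α₁ ≤ M.bar α x + M.dist x y + M.bar (TorusMetric.rev α₁) y := by
  have : M.gap α α₁ - M.dist x y - M.bar (TorusMetric.rev α₁) y ≤ M.bar α x := le_bar fun s => by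
    have h1 := h₁.rev.bar_le_add y (α s)
    rw [h.bar_rev_left h₁] at h1
    have h2 := dist_triangle (M := M) (α s) x y
    rw [dist_comm y] at h1
    linarith
  linarith

lemma Axis.bar_rev_right (h₁ : M.Axis α₁ k A) (t : ℝ) :
    M.bar (TorusMetric.rev α₁) (α₁ t) = -t := by
  have := h₁.rev.bar_self (-t)
  rwa [TorusMetric.rev, neg_neg] at this

lemma Axis.bar_right (h : M.Axis α k A) (h₁ : M.Axis α₁ k A) (t : ℝ) :
    M.bar α (α₁ t) = M.gap α α₁ + t := by
  have hanti : Antitone fun t => M.bar α (α₁ t) - t := fun s t hst => by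
    have h1 := h.bar_le_add (α₁ s) (α₁ t)
    rw [h₁.iso, abs_sub_comm, abs_of_nonneg (by linarith)] at h1
    dsimp only
    linarith
  have hper : ∀ s, M.bar α (α₁ (s + A)) - (s + A) = M.bar α (α₁ s) - s := fun s => by
    have h1 := h.bar_add_lat 1 (α₁ s)
    rw [Int.cast_one, one_smul] at h1
    rw [h₁.per, h1]
    ring
  have hle : M.bar α (α₁ t) - t ≤ M.gap α α₁ := le_bar fun r => by
    rw [eq_of_antitone_of_periodic hanti h.pos hper t (-r)]
    have := h.bar_le 0 (α₁ (-r))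
    rw [TorusMetric.rev, dist_comm]
    linarith
  have h2 := h.gap_le h₁ (α₁ t) (α₁ t)
  rw [dist_self, h₁.bar_rev_right] at h2
  linarith

/-- The curves of excess at most `ε` for the transition from `α` to `α₁`. -/
structure EC (M : TorusMetric) (α α₁ : ℝ → Plane) (ε : ℝ) (γ : ℝ → Plane) : Prop where
  lip : M.Lip1 γ
  ec : ∀ s t, s ≤ t → M.bar α (γ s) + (t - s) + M.bar (TorusMetric.rev α₁) (γ t) ≤ M.gap α α₁ + ε

lemma EC.mono {ε ε' : ℝ} {γ : ℝ → Plane} (hγ : EC M α α₁ ε γ) (hε : ε ≤ ε') : EC M α α₁ ε' γ :=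
  ⟨hγ.lip, fun s t hst => (hγ.ec s t hst).trans (by linarith)⟩

lemma EC.comp_add {ε : ℝ} {γ : ℝ → Plane} (hγ : EC M α α₁ ε γ) (a : ℝ) :
    EC M α α₁ ε fun t => γ (t + a) :=
  ⟨hγ.lip.comp_add a, fun s t hst => by
    have := hγ.ec (s + a) (t + a) (by linarith)
    linarith⟩

lemma EC.add_lat (h : M.Axis α k A) (h₁ : M.Axis α₁ k A) {ε : ℝ} {γ : ℝ → Plane}
    (hγ : EC M α α₁ ε γ) (n : ℤ) : EC M α α₁ ε fun t => γ t + (n : ℝ) • lat k := by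
  refine ⟨?_, fun s t hst => ?_⟩
  · rw [← lat_zsmul]; exact hγ.lip.add_lat _
  · have h1 := h.bar_add_lat n (γ s)
    have h2 := h₁.rev.bar_add_lat (-n) (γ t)
    rw [lat_neg] at h2
    push_cast at h2
    rw [smul_neg, neg_smul, neg_neg] at h2
    rw [h1, h2]
    have := hγ.ec s t hst
    linarith

lemma EC.sub_le_dist (h : M.Axis α k A) (h₁ : M.Axis α₁ k A) {ε : ℝ} {γ : ℝ → Plane}
    (hγ : EC M α α₁ ε γ) (s t : ℝ) : |s - t| - ε ≤ M.dist (γ s) (γ t) := by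
  wlog hst : s ≤ t generalizing s t
  · rw [dist_comm, abs_sub_comm]
    exact this _ _ (le_of_not_ge hst)
  have h1 := h.gap_le h₁ (γ s) (γ t)
  have h2 := hγ.ec s t hst
  rw [abs_sub_comm, abs_of_nonneg (by linarith)]
  linarith

lemma EC.of_bounds {γ : ℝ → Plane} (hγ : M.Lip1 γ) {a b ε : ℝ} (hab : a + b ≤ M.gap α α₁ + ε)
    (ha : ∀ p, M.bar α (γ p) ≤ a + p) (hb : ∀ q, M.bar (TorusMetric.rev α₁) (γ q) ≤ b - q) :
    EC M α α₁ ε γ :=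
  ⟨hγ, fun s t _ => by
    have := ha s
    have := hb t
    linarith⟩

lemma EC.left (h : M.Axis α k A) (h₁ : M.Axis α₁ k A) : EC M α α₁ 0 α :=
  EC.of_bounds (a := 0) (b := M.gap α α₁) h.lip1 (by linarith)
    (fun p => by rw [h.bar_self]; linarith) fun q => by rw [h.bar_rev_left h₁]

lemma EC.right (h : M.Axis α k A) (h₁ : M.Axis α₁ k A) : EC M α α₁ 0 α₁ :=
  EC.of_bounds (a := M.gap α α₁) (b := 0) h₁.lip1 (by linarith)
    (fun p => by rw [h.bar_right h₁]) fun q => by rw [h₁.bar_rev_right]; linarith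

/-- The value of the barrier at a fixed time bounds it along a 1-Lipschitz curve. -/
lemma Axis.bar_le_of_lip (h : M.Axis α k A) {γ : ℝ → Plane} (hγ : M.Lip1 γ) {s t : ℝ}
    (hst : s ≤ t) : M.bar α (γ t) ≤ M.bar α (γ s) + (t - s) := by
  have h1 := h.bar_le_add (γ s) (γ t)
  have h2 := hγ.dist_le_sub hst
  linarith

lemma Axis.bar_rev_le_of_lip (h : M.Axis α k A) {γ : ℝ → Plane} (hγ : M.Lip1 γ) {s t : ℝ}
    (hst : s ≤ t) :
    M.bar (TorusMetric.rev α) (γ s) ≤ M.bar (TorusMetric.rev α) (γ t) + (t - s) := by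
  have h1 := h.rev.bar_le_add (γ t) (γ s)
  have h2 := hγ.dist_le_sub hst
  rw [dist_comm] at h1
  linarith

lemma EC.tendsto (h : M.Axis α k A) (h₁ : M.Axis α₁ k A) {l : Filter ℕ} [l.NeBot] {ε : ℕ → ℝ}
    {ε₀ : ℝ} {γ : ℕ → ℝ → Plane} {L : ℝ → Plane} (hγ : ∀ n, EC M α α₁ (ε n) (γ n))
    (hε : Tendsto ε l (𝓝 ε₀)) (hL : ∀ t, Tendsto (fun n => γ n t) l (𝓝 (L t))) :
    EC M α α₁ ε₀ L where
  lip s t := le_of_tendsto (tendsto_dist (hL s) (hL t)) (Eventually.of_forall fun n => (hγ n).lip s t)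
  ec s t hst := by
    have h1 := (h.continuous_bar.tendsto _).comp (hL s)
    have h2 := (h₁.rev.continuous_bar.tendsto _).comp (hL t)
    exact le_of_tendsto_of_tendsto ((h1.add_const (t - s)).add h2) (hε.const_add (M.gap α α₁))
      (Eventually.of_forall fun n => (hγ n).ec s t hst)

/-- Almost minimal curves subconverge to minimal ones. -/
lemma EC.exists_limit (h : M.Axis α k A) (h₁ : M.Axis α₁ k A) {ε : ℕ → ℝ} {γ : ℕ → ℝ → Plane}
    (hγ : ∀ n, EC M α α₁ (ε n) (γ n)) (hε : Tendsto ε atTop (𝓝 0)) {B : ℝ}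
    (hB : ∀ n, ‖γ n 0‖ ≤ B) :
    ∃ L, EC M α α₁ 0 L ∧ ∀ t, Tendsto (fun n => γ n t) (hyperfilter ℕ) (𝓝 (L t)) := by
  obtain ⟨L, -, hL⟩ := exists_hyperlimit (fun n => (hγ n).lip) hB
  exact ⟨L, EC.tendsto h h₁ hγ (hε.mono_left Nat.hyperfilter_le_atTop) hL, hL⟩

lemma EC.isoOn (h : M.Axis α k A) (h₁ : M.Axis α₁ k A) {γ : ℝ → Plane} (hγ : EC M α α₁ 0 γ)
    (s t : ℝ) : M.dist (γ s) (γ t) = |s - t| :=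
  le_antisymm (hγ.lip s t) (by simpa using hγ.sub_le_dist h h₁ s t)

lemma EC.locIso (h : M.Axis α k A) (h₁ : M.Axis α₁ k A) {γ : ℝ → Plane} (hγ : EC M α α₁ 0 γ) :
    M.LocIso γ := fun _ => ⟨1, one_pos, fun s _ t _ => hγ.isoOn h h₁ s t⟩

lemma EC.ite (h : M.Axis α k A) (h₁ : M.Axis α₁ k A) {β γ : ℝ → Plane} {ε ε' : ℝ}
    (hβ : EC M α α₁ ε β) (hγ : EC M α α₁ ε' γ) {θ : ℝ} (hθ : β θ = γ θ) :
    EC M α α₁ (ε + ε') fun t => if t ≤ θ then β t else γ t := by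
  have b0 : ∀ ⦃δ γ⦄, EC M α α₁ δ γ → 0 ≤ δ := fun δ γ hγ => by
    have h1 := hγ.ec θ θ le_rfl
    have h2 := h.gap_le h₁ (γ θ) (γ θ)
    rw [dist_self] at h2
    linarith
  refine ⟨hβ.lip.ite hγ.lip hθ, fun s t hst => ?_⟩
  split_ifs with h1 h2 h2
  · have := hβ.ec s t hst
    have := b0 hγ
    linarith
  · have e1 := hβ.ec s θ h1
    have e2 := hγ.ec θ t (le_of_not_ge h2)
    have e3 := h.gap_le h₁ (β θ) (β θ)
    rw [dist_self] at e3
    rw [← hθ] at e2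
    linarith
  · exact absurd (hst.trans h2) h1
  · have := hγ.ec s t hst
    have := b0 hβ
    linarith

/-- Minimal curves through a common point coincide. -/
lemma EC.eq_of_eq (h : M.Axis α k A) (h₁ : M.Axis α₁ k A) {β γ : ℝ → Plane}
    (hβ : EC M α α₁ 0 β) (hγ : EC M α α₁ 0 γ) {θ : ℝ} (hθ : β θ = γ θ) : β = γ := by
  have key : ∀ ⦃β γ : ℝ → Plane⦄, EC M α α₁ 0 β → EC M α α₁ 0 γ → β θ = γ θ →
      ∀ t, θ ≤ t → β t = γ t := fun β γ hβ hγ hθ => by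
    set δ : ℝ → Plane := fun t => if t ≤ θ then β t else γ t with hδ
    have hE : EC M α α₁ 0 δ := by simpa using EC.ite h h₁ hβ hγ hθ
    have hl : δ =ᶠ[𝓝 (θ - 1)] β := by
      filter_upwards [Iio_mem_nhds (show θ - 1 < θ by linarith)] with t ht
      exact if_pos (le_of_lt ht)
    have hd := (hE.locIso h h₁).eq_of_eq_of_deriv_eq (hβ.locIso h h₁) hl.eq_of_nhds hl.deriv_eq
    intro t ht
    rcases ht.eq_or_lt with rfl | ht
    · exact hθ
    · rw [← hd, hδ]
      exact if_neg (not_le.2 ht)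
  have h2 : ∀ t, θ ≤ t → β t = γ t := key hβ hγ hθ
  have he : β =ᶠ[𝓝 (θ + 1)] γ := by
    filter_upwards [Ioi_mem_nhds (show θ < θ + 1 by linarith)] with t ht
    exact h2 t (le_of_lt ht)
  exact (hβ.locIso h h₁).eq_of_eq_of_deriv_eq (hγ.locIso h h₁) he.eq_of_nhds he.deriv_eq

/-- An almost shortest path from `α` to `α₁` extends to a curve of small excess. -/
lemma EC.of_path (h : M.Axis α k A) (h₁ : M.Axis α₁ k A) {ζ : ℝ → Plane} (hζ : M.Lip1 ζ)
    {s t d ε : ℝ} (hd : 0 ≤ d) (h0 : ζ 0 = α s) (hd1 : ζ d = α₁ t)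
    (hε : d - (t - s) ≤ M.gap α α₁ + ε) :
    EC M α α₁ ε fun p => if p ≤ d then (if p ≤ 0 then α (p + s) else ζ p) else α₁ (p + (t - d)) := by
  have l1 := (h.lip1.comp_add s).ite hζ (θ := 0) (by rw [zero_add, h0])
  have e1 : (if d ≤ 0 then α (d + s) else ζ d) = α₁ (d + (t - d)) := by
    rw [add_sub_cancel, ← hd1]
    split_ifs with hd'
    · rw [le_antisymm hd' hd, zero_add, h0]
    · rfl
  have l2 := l1.ite (h₁.lip1.comp_add (t - d)) (θ := d) e1
  refine EC.of_bounds l2 (a := s) (b := d - t) (by linarith) (fun p => ?_) fun q => ?_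
  · rcases le_total p 0 with hp | hp
    · simp only [hp, hp.trans hd, if_true, h.bar_self]; linarith
    · have := h.bar_le_of_lip l2 hp
      simp only [hd, le_refl, if_true, h.bar_self] at this
      linarith
  · rcases le_or_gt q d with hq | hq
    · have := h₁.bar_rev_le_of_lip l2 hq
      simp only [le_refl, if_true, e1, add_sub_cancel, h₁.bar_rev_right] at this
      linarith
    · simp only [hq.not_ge, if_false, h₁.bar_rev_right]; linarith

end Pair

end TorusMetric

namespace TorusMetric

attribute [local irreducible] TorusMetric.dist

variable {M : TorusMetric}

lemma LocIso.comp_add {γ : ℝ → Plane} (h : M.LocIso γ) (a : ℝ) : M.LocIso fun t => γ (t + a) :=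
  fun t => by
    obtain ⟨ε, hε, hi⟩ := h (t + a)
    refine ⟨ε, hε, fun s hs u hu => ?_⟩
    have := hi (s + a) ⟨by linarith [hs.1], by linarith [hs.2]⟩ (u + a)
      ⟨by linarith [hu.1], by linarith [hu.2]⟩
    rwa [add_sub_add_right_eq_sub] at this

lemma LocIso.comp_neg {γ : ℝ → Plane} (h : M.LocIso γ) : M.LocIso fun t => γ (-t) := fun t => by
  obtain ⟨ε, hε, hi⟩ := h (-t)
  refine ⟨ε, hε, fun s hs u hu => ?_⟩
  have := hi (-s) ⟨by linarith [hs.2], by linarith [hs.1]⟩ (-u)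
    ⟨by linarith [hu.2], by linarith [hu.1]⟩
  rwa [neg_sub_neg, abs_sub_comm] at this

lemma LocIso.hasDerivAt {γ : ℝ → Plane} (h : M.LocIso γ) (t : ℝ) : HasDerivAt γ (deriv γ t) t :=
  (h.contDiff_one.differentiable one_ne_zero t).hasDerivAt

lemma eq_or_eq_neg_of_crossDet {x v w : Plane} (hv : M.nrm x v = 1) (hw : M.nrm x w = 1)
    (h : crossDet v w = 0) : w = v ∨ w = -v := by
  have hv0 : v ≠ 0 := by
    rintro rfl
    rw [M.nrm_zero] at hv
    exact zero_ne_one hv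
  have hp := crossDet_rot_pos hv0
  set r := (v.1 * w.1 + v.2 * w.2) / (v.1 * v.1 + v.2 * v.2) with hr
  have hwr : w = r • v := by
    unfold crossDet at h
    refine Prod.ext ?_ ?_ <;> simp only [Prod.smul_fst, Prod.smul_snd, smul_eq_mul, hr] <;>
      rw [div_mul_eq_mul_div, eq_div_iff hp.ne']
    · linear_combination (-v.2) * h
    · linear_combination v.1 * h
  rw [hwr, M.nrm_smul, hv, mul_one] at hw
  rcases eq_or_eq_neg_of_abs_eq hw with h1 | h1
  · left; rw [hwr, h1, one_smul]
  · right; rw [hwr, h1, neg_smul, one_smul]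

/-- Tangent geodesics have the same trace. -/
lemma LocIso.range_eq {β γ : ℝ → Plane} (hβ : M.LocIso β) (hγ : M.LocIso γ) {s₀ t₀ : ℝ}
    (h0 : β s₀ = γ t₀) (h : crossDet (deriv β s₀) (deriv γ t₀) = 0) : range γ = range β := by
  have hu1 := hβ.nrm_deriv s₀
  have hu2 := hγ.nrm_deriv t₀
  rw [← h0] at hu2
  have hγd : HasDerivAt (fun t => γ (t + t₀)) (deriv γ t₀) 0 := by
    have := (hγ.hasDerivAt (0 + t₀)).comp_add_const 0 t₀
    simpa using this
  rcases eq_or_eq_neg_of_crossDet hu1 hu2 h with h1 | h1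
  · have hβd : HasDerivAt (fun t => β (t + s₀)) (deriv β s₀) 0 := by
      have := (hβ.hasDerivAt (0 + s₀)).comp_add_const 0 s₀
      simpa using this
    have key := (hβ.comp_add s₀).eq_of_eq_of_deriv_eq (hγ.comp_add t₀) (t₀ := 0)
      (by simpa using h0) (by rw [hβd.deriv, hγd.deriv, h1])
    refine Subset.antisymm ?_ ?_
    · rintro _ ⟨t, rfl⟩
      have := congrFun key (t - t₀)
      exact ⟨t - t₀ + s₀, by simpa using this⟩
    · rintro _ ⟨t, rfl⟩
      have := congrFun key (t - s₀)
      exact ⟨t - s₀ + t₀, by simpa using this.symm⟩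
  · have hβd : HasDerivAt (fun t => β (-t + s₀)) (-deriv β s₀) 0 := by
      have h2 : HasDerivAt (fun t : ℝ => -t + s₀) (-1) 0 := (hasDerivAt_neg 0).add_const s₀
      have h3 : HasDerivAt β (deriv β s₀) (-0 + s₀) := by simpa using hβ.hasDerivAt s₀
      have h4 := HasDerivAt.scomp (0 : ℝ) h3 h2
      rw [neg_one_smul] at h4
      exact h4
    have key := (hβ.comp_add s₀).comp_neg.eq_of_eq_of_deriv_eq (hγ.comp_add t₀) (t₀ := 0)
      (by simpa using h0) (by rw [hβd.deriv, hγd.deriv, h1])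
    refine Subset.antisymm ?_ ?_
    · rintro _ ⟨t, rfl⟩
      have := congrFun key (t - t₀)
      exact ⟨-(t - t₀) + s₀, by simpa using this⟩
    · rintro _ ⟨t, rfl⟩
      have := congrFun key (-(t - s₀))
      exact ⟨-(t - s₀) + t₀, by simpa using this.symm⟩

lemma ht_neg_left (k : ℤ × ℤ) (x : Plane) : ht (-k) x = -ht k x := by
  simp [ht]; ring

lemma Axis.mem_above_of_ge {α : ℝ → Plane} {k : ℤ × ℤ} {A : ℝ} (h : M.Axis α k A) {x : Plane}
    (hx : x ∉ range α) (hle : ∀ s, ht k (α s) ≤ ht k x) : x ∈ above k α := by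
  have hu : 0 < ht k (rot (lat k)) := by
    have := wd_lat_self_pos h.ne_zero
    simp only [ht, rot, lat, wd] at this ⊢
    linarith
  refine ⟨x + rot (lat k), fun s => ?_, ?_⟩
  · rw [ht_add]; have := hle s; linarith
  · refine JoinedIn.of_segment_subset ?_
    rw [segment_eq_image']
    rintro _ ⟨t, ht', rfl⟩ ⟨s, hs⟩
    rcases ht'.1.eq_or_lt with rfl | hp
    · exact hx ⟨s, by simpa using hs⟩
    · have h1 := hle s
      rw [hs, ht_add, add_sub_cancel_left, ht_smul] at h1
      have := mul_pos hp hu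
      linarith

lemma Axis.mem_below_of_le {α : ℝ → Plane} {k : ℤ × ℤ} {A : ℝ} (h : M.Axis α k A) {x : Plane}
    (hx : x ∉ range α) (hle : ∀ s, ht k x ≤ ht k (α s)) : x ∈ below k α := by
  have hu : 0 < ht k (rot (lat k)) := by
    have := wd_lat_self_pos h.ne_zero
    simp only [ht, rot, lat, wd] at this ⊢
    linarith
  have hneg : ht k (-rot (lat k)) = -ht k (rot (lat k)) := by
    have := ht_smul k (-1) (rot (lat k))
    simpa using this
  refine ⟨x + -rot (lat k), fun s => ?_, ?_⟩
  · rw [ht_add, hneg]; have := hle s; linarith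
  · refine JoinedIn.of_segment_subset ?_
    rw [segment_eq_image']
    rintro _ ⟨t, ht', rfl⟩ ⟨s, hs⟩
    rcases ht'.1.eq_or_lt with rfl | hp
    · exact hx ⟨s, by simpa using hs⟩
    · have h1 := hle s
      rw [hs, ht_add, add_sub_cancel_left, ht_smul, hneg] at h1
      have := mul_pos hp hu
      linarith

/-- Disjoint translates are translated across. -/
lemma Axis.ht_ne_zero {α : ℝ → Plane} {k : ℤ × ℤ} {A : ℝ} (h : M.Axis α k A) {τ : ℤ × ℤ}
    (hdisj : ∀ s, α s + lat τ ∉ range α) : ht k (lat τ) ≠ 0 := fun h0 => by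
  obtain ⟨s₁, hs₁⟩ := h.exists_highest
  obtain ⟨s₂, hs₂⟩ := h.exists_lowest
  have h1 := h.mem_above_of_ge (hdisj s₁) fun s => by rw [ht_add, h0, add_zero]; exact hs₁ s
  have h2 := h.mem_below_of_le (hdisj s₂) fun s => by rw [ht_add, h0, add_zero]; exact hs₂ s
  obtain ⟨u, -, hu⟩ := h.exists_mem_of_below_above (h.add_lat τ).continuous h2 h1
  exact hdisj u hu

lemma Axis.translate_mem_above {α : ℝ → Plane} {k : ℤ × ℤ} {A : ℝ} (h : M.Axis α k A) {τ : ℤ × ℤ}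
    (hdisj : ∀ s, α s + lat τ ∉ range α) (hpos : 0 < ht k (lat τ)) (s : ℝ) :
    α s + lat τ ∈ above k α := by
  obtain ⟨s₁, hs₁⟩ := h.exists_highest
  have h1 : α s₁ + lat τ ∈ above k α := mem_above_of_lt fun s => by
    rw [ht_add]; have := hs₁ s; linarith
  exact mem_above_of_avoids (γ := fun s => α s + lat τ) ordConnected_univ
    (h.add_lat τ).continuous.continuousOn (fun t _ => hdisj t) (mem_univ s₁) (mem_univ s) h1

lemma exists_axis {α : ℝ → Plane} {k τ : ℤ × ℤ} (hα : IsAxisOf M α k) (hmin : IsMinimal M α)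
    (hdisj : ∀ s, α s + lat τ ∉ range α) :
    ∃ β k A, M.Axis β k A ∧ range β = range α ∧ 0 < ht k (lat τ) := by
  obtain ⟨hg, hk, ℓ, hℓ⟩ := hα
  have hiso : ∀ s t, M.dist (α s) (α t) = |s - t| := fun s t => by
    wlog hst : s ≤ t generalizing s t
    · rw [dist_comm, abs_sub_comm]
      exact this t s (le_of_not_ge hst)
    rw [hmin s t hst, hg.length_eq, abs_sub_comm, abs_of_nonneg (by linarith)]
  have hℓ0 : ℓ ≠ 0 := by
    rintro rfl
    have := hℓ 0
    rw [add_zero, left_eq_add] at this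
    exact hk (lat_injective (by rw [this, lat_zero]))
  have h1 : ∃ k A, M.Axis α k A := by
    rcases hℓ0.lt_or_gt with h | h
    · refine ⟨-k, -ℓ, hiso, by linarith, fun s => ?_⟩
      have := hℓ (s + -ℓ)
      rw [neg_add_cancel_right] at this
      rw [this, lat_neg, add_neg_cancel_right]
    · exact ⟨k, ℓ, hiso, h, hℓ⟩
  obtain ⟨k, A, hA⟩ := h1
  rcases (hA.ht_ne_zero hdisj).lt_or_gt with h | h
  · refine ⟨rev α, -k, A, hA.rev, ?_, by rw [ht_neg_left]; linarith⟩
    exact (Equiv.neg ℝ).surjective.range_comp α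
  · exact ⟨α, k, A, hA, rfl, h⟩

/-- A geodesic arc `c[a,b]` above the minimal axis `α`, with end points on `α` and leaving the
upper side there, lying below the translate of `α` by `σ`. -/
structure Setup (M : TorusMetric) (α c : ℝ → Plane) (k σ : ℤ × ℤ) (A a b η : ℝ) : Prop where
  ax : M.Axis α k A
  cl : M.LocIso c
  lip : M.Lip1 c
  hab : a < b
  ha : c a ∈ range α
  hb : c b ∈ range α
  up : ∀ t ∈ Ioo a b, c t ∈ above k α
  hη : 0 < η
  dl : ∀ t ∈ Ioo (a - η) a, c t ∈ below k α
  dr : ∀ t ∈ Ioo b (b + η), c t ∈ below k α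
  high : ∀ s t, ht k (α t) < ht k (α s + lat σ)
  highc : ∀ s, ∀ t ∈ Icc a b, ht k (c t) < ht k (α s + lat σ)

theorem exists_setup {c α : ℝ → Plane} {k τ : ℤ × ℤ} (hc : M.IsGeodesic c) (hα : IsAxisOf M α k)
    (hmin : IsMinimal M α) {a b : ℝ} (ha : c a ∈ range α) (hb : c b ∈ range α)
    (hdisj : ∀ s, α s + lat τ ∉ range α) {s : ℝ} (hs : s ∈ Icc a b)
    (hcs : c s ∈ range (transl τ α)) :
    ∃ α k σ A a b η, Setup M α c k σ A a b η := by
  obtain ⟨β, k, A, h, hr, hp⟩ := exists_axis hα hmin hdisj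
  have hdisj' : ∀ s, β s + lat τ ∉ range β := fun s => by
    obtain ⟨t, ht⟩ : β s ∈ range α := hr ▸ mem_range_self s
    rw [hr, ← ht]
    exact hdisj t
  have hcs' : c s ∈ above k β := by
    obtain ⟨t, ht⟩ := hcs
    obtain ⟨u, hu⟩ : α t ∈ range β := hr ▸ mem_range_self t
    rw [← ht, transl, ← hu]
    exact h.translate_mem_above hdisj' hp u
  rw [← hr] at ha hb
  have hcl := hc.locIso
  have hcc := hcl.continuous
  have hclosed : IsClosed (c ⁻¹' range β) := h.isClosed_range.preimage hcc
  obtain ⟨a', ⟨ha1, ha2⟩, ha3⟩ := (isCompact_Icc.inter_right hclosed).exists_isGreatest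
    ⟨a, left_mem_Icc.2 hs.1, ha⟩
  obtain ⟨b', ⟨hb1, hb2⟩, hb3⟩ := (isCompact_Icc.inter_right hclosed).exists_isLeast
    ⟨b, right_mem_Icc.2 hs.2, hb⟩
  have hns := not_mem_of_mem_above hcs'
  have has : a' < s := lt_of_le_of_ne ha1.2 (by rintro rfl; exact hns ha2)
  have hsb : s < b' := lt_of_le_of_ne hb1.1 (by rintro rfl; exact hns hb2)
  have hup : ∀ t ∈ Ioo a' b', c t ∈ above k β := fun t ht => by
    refine mem_above_of_avoids ordConnected_Ioo hcc.continuousOn (fun u hu hur => ?_) ⟨has, hsb⟩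
      ht hcs'
    rcases le_total u s with hus | hus
    · exact absurd (ha3 ⟨⟨ha1.1.trans hu.1.le, hus⟩, hur⟩) (not_le.2 hu.1)
    · exact absurd (hb3 ⟨⟨hus, hu.2.le.trans hb1.2⟩, hur⟩) (not_le.2 hu.2)
  have htr : ∀ t s₀, β s₀ = c t → crossDet (deriv β s₀) (deriv c t) ≠ 0 := fun t s₀ h0 hcr => by
    have := h.locIso.range_eq hcl h0 hcr
    exact hns (this ▸ mem_range_self s)
  obtain ⟨sa, hsa⟩ := ha2
  obtain ⟨sb, hsb'⟩ := hb2
  have hla : ∀ᶠ t in 𝓝[<] a', c t ∈ below k β := by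
    have hr : ∀ᶠ t in 𝓝[>] a', c t ∈ above k β := by
      filter_upwards [Ioo_mem_nhdsGT (has.trans hsb)] with t ht using hup t ht
    rcases h.changes_side (hcl.hasDerivAt a') hsa.symm (htr _ _ hsa) with h1 | h1
    · exact h1.2
    · obtain ⟨t, ht1, ht2⟩ := (hr.and h1.1).exists
      exact (h.disjoint_above_below ht1 ht2).elim
  have hrb : ∀ᶠ t in 𝓝[>] b', c t ∈ below k β := by
    have hr : ∀ᶠ t in 𝓝[<] b', c t ∈ above k β := by
      filter_upwards [Ioo_mem_nhdsLT (has.trans hsb)] with t ht using hup t ht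
    rcases h.changes_side (hcl.hasDerivAt b') hsb'.symm (htr _ _ hsb') with h1 | h1
    · obtain ⟨t, ht1, ht2⟩ := (hr.and h1.2).exists
      exact (h.disjoint_above_below ht1 ht2).elim
    · exact h1.1
  obtain ⟨l, hl, hl'⟩ := mem_nhdsLT_iff_exists_Ioo_subset.1 hla
  obtain ⟨u, hu, hu'⟩ := mem_nhdsGT_iff_exists_Ioo_subset.1 hrb
  obtain ⟨s₁, hs₁⟩ := h.exists_highest
  obtain ⟨s₂, hs₂⟩ := h.exists_lowest
  obtain ⟨t₁, -, ht₁⟩ := isCompact_Icc.exists_isMaxOn (nonempty_Icc.2 (has.trans hsb).le)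
    (((continuous_ht k).comp hcc).continuousOn)
  obtain ⟨n, hn⟩ := exists_nat_gt
    ((max (ht k (β s₁)) (ht k (c t₁)) - ht k (β s₂)) / ht k (lat τ))
  rw [div_lt_iff₀ hp, sub_lt_iff_lt_add'] at hn
  have hn' : ∀ s, ht k (β s₂) + n * ht k (lat τ) ≤ ht k (β s + lat ((n : ℤ) • τ)) := fun s => by
    rw [ht_add, lat_zsmul, ht_smul, Int.cast_natCast]
    have := hs₂ s
    linarith
  simp only [mem_Iio, mem_Ioi] at hl hu
  refine ⟨β, k, (n : ℤ) • τ, A, a', b', min (a' - l) (u - b'), h, hcl, hc.lip1, has.trans hsb,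
    ⟨sa, hsa⟩, ⟨sb, hsb'⟩, hup, lt_min (by linarith) (by linarith), fun t ht => ?_, fun t ht => ?_,
    fun s t => ?_, fun s t ht => ?_⟩
  · have := min_le_left (a' - l) (u - b')
    exact hl' ⟨by linarith [ht.1], ht.2⟩
  · have := min_le_right (a' - l) (u - b')
    exact hu' ⟨ht.1, by linarith [ht.2]⟩
  · exact ((hs₁ t).trans (le_max_left _ _)).trans_lt (hn.trans_le (hn' s))
  · exact (((ht₁ ht : _ ≤ _)).trans (le_max_right _ _)).trans_lt (hn.trans_le (hn' s))

end TorusMetric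

namespace TorusMetric

attribute [local irreducible] TorusMetric.dist

variable {M : TorusMetric}

lemma exists_tendsto_of_isCompact {X : Type*} [TopologicalSpace X] {K : Set X} (hK : IsCompact K)
    {x : ℕ → X} (h : ∀ᶠ n in hyperfilter ℕ, x n ∈ K) :
    ∃ y ∈ K, Tendsto x (hyperfilter ℕ) (𝓝 y) := by
  obtain ⟨y, hy, hle⟩ := hK.ultrafilter_le_nhds' ((hyperfilter ℕ).map x) h
  exact ⟨y, hy, hle⟩

lemma tendsto_apply {l : Filter ℕ} {γ : ℕ → ℝ → Plane} {L : ℝ → Plane} (hγ : ∀ n, M.Lip1 (γ n))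
    (hL : ∀ t, Tendsto (fun n => γ n t) l (𝓝 (L t))) {v : ℕ → ℝ} {t : ℝ}
    (hv : Tendsto v l (𝓝 t)) : Tendsto (fun n => γ n (v n)) l (𝓝 (L t)) := by
  have h1 : Tendsto (fun n => γ n (v n) - γ n t) l (𝓝 0) := by
    refine squeeze_zero_norm (a := fun n => |v n - t| / M.lo) (fun n => (hγ n).norm_le _ _) ?_
    have : Tendsto (fun n => |v n - t| / M.lo) l (𝓝 (|t - t| / M.lo)) :=
      ((hv.sub_const t).abs).div_const _
    simpa using this
  simpa using h1.add (hL t)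

/-- Transversal intersections are stable under pointwise limits of 1-Lipschitz curves. -/
theorem stab {l : Filter ℕ} {γ : ℕ → ℝ → Plane} {L c : ℝ → Plane} (hγ : ∀ n, M.Lip1 (γ n))
    (hc : M.LocIso c) (hL : M.LocIso L) (hlim : ∀ t, Tendsto (fun n => γ n t) l (𝓝 (L t)))
    {u₀ t₀ : ℝ} (h0 : L u₀ = c t₀) (htr : crossDet (deriv c t₀) (deriv L u₀) ≠ 0)
    {ε : ℝ} (hε : 0 < ε) :
    ∀ᶠ n in l, ∃ u t, |t - t₀| < ε ∧ γ n u = c t := by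
  obtain ⟨e, he0, he, hcr⟩ := exists_chart hc.contDiff (hc.deriv_ne_zero t₀)
  obtain ⟨y, hy, hf⟩ := hcr L u₀ _ (hL.hasDerivAt u₀) h0 htr
  have he1 : e (t₀, 0) = L u₀ := by rw [he, nb_zero, h0]
  have htgt : L u₀ ∈ e.target := he1 ▸ e.map_source he0
  have hsymm : Tendsto e.symm (𝓝 (L u₀)) (𝓝 (t₀, 0)) := by
    have := (e.continuousAt_symm htgt).tendsto
    rwa [← he1, e.left_inv he0, he1] at this
  have hf0 : (e.symm (L u₀)).2 = 0 := by rw [← he1, e.left_inv he0]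
  obtain ⟨r, hr, hball⟩ := Metric.eventually_nhds_iff_ball.1
    (Filter.Eventually.and (e.open_target.mem_nhds htgt : ∀ᶠ x in 𝓝 (L u₀), x ∈ e.target)
      (hsymm.eventually (Metric.ball_mem_nhds (t₀, (0 : ℝ)) hε)))
  obtain ⟨σ, hσ⟩ : ∃ σ : ℝ, 0 < σ * y := ⟨y, mul_self_pos.2 hy⟩
  obtain ⟨c1, c2⟩ := sign_change hf hf0 hσ
  have hlo := M.lo_pos
  have hw : 0 < M.lo * (r / 4) := by positivity
  obtain ⟨p, hp1, hp2⟩ := (c1.and (Ioo_mem_nhdsGT (show u₀ < u₀ + M.lo * (r / 4) by linarith))).exists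
  obtain ⟨q, hq1, hq2⟩ := (c2.and (Ioo_mem_nhdsLT (show u₀ - M.lo * (r / 4) < u₀ by linarith))).exists
  have hqp : q ≤ p := (hq2.2.trans hp2.1).le
  have hnear : ∀ (β : ℝ → Plane), M.Lip1 β → ‖β u₀ - L u₀‖ < r / 2 → ∀ u ∈ Icc q p,
      β u ∈ Metric.ball (L u₀) r := fun β hβ hβ0 u hu => by
    rw [mem_ball_iff_norm]
    have h1 := hβ.norm_le u u₀
    have h2 : |u - u₀| / M.lo ≤ r / 4 := by
      rw [div_le_iff₀ hlo, abs_le]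
      constructor <;> linarith [hu.1, hu.2, hq2.1, hp2.2]
    calc ‖β u - L u₀‖ ≤ ‖β u - β u₀‖ + ‖β u₀ - L u₀‖ := norm_sub_le_norm_sub_add_norm_sub ..
      _ < r := by linarith
  by_cases hl : l = ⊥
  · simp [hl]
  have : l.NeBot := ⟨hl⟩
  have hLball : ∀ u ∈ Icc q p, ‖L u - L u₀‖ ≤ r / 4 := fun u hu => by
    refine le_of_tendsto ((hlim u).sub (hlim u₀)).norm (Eventually.of_forall fun n => ?_)
    refine ((hγ n).norm_le _ _).trans ?_
    rw [div_le_iff₀ hlo, abs_le]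
    constructor <;> linarith [hu.1, hu.2, hq2.1, hp2.2]
  have hcont : ∀ u ∈ Icc q p, Tendsto (fun n => (e.symm (γ n u)).2) l (𝓝 (e.symm (L u)).2) :=
    fun u hu => by
      have hm : L u ∈ e.target := (hball _ (by
        rw [mem_ball_iff_norm]; linarith [hLball u hu])).1
      exact ((continuous_snd.tendsto _).comp (e.continuousAt_symm hm).tendsto).comp (hlim u)
  have evp : ∀ᶠ n in l, 0 < σ * (e.symm (γ n p)).2 :=
    ((hcont p (right_mem_Icc.2 hqp)).const_mul σ).eventually (lt_mem_nhds hp1)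
  have evq : ∀ᶠ n in l, 0 < -σ * (e.symm (γ n q)).2 :=
    ((hcont q (left_mem_Icc.2 hqp)).const_mul (-σ)).eventually (lt_mem_nhds hq1)
  have ev0 : ∀ᶠ n in l, ‖γ n u₀ - L u₀‖ < r / 2 := by
    have := (hlim u₀).eventually (Metric.ball_mem_nhds _ (half_pos hr))
    simpa only [Metric.mem_ball, _root_.dist_eq_norm] using this
  filter_upwards [evp, evq, ev0] with n np nq n0
  have hb := hnear _ (hγ n) n0
  have hco : ContinuousOn (fun u => σ * (e.symm (γ n u)).2) (Icc q p) := by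
    refine continuousOn_const.mul (continuous_snd.comp_continuousOn
      (e.continuousOn_symm.comp (hγ n).continuous.continuousOn fun u hu => (hball _ (hb u hu)).1))
  obtain ⟨u, hu, hu0⟩ := intermediate_value_Icc hqp hco
    (show (0 : ℝ) ∈ Icc _ _ from ⟨by linarith, np.le⟩)
  have hσ0 : σ ≠ 0 := by rintro rfl; simp at hσ
  have hz2 := (mul_eq_zero.1 hu0).resolve_left hσ0
  obtain ⟨h1, h2⟩ := hball _ (hb u hu)
  refine ⟨u, (e.symm (γ n u)).1, ?_, ?_⟩
  · rw [Prod.dist_eq] at h2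
    exact (le_max_left _ _).trans_lt h2
  · rw [← nb_zero c, ← hz2, ← he, e.right_inv h1]

namespace Setup

variable {α c : ℝ → Plane} {k σ : ℤ × ℤ} {A a b η : ℝ}

lemma ax₁ (S : Setup M α c k σ A a b η) : M.Axis (transl σ α) k A := S.ax.add_lat σ

lemma eq_shift (S : Setup M α c k σ A a b η) {L : ℝ → Plane} (hL : EC M α (transl σ α) 0 L) {u : ℝ}
    (hu : L u ∈ range α) : ∃ s, ∀ t, L t = α (t + s) := by
  obtain ⟨s, hs⟩ := hu
  have h1 := (EC.left S.ax S.ax₁).comp_add (s - u)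
  have := EC.eq_of_eq S.ax S.ax₁ hL h1 (θ := u) (by simp [hs])
  exact ⟨s - u, fun t => by rw [this]⟩

lemma eq_shift₁ (S : Setup M α c k σ A a b η) {L : ℝ → Plane} (hL : EC M α (transl σ α) 0 L) {u : ℝ}
    (hu : L u ∈ range (transl σ α)) : ∃ s, ∀ t, L t = transl σ α (t + s) := by
  obtain ⟨s, hs⟩ := hu
  have h1 := (EC.right S.ax S.ax₁).comp_add (s - u)
  have := EC.eq_of_eq S.ax S.ax₁ hL h1 (θ := u) (by simp [hs])
  exact ⟨s - u, fun t => by rw [this]⟩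

lemma crossDet_ne_zero (S : Setup M α c k σ A a b η) {L : ℝ → Plane}
    (hL : EC M α (transl σ α) 0 L) {u t : ℝ} (h : L u = c t) :
    crossDet (deriv c t) (deriv L u) ≠ 0 := fun h0 => by
  have hr := S.cl.range_eq (hL.locIso S.ax S.ax₁) h.symm h0
  obtain ⟨u', hu'⟩ : c a ∈ range L := hr ▸ mem_range_self a
  obtain ⟨s, hs⟩ := S.eq_shift hL (hu'.symm ▸ S.ha)
  have hab := S.hab
  obtain ⟨w, hw⟩ : c ((a + b) / 2) ∈ range L := hr ▸ mem_range_self _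
  refine not_mem_of_mem_above (S.up ((a + b) / 2) ⟨by linarith, by linarith⟩) ?_
  rw [← hw, hs]
  exact mem_range_self _

/-- Limits of almost minimal curves on the upper side of `α` avoiding the arc avoid the arc. -/
lemma avoids_of_tendsto (S : Setup M α c k σ A a b η) {l : Filter ℕ} [l.NeBot]
    {γ : ℕ → ℝ → Plane} {L : ℝ → Plane} (hγ : ∀ n, M.Lip1 (γ n)) (hL : EC M α (transl σ α) 0 L)
    (hlim : ∀ t, Tendsto (fun n => γ n t) l (𝓝 (L t)))
    (hup : ∀ n t, γ n t ∈ range α ∪ above k α) (hav : ∀ n u, ∀ t ∈ Icc a b, γ n u ≠ c t)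
    (u : ℝ) (t : ℝ) (ht : t ∈ Icc a b) : L u ≠ c t := fun h => by
  obtain ⟨n, v, s, hs, hv⟩ := (stab hγ S.cl (hL.locIso S.ax S.ax₁) hlim h
    (S.crossDet_ne_zero hL h) S.hη).exists
  rw [abs_lt] at hs
  have hbel : c s ∉ below k α := fun hb => by
    rcases hup n v with h1 | h1 <;> rw [hv] at h1
    · exact not_mem_of_mem_below hb h1
    · exact S.ax.disjoint_above_below h1 hb
  rcases lt_or_ge s a with h1 | h1
  · exact hbel (S.dl s ⟨by linarith [ht.1], h1⟩)
  rcases lt_or_ge b s with h2 | h2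
  · exact hbel (S.dr s ⟨h2, by linarith [ht.2]⟩)
  exact hav n v s ⟨h1, h2⟩ hv

/-- The minimal curves meeting the arc for the last time. -/
structure Last (M : TorusMetric) (α c : ℝ → Plane) (k σ : ℤ × ℤ) (a b : ℝ) (L : ℝ → Plane) : Prop where
  ec : EC M α (transl σ α) 0 L
  mem : L 0 ∈ c '' Icc a b
  av : ∀ u, ∀ t ∈ Icc a b, L u ≠ c t + lat k

lemma last_of_tendsto (S : Setup M α c k σ A a b η) {ε : ℕ → ℝ} {γ : ℕ → ℝ → Plane}
    (hγ : ∀ n, EC M α (transl σ α) (ε n) (γ n)) (hε : Tendsto ε atTop (𝓝 0))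
    (hup : ∀ n t, γ n t ∈ range α ∪ above k α) (h0 : ∀ n, γ n 0 ∈ c '' Icc a b)
    (hav : ∀ n u, ∀ t ∈ Icc a b, γ n u ≠ c t + lat k) :
    ∃ L, Last M α c k σ a b L ∧ ∀ t, Tendsto (fun n => γ n t) (hyperfilter ℕ) (𝓝 (L t)) := by
  have hcc : IsCompact (c '' Icc a b) := isCompact_Icc.image S.cl.continuous
  obtain ⟨B, hB⟩ := hcc.isBounded.exists_norm_le
  obtain ⟨L, hL, hlim⟩ := EC.exists_limit S.ax S.ax₁ hγ hε fun n => hB _ (h0 n)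
  refine ⟨L, ⟨hL, hcc.isClosed.mem_of_tendsto (hlim 0) (Eventually.of_forall h0), ?_⟩, hlim⟩
  intro u t ht h
  refine S.avoids_of_tendsto (γ := fun n u => γ n u + ((-1 : ℤ) : ℝ) • lat k)
    (fun n => ((hγ n).add_lat S.ax S.ax₁ (-1)).lip) (hL.add_lat S.ax S.ax₁ (-1))
    (fun t => (hlim t).add_const _) (fun n t => ?_) (fun n u t ht h => ?_) u t ht ?_
  · exact (hup n t).imp (S.ax.range_add_lat (-1)).2 fun h => S.ax.add_mem_above h (-1)
  · refine hav n u t ht ?_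
    rw [← h]; simp
  · rw [h]; simp

lemma Last.not_mem_range (S : Setup M α c k σ A a b η) {L : ℝ → Plane}
    (hL : Last M α c k σ a b L) (u : ℝ) : L u ∉ range α := fun h => by
  obtain ⟨s, hs⟩ := S.eq_shift hL.ec h
  obtain ⟨r, hr⟩ := S.ha
  refine hL.av (r + A - s) a (left_mem_Icc.2 S.hab.le) ?_
  rw [hs, sub_add_cancel, S.ax.per, hr]

lemma Last.exists_mem_Ioo (S : Setup M α c k σ A a b η) {L : ℝ → Plane}
    (hL : Last M α c k σ a b L) : ∃ t ∈ Ioo a b, L 0 = c t := by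
  obtain ⟨t, ht, h0⟩ := hL.mem
  refine ⟨t, ⟨lt_of_le_of_ne ht.1 ?_, lt_of_le_of_ne ht.2 ?_⟩, h0.symm⟩
  · rintro rfl; exact hL.not_mem_range S 0 (h0 ▸ S.ha)
  · rintro rfl; exact hL.not_mem_range S 0 (h0 ▸ S.hb)

lemma Last.mem_above (S : Setup M α c k σ A a b η) {L : ℝ → Plane}
    (hL : Last M α c k σ a b L) (u : ℝ) : L u ∈ above k α := by
  obtain ⟨t, ht, h0⟩ := hL.exists_mem_Ioo S
  exact mem_above_of_avoids ordConnected_univ hL.ec.lip.continuous.continuousOn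
    (fun u _ => hL.not_mem_range S u) (mem_univ 0) (mem_univ u) (h0 ▸ S.up t ht)

lemma mem_above₁ (S : Setup M α c k σ A a b η) (s : ℝ) : transl σ α s ∈ above k α :=
  mem_above_of_lt fun t => S.high s t

/-- A curve of small excess on the upper side of `α`. -/
lemma exists_path (S : Setup M α c k σ A a b η) {ε : ℝ} (hε : 0 < ε) :
    ∃ γ d s t, EC M α (transl σ α) ε γ ∧ (∀ u, γ u ∈ range α ∪ above k α) ∧
      (∀ u ≤ 0, γ u = α (u + s)) ∧ (∀ u ≥ d, γ u = transl σ α (u + t)) := by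
  have h := S.ax
  have h₁ := S.ax₁
  obtain ⟨r, hr⟩ := exists_lt_of_ciInf_lt
    (show M.gap α (transl σ α) < M.gap α (transl σ α) + ε by linarith)
  set t := -r with ht
  have hD : M.dist (α 0) (transl σ α t) - t < M.gap α (transl σ α) + ε := by
    rw [dist_comm, ht, sub_neg_eq_add]; exact hr
  obtain ⟨ζ, hζ, hζ0, hζ1⟩ := M.exists_minimizer (α 0) (transl σ α t)
  set D := M.dist (α 0) (transl σ α t) with hDdef
  have hD0 : 0 ≤ D := dist_nonneg _ _
  have hclosed : IsClosed (ζ ⁻¹' range α) := h.isClosed_range.preimage hζ.continuous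
  obtain ⟨v, ⟨hv1, hv2⟩, hv3⟩ := (isCompact_Icc.inter_right hclosed).exists_isGreatest
    ⟨0, left_mem_Icc.2 hD0, by rw [mem_preimage, hζ0]; exact mem_range_self 0⟩
  obtain ⟨s, hs⟩ := hv2
  have hsv : s ≤ v := by
    have h1 := hζ 0 v
    rw [hζ0, ← hs, h.iso, zero_sub, zero_sub, abs_neg, abs_neg, abs_of_nonneg hv1.1] at h1
    exact (le_abs_self s).trans h1
  have hEC := EC.of_path h h₁ (hζ.comp_add v) (s := s) (t := t) (d := D - v) (ε := ε)
    (by linarith [hv1.2]) (by rw [zero_add, hs]) (by rw [sub_add_cancel, hζ1]) (by linarith)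
  have hnot : ∀ u ∈ Ioc v D, ζ u ∉ range α := fun u hu hur =>
    absurd (hv3 ⟨⟨hv1.1.trans hu.1.le, hu.2⟩, hur⟩) (not_le.2 hu.1)
  have habove : ∀ u ∈ Ioc v D, ζ u ∈ above k α := fun u hu =>
    mem_above_of_avoids ordConnected_Ioc hζ.continuous.continuousOn hnot
      ⟨hu.1.trans_le hu.2, le_rfl⟩ hu (by rw [hζ1]; exact S.mem_above₁ t)
  refine ⟨_, D - v, s, t - (D - v), hEC, fun u => ?_, fun u hu => ?_, fun u hu => ?_⟩
  · split_ifs with h1 h2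
    · exact Or.inl (mem_range_self _)
    · exact Or.inr (habove _ ⟨by linarith, by linarith⟩)
    · exact Or.inr (S.mem_above₁ _)
  · have : u ≤ D - v := by linarith [hv1.2]
    simp only [this, hu, if_true]
  · rcases hu.lt_or_eq with h1 | h1
    · simp only [h1.not_ge, if_false]
    · rw [← h1, if_pos le_rfl, add_sub_cancel]
      split_ifs with h2
      · rw [← hζ1, show D = v by linarith [hv1.2], ← hs, sub_self, zero_add]
      · rw [sub_add_cancel, hζ1]

/-- After a translation a curve of small excess meets the arc for the last time. -/
lemma exists_last_path (S : Setup M α c k σ A a b η) {ε : ℝ} (hε : 0 < ε) :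
    ∃ γ, EC M α (transl σ α) ε γ ∧ (∀ u, γ u ∈ range α ∪ above k α) ∧ γ 0 ∈ c '' Icc a b ∧
      ∀ u, ∀ t ∈ Icc a b, γ u ≠ c t + lat k := by
  have h := S.ax
  obtain ⟨γ, d, s, t, hγ, hup, hl, hr⟩ := S.exists_path hε
  obtain ⟨m, -, hm⟩ := isCompact_Icc.exists_isMinOn (nonempty_Icc.2 S.hab.le)
    ((h.continuous_bar.comp S.cl.continuous).continuousOn)
  obtain ⟨r, hra⟩ := S.ha
  obtain ⟨j, ⟨u, w, hw, hj⟩, hmax⟩ := Int.exists_greatest_of_bdd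
    (P := fun j => ∃ u, ∃ w ∈ Icc a b, γ u = c w + (j : ℝ) • lat k) (by
      obtain ⟨B, hB⟩ := exists_int_gt ((M.gap α (transl σ α) + ε + (d + t) - M.bar α (c m)) / A)
      refine ⟨B, fun j ⟨u, w, hw, hj⟩ => ?_⟩
      have hud : u ≤ d := by
        by_contra! hcon
        have h1 := S.highc (u + t) w hw
        have h2 := hr u hcon.le
        rw [transl] at h2
        rw [← h2, hj, ht_add, ht_smul, ht_lat_self, mul_zero, add_zero] at h1
        exact lt_irrefl _ h1
      have h1 := hγ.ec u d hud
      rw [hr d le_rfl, S.ax₁.bar_rev_right, hj, h.bar_add_lat] at h1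
      have h2 : M.bar α (c m) ≤ M.bar α (c w) := hm hw
      have h3 : (j : ℝ) < B := by
        refine lt_of_le_of_lt ?_ hB
        rw [le_div_iff₀ h.pos]
        linarith
      exact_mod_cast h3.le) (by
      obtain ⟨N, hN⟩ := exists_int_lt ((s - r) / A)
      refine ⟨N, r + N * A - s, a, left_mem_Icc.2 S.hab.le, ?_⟩
      rw [lt_div_iff₀ h.pos] at hN
      rw [hl _ (by linarith), sub_add_cancel, h.per_int, hra])
  refine ⟨fun v => γ (v + u) + ((-j : ℤ) : ℝ) • lat k, (hγ.comp_add u).add_lat h S.ax₁ (-j),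
    fun v => ?_, ⟨w, hw, ?_⟩, fun v w' hw' hv => ?_⟩
  · exact (hup _).imp (h.range_add_lat (-j)).2 fun h1 => h.add_mem_above h1 (-j)
  · simp [hj]
  · have := hmax (j + 1) ⟨v + u, w', hw', ?_⟩
    · omega
    · push_cast at hv ⊢
      rw [neg_smul, add_neg_eq_iff_eq_add] at hv
      rw [hv, add_smul, one_smul]
      abel

/-- The set of last intersection points with the arc. -/
def Q (M : TorusMetric) (α c : ℝ → Plane) (k σ : ℤ × ℤ) (a b : ℝ) : Set Plane :=
  {x | ∃ L, Last M α c k σ a b L ∧ L 0 = x}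

lemma nonempty_Q (S : Setup M α c k σ A a b η) : (Q M α c k σ a b).Nonempty := by
  choose γ h1 h2 h3 h4 using fun n : ℕ => S.exists_last_path (ε := 1 / ((n : ℝ) + 1)) (by positivity)
  obtain ⟨L, hL, -⟩ := S.last_of_tendsto h1 tendsto_one_div_add_atTop_nhds_zero_nat h2 h3 h4
  exact ⟨L 0, L, hL, rfl⟩

lemma isCompact_Q (S : Setup M α c k σ A a b η) : IsCompact (Q M α c k σ a b) := by
  have hcc : IsCompact (c '' Icc a b) := isCompact_Icc.image S.cl.continuous
  refine hcc.of_isClosed_subset (isClosed_of_closure_subset fun x hx => ?_) ?_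
  · obtain ⟨y, hy, hlim⟩ := mem_closure_iff_seq_limit.1 hx
    choose L hL hL0 using hy
    obtain ⟨L', hL', hlim'⟩ := S.last_of_tendsto (fun n => (hL n).ec) tendsto_const_nhds
      (fun n t => Or.inr ((hL n).mem_above S t)) (fun n => (hL n).mem) fun n => (hL n).av
    refine ⟨L', hL', ?_⟩
    have := hlim' 0
    simp only [hL0] at this
    exact tendsto_nhds_unique this (hlim.mono_left Nat.hyperfilter_le_atTop)
  · rintro _ ⟨L, hL, rfl⟩
    exact hL.mem

end Setup

end TorusMetric

namespace TorusMetric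

attribute [local irreducible] TorusMetric.dist

variable {M : TorusMetric}

/-- A compact set between an axis and a translate of it which almost minimal curves cannot avoid
once they start in it, and cannot join to its neighbouring translates. -/
structure Gate (M : TorusMetric) (α : ℝ → Plane) (k σ : ℤ × ℤ) (A : ℝ) (G : Set Plane) : Prop where
  ax : M.Axis α k A
  compact : IsCompact G
  above : G ⊆ above k α
  below : G ⊆ below k (transl σ α)
  exists_le : ∃ z ∈ G, M.bar α z + M.bar (rev (transl σ α)) z ≤ M.gap α (transl σ α)
  int : ∃ ε > 0, ∀ γ, EC M α (transl σ α) ε γ → γ 0 ∈ G → ∃ t, γ t ∈ interior G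
  sep : ∀ R, ∃ ε > 0, ∀ γ, EC M α (transl σ α) ε γ → γ 0 ∈ G → ∀ t, |t| ≤ R → ∀ x ∈ G,
    ∀ n : ℤ, n = 1 ∨ n = -1 → ε < ‖γ t - (x + (n : ℝ) • lat k)‖
  av : ∀ R, ∃ ε > 0, ∀ γ, EC M α (transl σ α) ε γ → γ 0 ∈ G → ∀ t, |t| ≤ R →
    γ t ∉ range α ∧ γ t ∉ range (transl σ α)

namespace Setup

variable {α c : ℝ → Plane} {k σ : ℤ × ℤ} {A a b η : ℝ}

lemma Last.eq (S : Setup M α c k σ A a b η) {L L' : ℝ → Plane}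
    (hL' : Last M α c k σ a b L') (hL : EC M α (transl σ α) 0 L) {u : ℝ} (h : L' 0 = L u) :
    Last M α c k σ a b fun t => L (t + u) := by
  have := EC.eq_of_eq S.ax S.ax₁ hL'.ec (hL.comp_add u) (θ := 0) (by simpa using h)
  rwa [← this]

/-- Minimal curves starting near `Q` meet `Q`. -/
lemma exists_rho (S : Setup M α c k σ A a b η) :
    ∃ ρ > 0, ∀ L, EC M α (transl σ α) 0 L → L 0 ∈ Metric.cthickening ρ (Q M α c k σ a b) →
      ∃ u, L u ∈ Q M α c k σ a b := by
  by_contra! hcon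
  choose L hL hL0 hLQ using fun n : ℕ => hcon (1 / ((n : ℝ) + 1)) (by positivity)
  have hQ := S.isCompact_Q
  have hK : IsCompact (Metric.cthickening 1 (Q M α c k σ a b)) := hQ.cthickening
  have hLK : ∀ n, L n 0 ∈ Metric.cthickening 1 (Q M α c k σ a b) := fun n =>
    Metric.cthickening_mono (by
      rw [div_le_one (by positivity)]; linarith [n.cast_nonneg (α := ℝ)]) _ (hL0 n)
  obtain ⟨B, hB⟩ := hK.isBounded.exists_norm_le
  obtain ⟨L', hL', hlim⟩ := EC.exists_limit S.ax S.ax₁ hL tendsto_const_nhds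
    fun n => hB _ (hLK n)
  have h0 : L' 0 ∈ Q M α c k σ a b := by
    rw [hQ.isClosed.mem_iff_infDist_zero S.nonempty_Q]
    refine le_antisymm ?_ Metric.infDist_nonneg
    refine le_of_tendsto_of_tendsto ((Metric.continuous_infDist_pt _).tendsto _ |>.comp (hlim 0))
      (tendsto_one_div_add_atTop_nhds_zero_nat.mono_left Nat.hyperfilter_le_atTop)
      (Eventually.of_forall fun n => ?_)
    have := hL0 n
    rw [Metric.mem_cthickening_iff] at this
    exact ENNReal.toReal_le_of_le_ofReal (by positivity) this
  obtain ⟨L₁, hL₁, h1⟩ := h0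
  have hlast := hL₁.eq S hL' h1
  simp only [add_zero] at hlast
  obtain ⟨t₀, ht₀, h2⟩ := hlast.exists_mem_Ioo S
  have hst := stab (fun n => (hL n).lip) S.cl (hL'.locIso S.ax S.ax₁) hlim h2
    (S.crossDet_ne_zero hL' h2) (ε := min (t₀ - a) (b - t₀))
    (lt_min (by linarith [ht₀.1]) (by linarith [ht₀.2]))
  have hcc : IsCompact (c '' Icc a b) := isCompact_Icc.image S.cl.continuous
  obtain ⟨B', hB'⟩ := hcc.isBounded.exists_norm_le
  set V := M.up * (B + (B' + ‖lat k‖)) with hV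
  have key : ∀ n, ∃ v s, (∃ u t, |t - t₀| < min (t₀ - a) (b - t₀) ∧ L n u = c t) →
      v ∈ Icc (-V) V ∧ s ∈ Icc a b ∧ L n v = c s + lat k := by
    intro n
    by_cases h : ∃ u t, |t - t₀| < min (t₀ - a) (b - t₀) ∧ L n u = c t
    swap
    · exact ⟨0, 0, fun h' => absurd h' h⟩
    obtain ⟨u, t, ht, hu⟩ := h
    have hta : t ∈ Icc a b := by
      have h3 := abs_lt.1 (ht.trans_le (min_le_left _ _))
      have h4 := abs_lt.1 (ht.trans_le (min_le_right _ _))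
      constructor <;> linarith
    have : ¬ ∀ v, ∀ s ∈ Icc a b, L n (v + u) ≠ c s + lat k := fun hav =>
      hLQ n u ⟨fun v => L n (v + u), ⟨(hL n).comp_add u, ⟨t, hta, by simp [hu]⟩, hav⟩, by simp⟩
    push Not at this
    obtain ⟨v, s, hs, hv⟩ := this
    refine ⟨v + u, s, fun _ => ⟨abs_le.1 ?_, hs, hv⟩⟩
    have h3 := (hL n).isoOn S.ax S.ax₁ 0 (v + u)
    rw [zero_sub, abs_neg] at h3
    rw [← h3]
    refine (dist_le_up _ _).trans (mul_le_mul_of_nonneg_left ?_ M.up_pos.le)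
    refine (norm_sub_le _ _).trans (add_le_add (hB _ (hLK n)) ?_)
    rw [hv]
    exact (norm_add_le _ _).trans (add_le_add_left (hB' _ ⟨s, hs, rfl⟩) _)
  choose v s hvs using key
  have ev : ∀ᶠ n in hyperfilter ℕ, v n ∈ Icc (-V) V ∧ s n ∈ Icc a b ∧ L n (v n) = c (s n) + lat k :=
    hst.mono fun n hn => hvs n hn
  obtain ⟨v', -, hv'⟩ := exists_tendsto_of_isCompact isCompact_Icc (ev.mono fun n h => h.1)
  obtain ⟨s', hs', hs''⟩ := exists_tendsto_of_isCompact isCompact_Icc (ev.mono fun n h => h.2.1)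
  refine hlast.av v' s' hs' (tendsto_nhds_unique (tendsto_apply (fun n => (hL n).lip) hlim hv') ?_)
  exact (((S.cl.continuous.tendsto _).comp hs'').add_const (lat k)).congr'
    (ev.mono fun n h => h.2.2.symm)

theorem exists_gate (S : Setup M α c k σ A a b η) : ∃ G, Gate M α k σ A G := by
  have hQ := S.isCompact_Q
  have hQa : Q M α c k σ a b ⊆ above k α ∩ below k (transl σ α) := by
    rintro _ ⟨L, hL, rfl⟩
    refine ⟨hL.mem_above S 0, ?_⟩
    obtain ⟨t, ht, h0⟩ := hL.mem
    exact h0 ▸ mem_below_of_lt fun s => S.highc s t ht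
  obtain ⟨ρ₁, hρ₁, h1⟩ := hQ.exists_cthickening_subset_open
    (S.ax.isOpen_above.inter S.ax₁.isOpen_below) hQa
  obtain ⟨ρ₂, hρ₂, h2⟩ := S.exists_rho
  set ρ := min ρ₁ ρ₂ with hρdef
  have hρ : 0 < ρ := lt_min hρ₁ hρ₂
  set G := Metric.cthickening ρ (Q M α c k σ a b) with hGdef
  have hG1 : G ⊆ above k α ∩ below k (transl σ α) :=
    (Metric.cthickening_mono (min_le_left _ _) _).trans h1
  have hG2 : ∀ L, EC M α (transl σ α) 0 L → ∀ t, L t ∈ G →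
      ∃ u, Last M α c k σ a b fun t => L (t + u) := fun L hL t ht => by
    obtain ⟨u, L', hL', hu⟩ := h2 _ (hL.comp_add t)
      (Metric.cthickening_mono (min_le_right ρ₁ ρ₂) _ (by rwa [zero_add]))
    exact ⟨u + t, hL'.eq S hL hu⟩
  have hGc : IsCompact G := hQ.cthickening
  have hQG : Q M α c k σ a b ⊆ interior G :=
    (Metric.self_subset_thickening hρ _).trans (interior_maximal
      (Metric.thickening_subset_cthickening _ _) Metric.isOpen_thickening)
  obtain ⟨B, hB⟩ := hGc.isBounded.exists_norm_le
  have hpos : ∀ n : ℕ, 0 < 1 / ((n : ℝ) + 1) := fun n => by positivity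
  have hlim : ∀ γ : ℕ → ℝ → Plane, (∀ n : ℕ, EC M α (transl σ α) (1 / ((n : ℝ) + 1)) (γ n)) →
      (∀ n, γ n 0 ∈ G) → ∃ L, EC M α (transl σ α) 0 L ∧ L 0 ∈ G ∧
        ∀ t, Tendsto (fun n => γ n t) (hyperfilter ℕ) (𝓝 (L t)) := fun γ h h0 => by
    obtain ⟨L, hL, hl⟩ := EC.exists_limit S.ax S.ax₁ h tendsto_one_div_add_atTop_nhds_zero_nat
      fun n => hB _ (h0 n)
    exact ⟨L, hL, hGc.isClosed.mem_of_tendsto (hl 0) (Eventually.of_forall h0), hl⟩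
  have htend : Tendsto (fun n : ℕ => 1 / ((n : ℝ) + 1)) (hyperfilter ℕ) (𝓝 0) :=
    tendsto_one_div_add_atTop_nhds_zero_nat.mono_left Nat.hyperfilter_le_atTop
  refine ⟨G, S.ax, hGc, fun x hx => (hG1 hx).1, fun x hx => (hG1 hx).2, ?_, ?_, ?_, ?_⟩
  · obtain ⟨x, hx⟩ := S.nonempty_Q
    refine ⟨x, interior_subset (hQG hx), ?_⟩
    obtain ⟨L, hL, rfl⟩ := hx
    have := hL.ec.ec 0 0 le_rfl
    linarith
  · by_contra! hcon
    choose γ h1 h2 h3 using fun n : ℕ => hcon _ (hpos n)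
    obtain ⟨L, hL, hL0, hl⟩ := hlim γ h1 h2
    obtain ⟨u, hu⟩ := hG2 L hL 0 hL0
    have : L u ∈ interior G := hQG ⟨_, hu, by simp⟩
    obtain ⟨n, hn⟩ := ((hl u).eventually (isOpen_interior.mem_nhds this)).exists
    exact h3 n u hn
  · intro R
    by_contra! hcon
    choose γ h1 h2 t ht x hx j hj hle using fun n : ℕ => hcon _ (hpos n)
    obtain ⟨L, hL, hL0, hl⟩ := hlim γ h1 h2
    obtain ⟨t', -, ht'⟩ := exists_tendsto_of_isCompact (isCompact_Icc (a := -R) (b := R))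
      (Eventually.of_forall fun n => abs_le.1 (ht n))
    obtain ⟨x', hx', hxl⟩ := exists_tendsto_of_isCompact hGc (Eventually.of_forall hx)
    obtain ⟨j', hj', hjl⟩ := exists_tendsto_of_isCompact (K := ({1, -1} : Set ℤ))
      (toFinite _).isCompact (Eventually.of_forall hj)
    have h3 : L t' - (x' + (j' : ℝ) • lat k) = 0 := by
      have hz : Tendsto (fun n => γ n (t n) - (x n + (j n : ℝ) • lat k)) (hyperfilter ℕ) (𝓝 0) :=
        squeeze_zero_norm hle htend
      refine tendsto_nhds_unique ((tendsto_apply (fun n => (h1 n).lip) hl ht').sub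
        (hxl.add (Tendsto.smul_const ?_ _))) hz
      exact (continuous_of_discreteTopology.tendsto j').comp hjl
    obtain ⟨u, hu⟩ := hG2 L hL 0 hL0
    obtain ⟨u', hu'⟩ := hG2 _ (hL.add_lat S.ax S.ax₁ (-j')) t' (by
      convert hx' using 1
      rw [sub_eq_zero] at h3
      rw [h3]; push_cast; rw [neg_smul]; abel)
    obtain ⟨s, hs, hs'⟩ := hu.mem
    obtain ⟨s₁, hs₁, hs₁'⟩ := hu'.mem
    rcases hj' with rfl | rfl
    · refine hu.av (u' - u) s₁ hs₁ ?_
      rw [hs₁']; simp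
    · refine hu'.av (u - u') s hs ?_
      rw [hs']; simp
  · intro R
    by_contra! hcon
    choose γ h1 h2 t ht hh using fun n : ℕ => hcon _ (hpos n)
    obtain ⟨L, hL, hL0, hl⟩ := hlim γ h1 h2
    obtain ⟨t', -, ht'⟩ := exists_tendsto_of_isCompact (isCompact_Icc (a := -R) (b := R))
      (Eventually.of_forall fun n => abs_le.1 (ht n))
    have h3 : L t' ∈ range α ∪ range (transl σ α) :=
      (S.ax.isClosed_range.union S.ax₁.isClosed_range).mem_of_tendsto
        (tendsto_apply (fun n => (h1 n).lip) hl ht')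
        (Eventually.of_forall fun n => or_iff_not_imp_left.2 (hh n))
    rcases h3 with h3 | h3
    · obtain ⟨s, hs⟩ := S.eq_shift hL h3
      exact not_mem_of_mem_above (hG1 hL0).1 (hs 0 ▸ mem_range_self _)
    · obtain ⟨s, hs⟩ := S.eq_shift₁ hL h3
      exact not_mem_of_mem_below (hG1 hL0).2 (hs 0 ▸ mem_range_self _)

end Setup

end TorusMetric

namespace TorusMetric

attribute [local irreducible] TorusMetric.dist

variable {M : TorusMetric}

lemma exists_le_lt_succ {f : ℤ → ℝ} (hf : Tendsto f atTop atTop) (hf' : Tendsto f atBot atBot)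
    (t : ℝ) : ∃ i, f i ≤ t ∧ t < f (i + 1) := by
  obtain ⟨j, hj⟩ := eventually_atTop.1 (hf.eventually_gt_atTop t)
  obtain ⟨i, hi⟩ := (hf'.eventually_le_atBot t).exists
  obtain ⟨n, hn, hmax⟩ := Int.exists_greatest_of_bdd (P := fun i => f i ≤ t)
    ⟨j, fun i hi => by
      by_contra! h
      exact absurd (hj i h.le) (not_lt.2 hi)⟩ ⟨i, hi⟩
  refine ⟨n, hn, ?_⟩
  by_contra! h
  have := hmax _ h
  omega

lemma exists_partial_sums {E : Type*} [AddCommGroup E] (d : ℤ → E) :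
    ∃ θ : ℤ → E, θ 0 = 0 ∧ ∀ i, θ (i + 1) - θ i = d i := by
  refine ⟨fun i => ∑ j ∈ Finset.range i.toNat, d j - ∑ j ∈ Finset.range (-i).toNat, d (-j - 1),
    by simp, fun i => ?_⟩
  rcases le_or_gt 0 i with h | h
  · obtain ⟨n, rfl⟩ := Int.eq_ofNat_of_zero_le h
    have h1 : ((n : ℤ) + 1).toNat = n + 1 := by omega
    have h2 : (-((n : ℤ) + 1)).toNat = 0 := by omega
    have h3 : (-(n : ℤ)).toNat = 0 := by omega
    simp only [h1, h2, h3, Finset.sum_range_succ, Finset.range_zero, Finset.sum_empty, Int.toNat_natCast]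
    abel
  · obtain ⟨n, hn⟩ := Int.eq_ofNat_of_zero_le (show 0 ≤ -i - 1 by omega)
    obtain rfl : i = -(n : ℤ) - 1 := by omega
    have h1 : (-(n : ℤ) - 1 + 1).toNat = 0 := by omega
    have h2 : (-(-(n : ℤ) - 1 + 1)).toNat = n := by omega
    have h3 : (-(n : ℤ) - 1).toNat = 0 := by omega
    have h4 : (-(-(n : ℤ) - 1)).toNat = n + 1 := by omega
    simp only [h1, h2, h3, h4, Finset.sum_range_succ, Finset.range_zero, Finset.sum_empty]
    abel

lemma add_le_of_one_le_sub {θ : ℤ → ℝ} (h : ∀ i, 1 ≤ θ (i + 1) - θ i) (i : ℤ) (n : ℕ) :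
    θ i + n ≤ θ (i + n) := by
  induction n with
  | zero => simp
  | succ n ih =>
    have := h (i + n)
    rw [show i + ((n + 1 : ℕ) : ℤ) = i + n + 1 by push_cast; ring]
    push_cast
    linarith

/-- Concatenation of infinitely many minimal segments. -/
lemma exists_concat {Y : ℤ → Plane} (hY : ∀ i, 1 ≤ M.dist (Y i) (Y (i + 1))) :
    ∃ (γ : ℝ → Plane) (θ : ℤ → ℝ), M.Lip1 γ ∧ (∀ i, γ (θ i) = Y i) ∧ θ 0 = 0 ∧
      ∀ i, θ (i + 1) - θ i = M.dist (Y i) (Y (i + 1)) := by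
  obtain ⟨θ, hθ0, hθ⟩ := exists_partial_sums fun i => M.dist (Y i) (Y (i + 1))
  have hge := add_le_of_one_le_sub fun i => (hθ i).symm ▸ hY i
  have hmono : StrictMono θ := strictMono_int_of_lt_succ fun i => by linarith [hθ i, hY i]
  have htop : Tendsto θ atTop atTop := by
    refine tendsto_atTop_mono' _ ?_ tendsto_intCast_atTop_atTop
    filter_upwards [eventually_ge_atTop 0] with i hi
    obtain ⟨n, rfl⟩ := Int.eq_ofNat_of_zero_le hi
    simpa [hθ0] using hge 0 n
  have hbot : Tendsto θ atBot atBot := by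
    refine tendsto_atBot_mono' _ ?_ (tendsto_intCast_atBot_iff.2 tendsto_id)
    filter_upwards [eventually_le_atBot 0] with i hi
    obtain ⟨n, hn⟩ := Int.eq_ofNat_of_zero_le (neg_nonneg.2 hi)
    obtain rfl : i = -n := by omega
    have := hge (-n) n
    rw [neg_add_cancel, hθ0] at this
    show θ (-(n : ℤ)) ≤ ((-(n : ℤ) : ℤ) : ℝ)
    push_cast
    linarith
  choose ι hι hι' using exists_le_lt_succ htop hbot
  choose ζ hζ hζ0 hζ1 using fun i => M.exists_minimizer (Y i) (Y (i + 1))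
  set γ : ℝ → Plane := fun t => ζ (ι t) (t - θ (ι t)) with hγ
  have hιθ : ∀ i t, θ i ≤ t → t < θ (i + 1) → ι t = i := fun i t h1 h2 => by
    have h3 := hmono.lt_iff_lt.1 ((hι t).trans_lt h2)
    have h4 := hmono.lt_iff_lt.1 (h1.trans_lt (hι' t))
    omega
  have hθY : ∀ i, γ (θ i) = Y i := fun i => by
    simp only [hγ, hιθ i (θ i) le_rfl (hmono (by omega)), sub_self, hζ0]
  have hpiece : ∀ i t, θ i ≤ t → t ≤ θ (i + 1) → γ t = ζ i (t - θ i) := fun i t h1 h2 => by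
    rcases h2.lt_or_eq with h2 | rfl
    · simp only [hγ, hιθ i t h1 h2]
    · rw [hθY, hθ, hζ1]
  have hlip : ∀ (i : ℤ) (n : ℕ) (s t : ℝ), θ i ≤ s → s ≤ t → t ≤ θ (i + n) →
      M.dist (γ s) (γ t) ≤ t - s := by
    intro i n
    induction n with
    | zero =>
      intro s t h1 h2 h3
      obtain rfl : s = t := le_antisymm h2 (by simpa using h3.trans (by simpa using h1))
      simp
    | succ n ih =>
      intro s t h1 h2 h3
      push_cast at h3
      rw [← add_assoc] at h3
      have hp : ∀ s t, θ (i + n) ≤ s → s ≤ t → t ≤ θ (i + n + 1) → M.dist (γ s) (γ t) ≤ t - s :=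
        fun s t h1 h2 h3 => by
          rw [hpiece _ s h1 (h2.trans h3), hpiece _ t (h1.trans h2) h3]
          exact ((hζ _).dist_le_sub (by linarith)).trans (by linarith)
      rcases le_total t (θ (i + n)) with h4 | h4
      · exact ih s t h1 h2 h4
      rcases le_total (θ (i + n)) s with h5 | h5
      · exact hp s t h5 h2 h3
      have h6 := ih s _ h1 h5 le_rfl
      have h7 := hp _ t le_rfl h4 h3
      linarith [dist_triangle (M := M) (γ s) (γ (θ (i + n))) (γ t)]
  have hlip' : ∀ s t, s ≤ t → M.dist (γ s) (γ t) ≤ t - s := fun s t hst => by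
    obtain ⟨n, hn⟩ := Int.eq_ofNat_of_zero_le (show 0 ≤ ι t + 1 - ι s by
      have := hmono.lt_iff_lt.1 ((hι s).trans_lt (hst.trans_lt (hι' t)))
      omega)
    refine hlip (ι s) n s t (hι s) hst ?_
    rw [show ι s + (n : ℤ) = ι t + 1 by omega]
    exact (hι' t).le
  refine ⟨γ, θ, fun s t => ?_, hθY, hθ0, hθ⟩
  rcases le_total s t with h | h
  · rw [abs_sub_comm, abs_of_nonneg (sub_nonneg.2 h)]; exact hlip' s t h
  · rw [dist_comm, abs_of_nonneg (sub_nonneg.2 h)]; exact hlip' t s h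

/-- A bi-infinite sequence in a compact set minimizing a sum of nearest neighbour interactions
with respect to finite modifications. -/
lemma exists_locally_minimal {X : Type*} [TopologicalSpace X] {G : Set X} (hG : IsCompact G)
    (hne : G.Nonempty)
    {F : ℤ → X → X → ℝ} (hF : ∀ i, Continuous fun z : X × X => F i z.1 z.2) :
    ∃ g : ℤ → X, (∀ i, g i ∈ G) ∧ ∀ i, ∀ x ∈ G, ∀ y ∈ G,
      F i (g i) (g (i + 1)) + F (i + 1) (g (i + 1)) (g (i + 2)) +
        F (i + 2) (g (i + 2)) (g (i + 3)) ≤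
      F i (g i) x + F (i + 1) x y + F (i + 2) y (g (i + 3)) := by
  have hK : IsCompact (univ.pi fun _ : ℤ => G) := isCompact_univ_pi fun _ => hG
  have hcont : ∀ i j l : ℤ, Continuous fun g : ℤ → X => F i (g j) (g l) := fun i j l =>
    (hF i).comp (f := fun g : ℤ → X => (g j, g l)) ((continuous_apply j).prodMk (continuous_apply l))
  choose g hgK hg using fun n : ℕ => hK.exists_isMinOn (univ_pi_nonempty_iff.2 fun _ => hne)
    (continuous_finsetSum (Finset.Ico (-n : ℤ) n) fun i _ => hcont i i (i + 1)).continuousOn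
  obtain ⟨g', hg', hlim⟩ := exists_tendsto_of_isCompact hK (Eventually.of_forall hgK)
  refine ⟨g', fun i => hg' i trivial, fun i x hx y hy => ?_⟩
  have hlim' : ∀ j, Tendsto (fun n => g n j) (hyperfilter ℕ) (𝓝 (g' j)) :=
    fun j => tendsto_pi_nhds.1 hlim j
  have hT : ∀ (j : ℤ) {p q : ℕ → X} {p' q' : X}, Tendsto p (hyperfilter ℕ) (𝓝 p') →
      Tendsto q (hyperfilter ℕ) (𝓝 q') →
      Tendsto (fun n => F j (p n) (q n)) (hyperfilter ℕ) (𝓝 (F j p' q')) :=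
    fun j p q p' q' hp hq => ((hF j).tendsto (p', q')).comp (hp.prodMk_nhds hq)
  refine le_of_tendsto_of_tendsto
    (((hT i (hlim' i) (hlim' (i + 1))).add (hT (i + 1) (hlim' (i + 1)) (hlim' (i + 2)))).add
      (hT (i + 2) (hlim' (i + 2)) (hlim' (i + 3))))
    (((hT i (hlim' i) (tendsto_const_nhds (x := x))).add tendsto_const_nhds).add
      (hT (i + 2) (tendsto_const_nhds (x := y)) (hlim' (i + 3)))) ?_
  have hev : ∀ᶠ n : ℕ in atTop, -(n : ℤ) ≤ i ∧ i + 3 ≤ n := by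
    filter_upwards [eventually_ge_atTop (i.natAbs + 3)] with n hn
    omega
  filter_upwards [Nat.hyperfilter_le_atTop hev] with n hn
  set h : ℤ → X := Function.update (Function.update (g n) (i + 1) x) (i + 2) y with hh
  have e0 : ∀ j, j ≠ i + 1 → j ≠ i + 2 → h j = g n j := fun j h1 h2 => by
    rw [hh, Function.update_of_ne h2, Function.update_of_ne h1]
  have e1 : h (i + 1) = x := by
    rw [hh, Function.update_of_ne (by omega), Function.update_self]
  have e2 : h (i + 2) = y := by rw [hh, Function.update_self]
  have hle := hg n (show h ∈ univ.pi fun _ : ℤ => G from fun j _ => by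
    by_cases h2 : j = i + 2
    · subst h2; rwa [e2]
    by_cases h1 : j = i + 1
    · subst h1; rwa [e1]
    rw [e0 j h1 h2]; exact hgK n j trivial)
  have hsub := Finset.sum_subset (s₁ := {i, i + 1, i + 2}) (s₂ := Finset.Ico (-n : ℤ) n)
    (f := fun j => F j (h j) (h (j + 1)) - F j (g n j) (g n (j + 1)))
    (fun j hj => by
      simp only [Finset.mem_insert, Finset.mem_singleton] at hj
      rw [Finset.mem_Ico]; omega)
    (fun j _ hj => by
      simp only [Finset.mem_insert, Finset.mem_singleton, not_or] at hj
      rw [e0 j hj.2.1 hj.2.2, e0 (j + 1) (by omega) (by omega), sub_self])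
  rw [Finset.sum_insert (by simp), Finset.sum_pair (by omega), Finset.sum_sub_distrib] at hsub
  simp only [show i + 1 + 1 = i + 2 by ring, show i + 2 + 1 = i + 3 by ring, e1, e2,
    e0 i (by omega) (by omega), e0 (i + 3) (by omega) (by omega)] at hsub
  have : ∑ j ∈ Finset.Ico (-n : ℤ) n, F j (g n j) (g n (j + 1)) ≤
    ∑ j ∈ Finset.Ico (-n : ℤ) n, F j (h j) (h (j + 1)) := hle
  linarith

lemma dist_add_smul_lat (x y : Plane) (n : ℤ) (k : ℤ × ℤ) :
    M.dist (x + (n : ℝ) • lat k) (y + (n : ℝ) • lat k) = M.dist x y := by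
  rw [← lat_zsmul, dist_add_lat]

lemma add_mem_above_transl {k : ℤ × ℤ} {α : ℝ → Plane} {x : Plane} (hx : x ∈ above k α)
    (l : ℤ × ℤ) : x + lat l ∈ above k (transl l α) := by
  obtain ⟨y, hy, hxy⟩ := hx
  refine ⟨y + lat l, fun s => ?_, ?_⟩
  · rw [transl, ht_add, ht_add]; linarith [hy s]
  · refine (hxy.map (f := fun z => z + lat l) (by fun_prop)).mono ?_
    rintro _ ⟨z, hz, rfl⟩ ⟨s, hs⟩
    exact hz ⟨s, add_right_cancel hs⟩

lemma Lip1.isoOn {γ : ℝ → Plane} (h : M.Lip1 γ) {a b : ℝ} (hd : b - a ≤ M.dist (γ a) (γ b)) :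
    M.IsoOn γ (Icc a b) := by
  have key : ∀ s t, a ≤ s → s ≤ t → t ≤ b → M.dist (γ s) (γ t) = t - s := fun s t h1 h2 h3 => by
    refine le_antisymm (h.dist_le_sub h2) ?_
    have e1 := h.dist_le_sub h1
    have e2 := h.dist_le_sub h3
    linarith [dist_triangle (M := M) (γ a) (γ s) (γ b), dist_triangle (M := M) (γ s) (γ t) (γ b)]
  intro s hs t ht
  rcases le_total s t with h1 | h1
  · rw [abs_sub_comm, abs_of_nonneg (sub_nonneg.2 h1)]; exact key s t hs.1 h1 ht.2
  · rw [dist_comm, abs_of_nonneg (sub_nonneg.2 h1)]; exact key t s ht.1 h1 hs.2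

namespace Gate

variable {α : ℝ → Plane} {k σ : ℤ × ℤ} {A : ℝ} {G : Set Plane}

lemma ax₁ (hG : Gate M α k σ A G) : M.Axis (transl σ α) k A := hG.ax.add_lat σ

lemma nonempty (hG : Gate M α k σ A G) : G.Nonempty :=
  let ⟨z, hz, _⟩ := hG.exists_le
  ⟨z, hz⟩

lemma not_mem_range (hG : Gate M α k σ A G) {x : Plane} (hx : x ∈ G) : x ∉ range α :=
  not_mem_of_mem_above (hG.above hx)

lemma not_mem_range₁ (hG : Gate M α k σ A G) {x : Plane} (hx : x ∈ G) : x ∉ range (transl σ α) :=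
  not_mem_of_mem_below (hG.below hx)

lemma exists_dist_le (hG : Gate M α k σ A G) {ε : ℝ} (hε : 0 < ε) :
    ∃ N : ℤ, ∀ m ≥ N, ∀ x ∈ G, ∀ y ∈ G, M.dist x (y + lat σ + (m : ℝ) • lat k) ≤
      M.bar (rev (transl σ α)) x + M.bar α y + m * A + ε := by
  obtain ⟨S, hS⟩ := hG.ax.bar_approx hG.compact (half_pos hε)
  obtain ⟨S', hS'⟩ := hG.ax₁.rev.bar_approx hG.compact (half_pos hε)
  obtain ⟨N, hN⟩ := exists_int_gt ((-S' - S) / A)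
  refine ⟨N, fun m hm x hx y hy => ?_⟩
  have hm' : (N : ℝ) ≤ m := by exact_mod_cast hm
  have hpos := hG.ax.pos
  have h0 : -S' - m * A ≤ S := by
    have := (div_lt_iff₀ hpos).1 hN
    nlinarith
  have h1 := hS' S' le_rfl x hx
  have h2 := hS _ h0 y hy
  have h3 : M.dist (rev (transl σ α) S') (y + lat σ + (m : ℝ) • lat k) =
      M.dist (α (-S' - m * A)) y := by
    have h := hG.ax.per_int m (-S' - m * A)
    rw [sub_add_cancel] at h
    rw [rev, transl, h, add_right_comm, dist_add_smul_lat, dist_add_lat]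
  have h4 := dist_triangle (M := M) x (rev (transl σ α) S') (y + lat σ + (m : ℝ) • lat k)
  rw [dist_comm x (rev _ _), h3] at h4
  linarith

lemma exists_le_dist (hG : Gate M α k σ A G) :
    ∃ N : ℤ, ∀ m ≥ N, ∀ x ∈ G, ∀ y ∈ G, 1 ≤ M.dist x (y + lat σ + (m : ℝ) • lat k) := by
  obtain ⟨p, -, hp⟩ := hG.compact.exists_isMaxOn hG.nonempty hG.ax.continuous_bar.continuousOn
  obtain ⟨q, -, hq⟩ := hG.compact.exists_isMinOn hG.nonempty
    (hG.ax.continuous_bar.comp (continuous_add_const (lat σ))).continuousOn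
  obtain ⟨N, hN⟩ := exists_int_gt ((1 + M.bar α p - M.bar α (q + lat σ)) / A)
  refine ⟨N, fun m hm x hx y hy => ?_⟩
  have hm' : (N : ℝ) ≤ m := by exact_mod_cast hm
  have hpos := hG.ax.pos
  have h0 : 1 + M.bar α p - M.bar α (q + lat σ) ≤ m * A := by
    have := (div_lt_iff₀ hpos).1 hN
    nlinarith
  have h1 := hG.ax.bar_le_add x (y + lat σ + (m : ℝ) • lat k)
  rw [hG.ax.bar_add_lat] at h1
  have h2 : M.bar α x ≤ M.bar α p := hp hx
  have h3 : M.bar α (q + lat σ) ≤ M.bar α (y + lat σ) := hq hy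
  linarith

end Gate

end TorusMetric

namespace TorusMetric

attribute [local irreducible] TorusMetric.dist

variable {M : TorusMetric}

section

variable {α : ℝ → Plane} {k σ : ℤ × ℤ} {A : ℝ} {G : Set Plane} {κ : ℤ → ℤ × ℤ} {γ : ℝ → Plane}
  {θ : ℤ → ℝ}

/-- A concatenation of minimal segments joining translates of `G`, with vertices chosen in an
optimal way. -/
structure PreChain (M : TorusMetric) (G : Set Plane) (κ : ℤ → ℤ × ℤ) (γ : ℝ → Plane)
    (θ : ℤ → ℝ) : Prop where
  lip : M.Lip1 γ
  zero : θ 0 = 0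
  mem : ∀ i, γ (θ i) - lat (κ i) ∈ G
  diff : ∀ i, θ (i + 1) - θ i = M.dist (γ (θ i)) (γ (θ (i + 1)))
  one_le : ∀ i, 1 ≤ θ (i + 1) - θ i
  min_le : ∀ i, ∀ x, x - lat (κ (i + 1)) ∈ G → ∀ y, y - lat (κ (i + 2)) ∈ G →
    θ (i + 3) - θ i ≤ M.dist (γ (θ i)) x + M.dist x y + M.dist y (γ (θ (i + 3)))

lemma exists_preChain (hG : IsCompact G) (hne : G.Nonempty)
    (hκ : ∀ i, ∀ x ∈ G, ∀ y ∈ G, 1 ≤ M.dist (x + lat (κ i)) (y + lat (κ (i + 1)))) :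
    ∃ γ θ, PreChain M G κ γ θ := by
  obtain ⟨g, hg, hmin⟩ := exists_locally_minimal hG hne
    (F := fun i x y => M.dist (x + lat (κ i)) (y + lat (κ (i + 1)))) fun i => by fun_prop
  obtain ⟨γ, θ, hl, hY, h0, hd⟩ := exists_concat (M := M) (Y := fun i => g i + lat (κ i))
    fun i => hκ i _ (hg i) _ (hg _)
  refine ⟨γ, θ, hl, h0, fun i => ?_, fun i => ?_, fun i => ?_, fun i x hx y hy => ?_⟩
  · rw [hY, add_sub_cancel_right]; exact hg i
  · rw [hY, hY, hd]
  · rw [hd]; exact hκ i _ (hg i) _ (hg _)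
  · have h := hmin i _ hx _ hy
    simp only [sub_add_cancel, show i + 1 + 1 = i + 2 by ring, show i + 2 + 1 = i + 3 by ring] at h
    have e1 := hd i
    have e2 := hd (i + 1)
    have e3 := hd (i + 2)
    simp only [show i + 1 + 1 = i + 2 by ring, show i + 2 + 1 = i + 3 by ring] at e2 e3
    rw [hY, hY]
    linarith

namespace PreChain

lemma exists_crossing (hG : Gate M α k σ A G) (P : PreChain M G κ γ θ) {i m : ℤ}
    (hm : κ (i + 1) = κ i + σ + m • k) :
    ∃ c ∈ Icc (θ i) (θ (i + 1)), ∃ s, γ c = α s + lat σ + lat (κ i) := by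
  have h1 := hG.below (P.mem i)
  have h2 : γ (θ (i + 1)) - lat (κ i) ∈ above k (transl σ α) := by
    have := hG.ax₁.add_mem_above (add_mem_above_transl (hG.above (P.mem (i + 1))) σ) m
    convert this using 1
    rw [hm, lat_add, lat_add, lat_zsmul]
    abel
  obtain ⟨c, hc, s, hs⟩ := hG.ax₁.exists_mem_of_below_above
    (γ := fun t => γ t - lat (κ i)) (by have := P.lip.continuous; fun_prop) h1 h2
  rw [uIcc_of_le (by linarith [P.one_le i])] at hc
  exact ⟨c, hc, s, (eq_sub_iff_add_eq.1 hs).symm⟩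

/-- Between two consecutive crossings with translates of the axis, the excess is small. -/
lemma exists_ec (hG : Gate M α k σ A G) (P : PreChain M G κ γ θ) {i m m' : ℤ} {ε : ℝ}
    (hm : κ (i + 1) = κ i + σ + m • k) (hm' : κ (i + 2) = κ (i + 1) + σ + m' • k)
    (hd : ∀ x ∈ G, ∀ y ∈ G, M.dist x (y + lat σ + (m : ℝ) • lat k) ≤
      M.bar (rev (transl σ α)) x + M.bar α y + m * A + ε / 2)
    (hd' : ∀ x ∈ G, ∀ y ∈ G, M.dist x (y + lat σ + (m' : ℝ) • lat k) ≤
      M.bar (rev (transl σ α)) x + M.bar α y + m' * A + ε / 2)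
    {c c' s s' : ℝ} (hc : c ∈ Icc (θ i) (θ (i + 1))) (hc' : c' ∈ Icc (θ (i + 1)) (θ (i + 2)))
    (hs : γ c = α s + lat σ + lat (κ i)) (hs' : γ c' = α s' + lat σ + lat (κ (i + 1))) :
    ∃ β, EC M α (transl σ α) ε β ∧
      (∀ r, c ≤ θ (i + 1) + r → θ (i + 1) + r ≤ c' → β r = γ (θ (i + 1) + r) - lat (κ (i + 1))) ∧
      ∀ r, ¬(c < θ (i + 1) + r ∧ θ (i + 1) + r < c') → β r ∈ range α ∪ range (transl σ α) := by
  obtain ⟨z, hz, hz'⟩ := hG.exists_le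
  have k1 : lat (κ (i + 1)) = lat (κ i) + lat σ + (m : ℝ) • lat k := by
    rw [hm, lat_add, lat_add, lat_zsmul]
  have k2 : lat (κ (i + 2)) = lat (κ (i + 1)) + lat σ + (m' : ℝ) • lat k := by
    rw [hm', lat_add, lat_add, lat_zsmul]
  have hg0 := P.mem i
  have hg2 := P.mem (i + 2)
  set g0 := γ (θ i) - lat (κ i) with hg0'
  set g2 := γ (θ (i + 2)) - lat (κ (i + 2)) with hg2'
  have b1 : M.bar α g2 + m' * A - s' ≤ θ (i + 2) - c' := by
    have h1 := P.lip.dist_le_sub hc'.2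
    have h2 := hG.ax.bar_le s' (g2 + (m' : ℝ) • lat k)
    rw [hG.ax.bar_add_lat] at h2
    have h3 : M.dist (γ c') (γ (θ (i + 2))) = M.dist (α s') (g2 + (m' : ℝ) • lat k) := by
      rw [← dist_add_lat (M := M) (α s') _ σ, ← dist_add_lat (M := M) (α s' + lat σ) _ (κ (i + 1)),
        hs', hg2', k2]
      congr 1
      abel
    linarith
  have b0 : M.bar (rev (transl σ α)) g0 + s ≤ c - θ i := by
    have h1 := P.lip.dist_le_sub hc.1
    have h2 := hG.ax₁.rev.bar_le (-s) g0
    have h3 : M.dist (γ (θ i)) (γ c) = M.dist (rev (transl σ α) (-s)) g0 := by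
      rw [dist_comm, ← dist_add_lat (M := M) (rev _ _) _ (κ i), hs, rev, neg_neg, transl, hg0',
        sub_add_cancel]
    linarith
  have hmin := P.min_le i (z + lat (κ (i + 1))) (by rwa [add_sub_cancel_right]) (γ (θ (i + 2))) hg2
  have d2 := P.diff (i + 2)
  rw [show i + 2 + 1 = i + 3 by ring] at d2
  have d0 := hd _ hg0 z hz
  have d1 := hd' z hz _ hg2
  have e0 : M.dist (γ (θ i)) (z + lat (κ (i + 1))) =
      M.dist g0 (z + lat σ + (m : ℝ) • lat k) := by
    rw [← dist_add_lat (M := M) g0 _ (κ i), hg0', k1, sub_add_cancel]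
    congr 1
    abel
  have e1 : M.dist (z + lat (κ (i + 1))) (γ (θ (i + 2))) =
      M.dist z (g2 + lat σ + (m' : ℝ) • lat k) := by
    rw [← dist_add_lat (M := M) z _ (κ (i + 1)), hg2', k2]
    congr 1
    abel
  have hE := EC.of_path hG.ax hG.ax₁ (ζ := fun p => γ (p + c) - lat (κ (i + 1)))
    (s := s - m * A) (t := s') (d := c' - c) (ε := ε)
    (by simpa [sub_eq_add_neg, lat_neg] using (P.lip.comp_add c).add_lat (-κ (i + 1)))
    (by linarith [hc.2, hc'.1])
    (by
      have := hG.ax.per_int m (s - m * A)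
      rw [sub_add_cancel] at this
      rw [zero_add, hs, k1, this]
      abel)
    (by
      rw [sub_add_cancel, hs', transl, add_sub_cancel_right])
    (by linarith)
  refine ⟨_, hE.comp_add (θ (i + 1) - c), fun r h1 h2 => ?_, fun r h => ?_⟩
  · rw [if_pos (by linarith)]
    rcases h1.eq_or_lt with h1 | h1
    · rw [if_pos (by linarith)]
      have h3 := hG.ax.per_int m (s - m * A)
      rw [sub_add_cancel] at h3
      rw [← h1, hs, k1, h3, show r + (θ (i + 1) - c) + (s - m * A) = s - m * A by linarith]
      abel
    · rw [if_neg (by linarith)]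
      congr 2
      ring
  · split_ifs with h1 h2
    · exact Or.inl ⟨_, rfl⟩
    · have h3 : r + (θ (i + 1) - c) + c = c' := by
        by_contra h3
        refine h ⟨by linarith, lt_of_le_of_ne (by linarith) fun h4 => h3 (by linarith)⟩
      rw [h3, hs', add_sub_cancel_right]
      exact Or.inr ⟨s', rfl⟩
    · exact Or.inr ⟨_, rfl⟩

/-- A chain which passes through interior points of the translates of `G` is a geodesic. -/
lemma locIso (P : PreChain M G κ γ θ) {T : ℤ → ℝ} {c : ℤ → ℝ}
    (hc : ∀ i, c i ∈ Icc (θ i) (θ (i + 1))) (hT : ∀ i, T i ∈ Ioo (c i) (c (i + 1)))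
    (hTG : ∀ i, γ (T i) - lat (κ (i + 1)) ∈ interior G) : M.LocIso γ := by
  have htop : Tendsto T atTop atTop := by
    refine tendsto_atTop_mono (fun i => ((hc i).1.trans (hT i).1.le)) ?_
    refine tendsto_atTop_mono' _ ?_ tendsto_intCast_atTop_atTop
    filter_upwards [eventually_ge_atTop 0] with i hi
    obtain ⟨n, rfl⟩ := Int.eq_ofNat_of_zero_le hi
    simpa [P.zero] using add_le_of_one_le_sub P.one_le 0 n
  have hbot : Tendsto T atBot atBot := by
    refine tendsto_atBot_mono (f := fun i : ℤ => θ (i + 2)) (fun i => ?_) ?_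
    · have := (hc (i + 1)).2
      rw [show i + 1 + 1 = i + 2 by ring] at this
      exact (hT i).2.le.trans this
    have : Tendsto θ atBot atBot := by
      refine tendsto_atBot_mono' _ ?_ (tendsto_intCast_atBot_iff.2 tendsto_id)
      filter_upwards [eventually_le_atBot 0] with i hi
      obtain ⟨n, hn⟩ := Int.eq_ofNat_of_zero_le (neg_nonneg.2 hi)
      obtain rfl : i = -n := by omega
      have := add_le_of_one_le_sub P.one_le (-n) n
      rw [neg_add_cancel, P.zero] at this
      show θ (-(n : ℤ)) ≤ ((-(n : ℤ) : ℤ) : ℝ)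
      push_cast
      linarith
    exact this.comp (tendsto_atBot_add_const_right _ 2 tendsto_id)
  intro t
  obtain ⟨i, hi, hi'⟩ := exists_le_lt_succ htop hbot t
  have hγ := P.lip.continuous
  have hev : ∀ᶠ s in 𝓝 (T i), γ s - lat (κ (i + 1)) ∈ interior G :=
    (show Continuous fun s => γ s - lat (κ (i + 1)) by fun_prop).continuousAt
      (isOpen_interior.mem_nhds (hTG i))
  obtain ⟨s, ⟨hsG, hsc⟩, hsT⟩ := ((hev.and (Ioi_mem_nhds (hT i).1)).filter_mono
    (nhdsWithin_le_nhds (s := Iio (T i))) |>.and self_mem_nhdsWithin).exists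
  have h1 : θ i ≤ s := (hc i).1.trans (le_of_lt hsc)
  have h2 : T (i + 1) ≤ θ (i + 3) := by
    have := (hc (i + 2)).2
    have h3 := (hT (i + 1)).2
    rw [show i + 2 + 1 = i + 3 by ring] at this
    rw [show i + 1 + 1 = i + 2 by ring] at h3
    linarith
  have hsT' : s < T i := hsT
  have h4 := P.min_le i (γ s) (interior_subset hsG) (γ (T (i + 1)))
    (by
      have := interior_subset (hTG (i + 1))
      rwa [show i + 1 + 1 = i + 2 by ring] at this)
  have h5 := P.lip.dist_le_sub h1
  have h6 := P.lip.dist_le_sub h2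
  have hiso := P.lip.isoOn (a := s) (b := T (i + 1)) (by linarith)
  refine ⟨min (t - s) (T (i + 1) - t), lt_min (by linarith) (by linarith), hiso.mono fun u hu => ?_⟩
  have := min_le_left (t - s) (T (i + 1) - t)
  have := min_le_right (t - s) (T (i + 1) - t)
  exact ⟨by linarith [hu.1], by linarith [hu.2]⟩

end PreChain

/-- A geodesic passing through translates of `G`, and of excess at most `ε` up to time `R` from
each passage. -/
structure Chain (M : TorusMetric) (α : ℝ → Plane) (σ : ℤ × ℤ) (G : Set Plane) (ε R : ℝ)
    (κ : ℤ → ℤ × ℤ) (γ : ℝ → Plane) (θ : ℤ → ℝ) : Prop where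
  locIso : M.LocIso γ
  zero : θ 0 = 0
  mem : ∀ i, γ (θ i) - lat (κ i) ∈ G
  diff : ∀ i, θ (i + 1) - θ i = M.dist (γ (θ i)) (γ (θ (i + 1)))
  ec : ∀ i, ∃ β, EC M α (transl σ α) ε β ∧ ∀ r, |r| ≤ R → β r = γ (θ i + r) - lat (κ i)

theorem Gate.exists_chain (hG : Gate M α k σ A G) {ε R : ℝ} (hε : 0 < ε)
    (hmeet : ∀ β, EC M α (transl σ α) ε β → β 0 ∈ G → ∃ t, β t ∈ interior G)
    (hav : ∀ β, EC M α (transl σ α) ε β → β 0 ∈ G → ∀ t, |t| ≤ R →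
      β t ∉ range α ∧ β t ∉ range (transl σ α)) :
    ∃ N : ℤ, ∀ κ : ℤ → ℤ × ℤ, (∀ i, ∃ m ≥ N, κ (i + 1) = κ i + σ + m • k) →
      ∃ γ θ, Chain M α σ G ε R κ γ θ := by
  obtain ⟨N₁, hN₁⟩ := hG.exists_dist_le (half_pos hε)
  obtain ⟨N₂, hN₂⟩ := hG.exists_le_dist
  refine ⟨max N₁ N₂, fun κ hκ => ?_⟩
  choose m hm hκm using hκ
  obtain ⟨γ, θ, P⟩ := exists_preChain (κ := κ) hG.compact hG.nonempty fun i x hx y hy => by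
    have := hN₂ _ ((le_max_right _ _).trans (hm i)) x hx y hy
    rw [← dist_add_lat (M := M) x _ (κ i)] at this
    convert this using 2
    rw [hκm, lat_add, lat_add, lat_zsmul]
    abel
  choose c hc s hs using fun i => P.exists_crossing hG (hκm i)
  have hκm' : ∀ i, κ (i + 2) = κ (i + 1) + σ + m (i + 1) • k := fun i => by
    rw [← hκm, show i + 1 + 1 = i + 2 by ring]
  have hc' : ∀ i, c (i + 1) ∈ Icc (θ (i + 1)) (θ (i + 2)) := fun i => by
    rw [show i + 2 = i + 1 + 1 by ring]
    exact hc (i + 1)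
  choose β hβ hβγ hβr using fun i => P.exists_ec hG (hκm i) (hκm' i)
    (hN₁ _ ((le_max_left _ _).trans (hm i))) (hN₁ _ ((le_max_left _ _).trans (hm (i + 1))))
    (hc i) (hc' i) (hs i) (hs (i + 1))
  have hβ0 : ∀ i, β i 0 ∈ G := fun i => by
    rw [hβγ i 0 (by simpa using (hc i).2) (by simpa using (hc' i).1), add_zero]
    exact P.mem _
  have hmem : ∀ i r, β i r ∉ range α → β i r ∉ range (transl σ α) →
      c i < θ (i + 1) + r ∧ θ (i + 1) + r < c (i + 1) := fun i r h1 h2 => by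
    by_contra h
    exact (hβr i r h).elim h1 h2
  have hT : ∀ i, ∃ T ∈ Ioo (c i) (c (i + 1)), γ T - lat (κ (i + 1)) ∈ interior G := fun i => by
    obtain ⟨t, ht⟩ := hmeet _ (hβ i) (hβ0 i)
    have h := hmem i t (hG.not_mem_range (interior_subset ht))
      (hG.not_mem_range₁ (interior_subset ht))
    exact ⟨_, h, by rwa [← hβγ i t h.1.le h.2.le]⟩
  choose T hT hTG using hT
  have hec : ∀ i, ∃ β, EC M α (transl σ α) ε β ∧
      ∀ r, |r| ≤ R → β r = γ (θ (i + 1) + r) - lat (κ (i + 1)) := fun i =>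
    ⟨β i, hβ i, fun r hr => by
      have h := hav _ (hβ i) (hβ0 i) r hr
      have h' := hmem i r h.1 h.2
      exact hβγ i r h'.1.le h'.2.le⟩
  exact ⟨γ, θ, P.locIso hc hT hTG, P.zero, P.mem, P.diff, fun i => by simpa using hec (i - 1)⟩

end

end TorusMetric

namespace TorusMetric

attribute [local irreducible] TorusMetric.dist

variable {M : TorusMetric}

lemma norm_le_norm2 (p : Plane) : ‖p‖ ≤ norm2 p := by
  rw [Prod.norm_def, norm2]
  exact max_le (Real.abs_le_sqrt (by nlinarith [sq_nonneg p.2]))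
    (Real.abs_le_sqrt (by nlinarith [sq_nonneg p.1]))

lemma phaseDist_self_le {ε : ℝ} (hε : 0 ≤ ε) (p : Plane × Plane) : phaseDist p p ≤ ε := by
  refine (csInf_le ⟨0, ?_⟩ ⟨0, ?_⟩ : phaseDist p p ≤ 0).trans hε
  · rintro _ ⟨k, rfl⟩
    exact add_nonneg (Real.sqrt_nonneg _) (Real.sqrt_nonneg _)
  · simp [norm2]

lemma exists_norm_lt_of_phaseDist_lt {p q : Plane × Plane} {δ : ℝ} (h : phaseDist p q < δ) :
    ∃ j, ‖p.1 - q.1 - lat j‖ < δ := by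
  have hne : {r | ∃ j, r = norm2 (p.1 - (q.1 + lat j)) + norm2 (p.2 - q.2)}.Nonempty := ⟨_, 0, rfl⟩
  obtain ⟨_, ⟨j, rfl⟩, hj⟩ := exists_lt_of_csInf_lt hne h
  have h1 := norm_le_norm2 (p.1 - (q.1 + lat j))
  have h2 : 0 ≤ norm2 (p.2 - q.2) := Real.sqrt_nonneg _
  refine ⟨j, ?_⟩
  rw [sub_sub]
  linarith

lemma eq_zero_of_norm_lat_lt_one {j : ℤ × ℤ} (h : ‖lat j‖ < 1) : j = 0 := by
  rw [Prod.norm_def, max_lt_iff] at h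
  have h1 := h.1
  have h2 := h.2
  simp only [lat, Real.norm_eq_abs] at h1 h2
  norm_cast at h1 h2
  exact Prod.ext (Int.abs_lt_one_iff.1 h1) (Int.abs_lt_one_iff.1 h2)

/-- Curves which are close on the torus and whose lifts are close initially have close lifts. -/
lemma norm_sub_lt_of_forall_phaseDist_lt {γ γ' : ℝ → Plane} (hγ : Continuous γ)
    (hγ' : Continuous γ') {δ T : ℝ} (hδ : δ ≤ 1 / 4) (h0 : ‖γ 0 - γ' 0‖ < 1 / 4)
    (h : ∀ t ∈ Icc 0 T, phaseDist (γ t, deriv γ t) (γ' t, deriv γ' t) < δ) :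
    ∀ t ∈ Icc 0 T, ‖γ t - γ' t‖ < δ := by
  have key : ∀ t ∈ Icc 0 T, ‖γ t - γ' t‖ ≤ 1 / 4 → ‖γ t - γ' t‖ < δ := fun t ht h1 => by
    obtain ⟨j, hj⟩ := exists_norm_lt_of_phaseDist_lt (h t ht)
    dsimp only at hj
    have hj0 : j = 0 := eq_zero_of_norm_lat_lt_one <| by
      have := norm_sub_le (γ t - γ' t) (γ t - γ' t - lat j)
      rw [sub_sub_cancel] at this
      linarith
    simpa [hj0] using hj
  intro t ht
  refine key t ht (le_of_not_gt fun hlt => ?_)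
  obtain ⟨u, hu, hu'⟩ := intermediate_value_Icc ht.1
    (f := fun t => ‖γ t - γ' t‖) (by fun_prop) (show (1 / 4 : ℝ) ∈ _ from ⟨h0.le, hlt.le⟩)
  dsimp only at hu'
  have := key u ⟨hu.1, hu.2.trans ht.2⟩ hu'.le
  linarith

lemma le_elog {x : ℝ≥0∞} {r : ℝ} (h : ENNReal.ofReal (Real.exp r) ≤ x) : (r : EReal) ≤ elog x := by
  have hpos : 0 < x := (ENNReal.ofReal_pos.2 (Real.exp_pos r)).trans_le h
  unfold elog
  split_ifs with h1 h2
  · exact absurd h1 hpos.ne'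
  · exact le_top
  · rw [EReal.coe_le_coe_iff, Real.le_log_iff_exp_le (ENNReal.toReal_pos h1 h2)]
    exact (ENNReal.ofReal_le_iff_le_toReal h2).1 h

/-- Exponential growth of separated sets gives positive entropy. -/
lemma topEnt_pos_of_exponential {ε B C : ℝ} (hε : 0 < ε) (hB : 0 < B) (hC : 0 < C)
    (h : ∀ K : ℕ, ∃ F, IsSeparated M ε (B * K) F ∧ (2 : ℝ) ^ K / C ≤ F.card) : 0 < topEnt M := by
  have hlog := Real.log_pos one_lt_two
  have hfreq : ∃ᶠ T : ℝ in atTop, ((Real.log 2 / (2 * B) : ℝ) : EReal) ≤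
      ((T⁻¹ : ℝ) : EReal) * elog (sepCount M ε T) := by
    have ht : Tendsto (fun K : ℕ => B * K) atTop atTop :=
      tendsto_natCast_atTop_atTop.const_mul_atTop hB
    refine ht.frequently (Eventually.frequently ?_)
    obtain ⟨K₀, hK₀⟩ := exists_nat_gt (2 * Real.log C / Real.log 2)
    filter_upwards [eventually_ge_atTop (K₀ + 1)] with K hK
    obtain ⟨F, hF, hcard⟩ := h K
    have hK' : (K₀ : ℝ) + 1 ≤ K := by exact_mod_cast hK
    have hKpos : (0 : ℝ) < K := by linarith [K₀.cast_nonneg (α := ℝ)]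
    have h1 : (2 * Real.log C) ≤ K * Real.log 2 := by
      rw [div_lt_iff₀ hlog] at hK₀
      nlinarith
    have h2 : ((K * Real.log 2 - Real.log C : ℝ) : EReal) ≤ elog (sepCount M ε (B * K)) := by
      refine le_elog ?_
      rw [Real.exp_sub, Real.exp_log hC, mul_comm, Real.exp_mul, Real.exp_log two_pos,
        Real.rpow_natCast]
      refine (ENNReal.ofReal_le_ofReal hcard).trans ?_
      rw [ENNReal.ofReal_natCast]
      exact le_iSup₂_of_le F hF le_rfl
    have h3 : (0 : EReal) ≤ (((B * K)⁻¹ : ℝ) : EReal) := by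
      exact_mod_cast (inv_pos.2 (mul_pos hB hKpos)).le
    refine le_trans ?_ (mul_le_mul_of_nonneg_left h2 h3)
    rw [← EReal.coe_mul, EReal.coe_le_coe_iff, inv_mul_eq_div, div_le_div_iff₀ (by positivity)
      (by positivity)]
    nlinarith
  refine lt_of_lt_of_le ?_ (le_iSup₂_of_le ε hε (le_limsup_of_frequently_le' hfreq))
  exact_mod_cast (show 0 < Real.log 2 / (2 * B) by positivity)

section

variable {α : ℝ → Plane} {k σ : ℤ × ℤ} {A : ℝ} {G : Set Plane}

lemma Chain.continuous {ε R : ℝ} {κ : ℤ → ℤ × ℤ} {γ : ℝ → Plane} {θ : ℤ → ℝ}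
    (C : Chain M α σ G ε R κ γ θ) : Continuous γ := C.locIso.continuous

/-- Nearby chains which agree up to some index agree at the next one. -/
lemma Chain.step (hG : Gate M α k σ A G) {ε δ D : ℝ} (hε : ε ≤ 1) (hδ : M.up * δ ≤ 1)
    (hD : ∀ x ∈ G, ∀ y ∈ G, ∀ n : ℤ, |n| ≤ 1 → M.dist x (y + (n : ℝ) • lat k) ≤ D)
    (hsep : ∀ β, EC M α (transl σ α) ε β → β 0 ∈ G → ∀ t, |t| ≤ 3 * D + 2 → ∀ x ∈ G,
      ∀ n : ℤ, n = 1 ∨ n = -1 → δ < ‖β t - (x + (n : ℝ) • lat k)‖)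
    {κ κ' : ℤ → ℤ × ℤ} {γ γ' : ℝ → Plane} {θ θ' : ℤ → ℝ}
    (C : Chain M α σ G ε (3 * D + 2) κ γ θ) (C' : Chain M α σ G ε (3 * D + 2) κ' γ' θ')
    {j n : ℤ} (hn : |n| ≤ 1) (hκ : κ j = κ' j) (hκ' : κ (j + 1) = κ' (j + 1) + n • k)
    (hθ : |θ j - θ' j| ≤ D + 2) (hc : ‖γ (θ' (j + 1)) - γ' (θ' (j + 1))‖ ≤ δ) :
    n = 0 ∧ |θ (j + 1) - θ' (j + 1)| ≤ D + 2 := by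
  have e1 : M.dist (γ (θ j)) (γ' (θ' j)) ≤ D := by
    have := hD _ (C.mem j) _ (C'.mem j) 0 (by simp)
    rwa [Int.cast_zero, zero_smul, add_zero, hκ, dist_sub_lat] at this
  have e2 : M.dist (γ (θ (j + 1))) (γ' (θ' (j + 1))) ≤ D := by
    have := hD _ (C.mem (j + 1)) _ (C'.mem (j + 1)) (-n) (by rwa [abs_neg])
    rw [← dist_add_lat (M := M) _ _ (κ (j + 1)), sub_add_cancel, hκ', lat_add, lat_zsmul] at this
    convert this using 2
    push_cast
    rw [neg_smul]
    abel
  have h1 := abs_dist_sub_dist_le (M := M) (γ (θ j)) (γ (θ (j + 1))) (γ' (θ' j)) (γ' (θ' (j + 1)))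
  rw [← C.diff, ← C'.diff] at h1
  have hr : |θ' (j + 1) - θ (j + 1)| ≤ 3 * D + 2 := by
    rw [abs_le] at *
    constructor <;> linarith [h1.1, h1.2, hθ.1, hθ.2]
  obtain ⟨β, hβ, hβγ⟩ := C.ec (j + 1)
  have hD0 : 0 ≤ 3 * D + 2 := (abs_nonneg _).trans hr
  have b0 := hβγ 0 (by simpa using hD0)
  have br := hβγ _ hr
  rw [add_zero] at b0
  rw [add_sub_cancel] at br
  have hβ0 : β 0 ∈ G := b0 ▸ C.mem (j + 1)
  have hn0 : n = 0 := by
    by_contra hn0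
    have hn1 : -n = 1 ∨ -n = -1 := by
      rw [abs_le] at hn
      omega
    have h2 := hsep β hβ hβ0 _ hr _ (C'.mem (j + 1)) (-n) hn1
    have h3 : β (θ' (j + 1) - θ (j + 1)) -
        (γ' (θ' (j + 1)) - lat (κ' (j + 1)) + ((-n : ℤ) : ℝ) • lat k) =
        γ (θ' (j + 1)) - γ' (θ' (j + 1)) := by
      rw [br, hκ', lat_add, lat_zsmul]
      push_cast
      rw [neg_smul]
      abel
    rw [h3] at h2
    exact h2.not_ge hc
  refine ⟨hn0, ?_⟩
  have h2 := hβ.sub_le_dist hG.ax hG.ax₁ 0 (θ' (j + 1) - θ (j + 1))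
  rw [zero_sub, abs_neg, b0, br, dist_sub_lat, abs_sub_comm] at h2
  have h3 := dist_triangle (M := M) (γ (θ (j + 1))) (γ' (θ' (j + 1))) (γ (θ' (j + 1)))
  have h4 := dist_le_up (M := M) (γ' (θ' (j + 1))) (γ (θ' (j + 1)))
  rw [norm_sub_rev] at h4
  have h5 := mul_le_mul_of_nonneg_left hc M.up_pos.le
  linarith

lemma Gate.exists_dist_bound (hG : Gate M α k σ A G) :
    ∃ D, ∀ x ∈ G, ∀ y ∈ G, ∀ n : ℤ, |n| ≤ 1 → M.dist x (y + (n : ℝ) • lat k) ≤ D := by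
  obtain ⟨b, hb⟩ := hG.compact.isBounded.exists_norm_le
  refine ⟨M.up * (b + (b + ‖lat k‖)), fun x hx y hy n hn => (dist_le_up _ _).trans ?_⟩
  refine mul_le_mul_of_nonneg_left ?_ M.up_pos.le
  refine (norm_sub_le _ _).trans (add_le_add (hb x hx) ((norm_add_le _ _).trans
    (add_le_add (hb y hy) ?_)))
  rw [norm_smul]
  refine mul_le_of_le_one_left (norm_nonneg _) ?_
  rw [Real.norm_eq_abs]
  exact_mod_cast hn

/-- The word `w` as a bi-infinite sequence. -/
def letter {K : ℕ} (w : Fin K → Bool) (i : ℤ) : ℤ :=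
  if h : 0 ≤ i ∧ i < K then (if w ⟨i.toNat, by omega⟩ then 1 else 0) else 0

lemma letter_nonneg {K : ℕ} (w : Fin K → Bool) (i : ℤ) : 0 ≤ letter w i := by
  unfold letter; split_ifs <;> simp

lemma letter_le_one {K : ℕ} (w : Fin K → Bool) (i : ℤ) : letter w i ≤ 1 := by
  unfold letter; split_ifs <;> simp

lemma eq_of_forall_letter_eq {K : ℕ} {w w' : Fin K → Bool}
    (h : ∀ i : ℕ, i < K → letter w i = letter w' i) : w = w' := by
  funext i
  have := h i i.2
  simp only [letter, Nat.cast_nonneg, Nat.cast_lt, i.2, and_self, dif_pos, Int.toNat_natCast,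
    Fin.eta] at this
  cases h1 : w i <;> cases h2 : w' i <;> simp [h1, h2] at this ⊢

theorem Gate.topEnt_pos (hG : Gate M α k σ A G) : 0 < topEnt M := by
  obtain ⟨D, hD⟩ := hG.exists_dist_bound
  obtain ⟨ε₁, hε₁, hmeet⟩ := hG.int
  obtain ⟨ε₂, hε₂, hsep⟩ := hG.sep (3 * D + 2)
  obtain ⟨ε₃, hε₃, hav⟩ := hG.av (3 * D + 2)
  obtain ⟨ε, hε, hεle⟩ : ∃ ε > 0, ε ≤ 1 ∧ ε ≤ ε₁ ∧ ε ≤ ε₂ ∧ ε ≤ ε₃ :=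
    ⟨min 1 (min ε₁ (min ε₂ ε₃)), by positivity, by simp⟩
  obtain ⟨hε1, hεε₁, hεε₂, hεε₃⟩ := hεle
  obtain ⟨δ, hδ, hδle⟩ : ∃ δ > 0, δ ≤ 1 / 4 ∧ δ ≤ ε₂ ∧ δ ≤ 1 / M.up :=
    ⟨min (1 / 4) (min ε₂ (1 / M.up)), by have := M.up_pos; positivity, by simp⟩
  obtain ⟨hδ4, hδε₂, hδup⟩ := hδle
  rw [le_div_iff₀ M.up_pos, mul_comm] at hδup
  obtain ⟨N, hN⟩ := hG.exists_chain (R := 3 * D + 2) hε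
    (fun β hβ => hmeet β (hβ.mono hεε₁)) (fun β hβ => hav β (hβ.mono hεε₃))
  choose κ hκ0 hκ using fun (K : ℕ) (w : Fin K → Bool) =>
    exists_partial_sums fun i => σ + (N + letter w i) • k
  have hκ' : ∀ K w i, κ K w (i + 1) = κ K w i + σ + (N + letter w i) • k := fun K w i => by
    rw [add_assoc, ← hκ K w i]; abel
  choose γ θ C using fun (K : ℕ) (w : Fin K → Bool) =>
    hN (κ K w) fun i => ⟨_, le_add_of_nonneg_right (letter_nonneg w i), hκ' K w i⟩
  obtain ⟨b, hb⟩ := hG.compact.isBounded.exists_norm_le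
  set B : ℝ := M.up * (b + (b + ‖lat σ‖ + (|(N : ℝ)| + 1) * ‖lat k‖)) + 1 with hB
  have hBstep : ∀ K w i, θ K w (i + 1) - θ K w i ≤ B := fun K w i => by
    rw [(C K w).diff, ← dist_sub_lat (M := M) _ _ (κ K w i)]
    refine (dist_le_up _ _).trans ?_
    have h1 := hb _ ((C K w).mem i)
    have h2 := hb _ ((C K w).mem (i + 1))
    have h3 : γ K w (θ K w (i + 1)) - lat (κ K w i) =
        γ K w (θ K w (i + 1)) - lat (κ K w (i + 1)) + lat σ + ((N : ℝ) + letter w i) • lat k := by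
      rw [hκ', lat_add, lat_add, lat_zsmul]
      push_cast
      abel
    have h4 : |(N : ℝ) + letter w i| ≤ |(N : ℝ)| + 1 := by
      refine (abs_add_le _ _).trans (add_le_add le_rfl ?_)
      rw [abs_of_nonneg (by exact_mod_cast letter_nonneg w i)]
      exact_mod_cast letter_le_one w i
    rw [h3, hB]
    refine le_add_of_le_of_nonneg (mul_le_mul_of_nonneg_left ?_ M.up_pos.le) zero_le_one
    refine (norm_sub_le _ _).trans (add_le_add h1 ((norm_add₃_le).trans
      (add_le_add (add_le_add h2 le_rfl) ?_)))
    rw [norm_smul]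
    exact mul_le_mul_of_nonneg_right h4 (norm_nonneg _)
  have hb0 : 0 ≤ b := by
    obtain ⟨x, hx⟩ := hG.nonempty
    exact (norm_nonneg _).trans (hb x hx)
  have hBpos : 0 < B := by
    have := M.up_pos
    positivity
  have hθ0 : ∀ K w (i : ℕ), 0 ≤ θ K w i := fun K w i => by
    induction i with
    | zero => rw [Nat.cast_zero, (C K w).zero]
    | succ i ih =>
      push_cast
      linarith [(C K w).diff i, M.dist_nonneg (γ K w (θ K w i)) (γ K w (θ K w (i + 1)))]
  have hθB : ∀ K w (i : ℕ), θ K w i ≤ B * i := fun K w i => by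
    induction i with
    | zero => rw [Nat.cast_zero, (C K w).zero, Nat.cast_zero, mul_zero]
    | succ i ih =>
      push_cast
      linarith [hBstep K w i]
  have hinj : ∀ K w w', ‖γ K w 0 - γ K w' 0‖ < 1 / 4 →
      (∀ t ∈ Icc 0 (B * K), phaseDist (γ K w t, deriv (γ K w) t) (γ K w' t, deriv (γ K w') t)
        ≤ δ / 2) → w = w' := fun K w w' h0 hclose => by
    have hlift := norm_sub_lt_of_forall_phaseDist_lt (C K w).continuous (C K w').continuous hδ4 h0
      fun t ht => (hclose t ht).trans_lt (half_lt_self hδ)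
    have hind : ∀ j : ℕ, j ≤ K → κ K w j = κ K w' j ∧ |θ K w j - θ K w' j| ≤ D + 2 ∧
        ∀ i < j, letter w i = letter w' i := fun j => by
      induction j with
      | zero =>
        intro _
        have h1 : 0 ≤ D := by
          obtain ⟨x, hx⟩ := hG.nonempty
          exact (M.dist_nonneg _ _).trans (hD x hx x hx 0 (by simp))
        refine ⟨by rw [Nat.cast_zero, hκ0, hκ0], ?_, fun i hi => absurd hi (by omega)⟩
        rw [Nat.cast_zero, (C K w).zero, (C K w').zero, sub_zero, abs_zero]
        linarith
      | succ j ih =>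
        intro hj
        obtain ⟨h1, h2, h3⟩ := ih (by omega)
        have h4 : κ K w (j + 1) = κ K w' (j + 1) + (letter w j - letter w' j) • k := by
          rw [hκ', hκ', h1]
          module
        have hmem : θ K w' (j + 1) ∈ Icc 0 (B * K) := by
          have e1 := hθ0 K w' (j + 1)
          have e2 := hθB K w' (j + 1)
          push_cast at e1 e2
          refine ⟨e1, e2.trans (mul_le_mul_of_nonneg_left ?_ hBpos.le)⟩
          exact_mod_cast hj
        obtain ⟨h5, h6⟩ := Chain.step hG hε1 hδup hD
          (fun β hβ hβ0 t ht x hx n hn =>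
            hδε₂.trans_lt (hsep β (hβ.mono hεε₂) hβ0 t ht x hx n hn))
          (C K w) (C K w') (j := j) (n := letter w j - letter w' j)
          (by
            have := letter_nonneg w j
            have := letter_nonneg w' j
            have := letter_le_one w j
            have := letter_le_one w' j
            rw [abs_le]; omega) h1 h4 h2 (hlift _ hmem).le
        push_cast
        refine ⟨by rw [h4, h5, zero_smul, add_zero], h6, fun i hi => ?_⟩
        rcases (Nat.lt_succ_iff.1 hi).lt_or_eq with hi | rfl
        · exact h3 i hi
        · omega
    exact eq_of_forall_letter_eq (hind K le_rfl).2.2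
  obtain ⟨t, -, htfin, ht⟩ := hG.compact.finite_cover_balls (e := 1 / 8) (by norm_num)
  lift t to Finset Plane using htfin
  have hγ0 : ∀ K w, γ K w 0 ∈ G := fun K w => by
    have := (C K w).mem 0
    rwa [(C K w).zero, hκ0, lat_zero, sub_zero] at this
  have hp : ∀ K w, ∃ x ∈ t, γ K w 0 ∈ Metric.ball x (1 / 8) := fun K w => by
    simpa using ht (hγ0 K w)
  choose p hpt hp using hp
  have htne : t.Nonempty := ⟨_, hpt 0 fun _ => true⟩
  have htpos : (0 : ℝ) < t.card := by exact_mod_cast htne.card_pos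
  refine topEnt_pos_of_exponential (half_pos hδ) hBpos htpos fun K => ?_
  obtain ⟨x, -, hx⟩ := Finset.exists_le_card_fiber_of_nsmul_le_card_of_maps_to
    (s := (Finset.univ : Finset (Fin K → Bool))) (f := p K) (fun w _ => hpt K w) htne
    (b := (2 : ℝ) ^ K / t.card) (by
      rw [nsmul_eq_mul, mul_div_cancel₀ _ htpos.ne']
      simp)
  have hclose : ∀ w w', p K w = x → p K w' = x → ‖γ K w 0 - γ K w' 0‖ < 1 / 4 :=
    fun w w' hw hw' => by
      have h1 := hp K w
      have h2 := hp K w'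
      rw [hw, Metric.mem_ball] at h1
      rw [hw', Metric.mem_ball] at h2
      have h3 := dist_triangle_right (γ K w 0) (γ K w' 0) x
      rw [← _root_.dist_eq_norm]
      linarith
  classical
  refine ⟨(Finset.univ.filter fun w => p K w = x).image (γ K), ⟨fun c hc => ?_, ?_⟩, ?_⟩
  · obtain ⟨w, -, rfl⟩ := Finset.mem_image.1 hc
    exact (C K w).locIso.isGeodesic
  · intro c₁ h₁ c₂ h₂ hne
    obtain ⟨w, hw, rfl⟩ := Finset.mem_image.1 h₁
    obtain ⟨w', hw', rfl⟩ := Finset.mem_image.1 h₂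
    by_contra! hcon
    exact hne (congrArg (γ K) (hinj K w w'
      (hclose w w' (Finset.mem_filter.1 hw).2 (Finset.mem_filter.1 hw').2) hcon))
  · rw [Finset.card_image_of_injOn]
    · exact hx
    · intro w hw w' hw' hww
      have hw := (Finset.mem_filter.1 hw).2
      have hw' := (Finset.mem_filter.1 hw').2
      refine hinj K w w' (hclose w w' hw hw') fun t _ => ?_
      rw [hww]
      exact phaseDist_self_le (half_pos hδ).le _

end

end TorusMetric

/-- Let `(T², g)` be a Riemannian torus, `c : ℝ → ℝ²` a geodesic and `α` a minimal axis
with `c(a), c(b) ∈ α(ℝ)` for some `a < b`.  If there exists a translation element `τ` with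
`τ(α(ℝ)) ∩ α(ℝ) = ∅` such that `τ(α(ℝ))` intersects `c([a,b])` transversally, then the
geodesic flow of `g` has positive topological entropy. -/
theorem stmt9 (M : TorusMetric) (c α : ℝ → ℝ × ℝ) (τ₀ : ℤ × ℤ)
    (hc : M.IsGeodesic c) (hα : IsAxisOf M α τ₀) (hmin : IsMinimal M α)
    (a b : ℝ) (hab : a < b) (ha : c a ∈ Set.range α) (hb : c b ∈ Set.range α)
    (τ : ℤ × ℤ) (hτ : τ ≠ 0)
    (hdisj : Set.range (transl τ α) ∩ Set.range α = ∅)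
    (hcross : (transInter (transl τ α) c Set.univ (Set.Icc a b)).Nonempty) :
    0 < topEnt M := by
  obtain ⟨_, s, -, t, ht, hs, hst, -⟩ := hcross
  obtain ⟨α, k, σ, A, a, b, η, S⟩ := TorusMetric.exists_setup hc hα hmin ha hb (τ := τ)
    (fun u hu => eq_empty_iff_forall_notMem.1 hdisj (α u + lat τ) ⟨⟨u, rfl⟩, hu⟩) ht
    ⟨s, hs.trans hst.symm⟩
  obtain ⟨G, hG⟩ := S.exists_gate
  exact hG.topEnt_pos
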